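/- arXiv:1406.7432 — 2 statements merged into one kernel-verified Lean document; each statement's English description precedes it below -/
import Mathlib

section
/- Let p ∈ (1,∞), s ∈ (0,1), and let w ∈ W^{s,p}(ℝⁿ) be a weak subsolution of the homogeneous problem −L_Φ w = 0 in Ω with boundary datum in W^{s,p}(ℝⁿ). Let B_r(x₀) ⊂ Ω. Then for every σ ∈ (0,1), sup_{B_{σr}(x₀)} w₊ ≤ c (1−σ)^{−np/(p−1)} [ ⨍_{B_r(x₀)} w₊ dx + Tail(w₊; x₀, r/2) ], where w₊ := max{w, 0} and c depends only on n, s, p, Λ. -/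
noncomputable section

open MeasureTheory Metric Set Filter Topology
open scoped ENNReal NNReal

/-- Euclidean space `ℝⁿ`. -/
abbrev Rn (n : ℕ) : Type := EuclideanSpace ℝ (Fin n)

/-- `q_* = max {1, p-1}`. -/
def qStar (p : ℝ) : ℝ := max 1 (p - 1)

/-- `q̄ = min {n(p-1)/(n-s), p}`. -/
def qBar (n : ℕ) (s p : ℝ) : ℝ := min ((n : ℝ) * (p - 1) / ((n : ℝ) - s)) p

/-- Gagliardo seminorm raised to the power `p`, as an `ℝ≥0∞`-valued double integral. -/
def gagliardo (n : ℕ) (s p : ℝ) (O : Set (Rn n)) (v : Rn n → ℝ) : ℝ≥0∞ :=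
  ∫⁻ x in O, ∫⁻ y in O, ENNReal.ofReal (|v x - v y| ^ p / ‖x - y‖ ^ ((n : ℝ) + s * p))

/-- `v ∈ W^{s,p}(O)`. -/
def memWsp (n : ℕ) (s p : ℝ) (O : Set (Rn n)) (v : Rn n → ℝ) : Prop :=
  AEMeasurable v (volume.restrict O) ∧
    (∫⁻ x in O, ENNReal.ofReal (|v x| ^ p)) < ⊤ ∧ gagliardo n s p O v < ⊤

/-- `Tail(v; x₀, r)`. -/
def tailFn (n : ℕ) (s p : ℝ) (v : Rn n → ℝ) (x₀ : Rn n) (r : ℝ) : ℝ≥0∞ :=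
  (ENNReal.ofReal (r ^ (s * p)) *
      ∫⁻ x in (ball x₀ r)ᶜ,
        ENNReal.ofReal (|v x| ^ (p - 1) / ‖x - x₀‖ ^ ((n : ℝ) + s * p))) ^ (1 / (p - 1))

/-- `v ∈ L^{p-1}_{sp}(ℝⁿ)`. -/
def memTailSpace (n : ℕ) (s p : ℝ) (v : Rn n → ℝ) : Prop :=
  AEMeasurable v (volume : Measure (Rn n)) ∧
    (∀ R : ℝ, (∫⁻ x in ball (0 : Rn n) R, ENNReal.ofReal (|v x| ^ (p - 1))) < ⊤) ∧
    ∀ z : Rn n, ∀ r : ℝ, 0 < r → tailFn n s p v z r < ⊤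

/-- `φ ∈ C_0^∞(O)`. -/
def IsTestFun (n : ℕ) (O : Set (Rn n)) (φ : Rn n → ℝ) : Prop :=
  ContDiff ℝ (⊤ : ℕ∞) φ ∧ HasCompactSupport φ ∧ tsupport φ ⊆ O

/-- The nonlocal form `⟨-L_Φ u, φ⟩`. -/
def nonlocalForm (n : ℕ) (Φ : ℝ → ℝ) (K : Rn n → Rn n → ℝ) (u φ : Rn n → ℝ) : ℝ :=
  ∫ x : Rn n, ∫ y : Rn n, Φ (u x - u y) * (φ x - φ y) * K x y

/-- Ellipticity/coercivity bounds on the kernel `K`. -/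
def KernelBounds (n : ℕ) (Λ s p : ℝ) (K : Rn n → Rn n → ℝ) : Prop :=
  Measurable (Function.uncurry K) ∧
    ∀ x y : Rn n, x ≠ y →
      1 / (Λ * ‖x - y‖ ^ ((n : ℝ) + s * p)) ≤ K x y ∧
        K x y ≤ Λ / ‖x - y‖ ^ ((n : ℝ) + s * p)

/-- Structure conditions on `Φ`. -/
def PhiBounds (Λ p : ℝ) (Φ : ℝ → ℝ) : Prop :=
  Continuous Φ ∧ Φ 0 = 0 ∧
    ∀ t : ℝ, |t| ^ p / Λ ≤ Φ t * t ∧ Φ t * t ≤ Λ * |t| ^ p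

/-- `∫ φ dμ` for a signed measure `μ`. -/
def sintegral (n : ℕ) (μ : MeasureTheory.SignedMeasure (Rn n)) (φ : Rn n → ℝ) : ℝ :=
  (∫ x, φ x ∂μ.toJordanDecomposition.posPart) -
    ∫ x, φ x ∂μ.toJordanDecomposition.negPart

/-- Weak (energy) solution of `-L_Φ u = f` in `Ω`, `u = g` on `ℝⁿ ∖ Ω`. -/
def WeakSol (n : ℕ) (Φ : ℝ → ℝ) (K : Rn n → Rn n → ℝ) (s p : ℝ)
    (Ω : Set (Rn n)) (f g u : Rn n → ℝ) : Prop :=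
  memWsp n s p univ u ∧ (∀ᵐ x : Rn n, x ∉ Ω → u x = g x) ∧
    ∀ φ : Rn n → ℝ, IsTestFun n Ω φ → nonlocalForm n Φ K u φ = ∫ x : Rn n, φ x * f x

/-- Weak subsolution of the homogeneous equation `-L_Φ w = 0` in `Ω`. -/
def WeakSubSol (n : ℕ) (Φ : ℝ → ℝ) (K : Rn n → Rn n → ℝ) (s p : ℝ)
    (Ω : Set (Rn n)) (w : Rn n → ℝ) : Prop :=
  memWsp n s p univ w ∧
    ∀ φ : Rn n → ℝ, IsTestFun n Ω φ → (∀ x, 0 ≤ φ x) → nonlocalForm n Φ K w φ ≤ 0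

/-- The approximation properties required of a SOLA. -/
def SOLAApprox (n : ℕ) (Φ : ℝ → ℝ) (K : Rn n → Rn n → ℝ) (s p : ℝ)
    (Ω : Set (Rn n)) (μ : MeasureTheory.SignedMeasure (Rn n)) (g u : Rn n → ℝ)
    (uj μj gj : ℕ → Rn n → ℝ) : Prop :=
  (∀ j, ContDiff ℝ (⊤ : ℕ∞) (μj j) ∧ HasCompactSupport (μj j)) ∧
  (∀ j, ContDiff ℝ (⊤ : ℕ∞) (gj j) ∧ HasCompactSupport (gj j)) ∧
  (∀ j, WeakSol n Φ K s p Ω (μj j) (gj j) (uj j)) ∧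
  (∀ᵐ x : Rn n, Tendsto (fun j => uj j x) atTop (𝓝 (u x))) ∧
  (∀ q : ℝ, qStar p ≤ q → q < qBar n s p → ∀ z : Rn n, ∀ r : ℝ, 0 < r →
    Tendsto (fun j => ∫⁻ x in ball z r, ENNReal.ofReal (|uj j x - u x| ^ q)) atTop (𝓝 0)) ∧
  (∀ φ : Rn n → ℝ, Continuous φ → HasCompactSupport φ → tsupport φ ⊆ Ω →
    Tendsto (fun j => ∫ x : Rn n, φ x * μj j x) atTop (𝓝 (sintegral n μ φ))) ∧
  (∀ z : Rn n, ∀ r : ℝ, 0 < r →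
    Filter.limsup (fun j => ∫⁻ x in ball z r, ENNReal.ofReal |μj j x|) atTop
      ≤ μ.totalVariation (closedBall z r)) ∧
  (∀ z : Rn n, ∀ r : ℝ, 0 < r →
    Tendsto (fun j =>
        (∫⁻ x in ball z r, ENNReal.ofReal (|gj j x - g x| ^ p)) +
          gagliardo n s p (ball z r) (fun x => gj j x - g x)) atTop (𝓝 0) ∧
      Tendsto (fun j => tailFn n s p (fun x => gj j x - g x) z r) atTop (𝓝 0))

/-- SOLA of the Dirichlet problem `-L_Φ u = μ` in `Ω`, `u = g` on `ℝⁿ ∖ Ω`. -/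
def IsSOLA (n : ℕ) (Φ : ℝ → ℝ) (K : Rn n → Rn n → ℝ) (s p : ℝ)
    (Ω : Set (Rn n)) (μ : MeasureTheory.SignedMeasure (Rn n)) (g u : Rn n → ℝ) : Prop :=
  (∀ h q : ℝ, 0 < h → h < s → qStar p ≤ q → q < qBar n s p → memWsp n h q Ω u) ∧
  (∀ φ : Rn n → ℝ, IsTestFun n Ω φ → nonlocalForm n Φ K u φ = sintegral n μ φ) ∧
  (∀ᵐ x : Rn n, x ∉ Ω → u x = g x) ∧
  ∃ uj μj gj : ℕ → Rn n → ℝ, SOLAApprox n Φ K s p Ω μ g u uj μj gj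

/-- Truncated Wolff potential `W^ν_{s,p}(x₀, r)`. -/
def wolff (n : ℕ) (s p : ℝ) (ν : Measure (Rn n)) (x₀ : Rn n) (r : ℝ) : ℝ≥0∞ :=
  ∫⁻ ρ in Ioc (0 : ℝ) r,
    (ν (ball x₀ ρ) / ENNReal.ofReal (ρ ^ ((n : ℝ) - s * p))) ^ (1 / (p - 1)) /
      ENNReal.ofReal ρ

/-- Integral average of `u` over `B_r(x₀)`. -/
def ballAvg (n : ℕ) (u : Rn n → ℝ) (x₀ : Rn n) (r : ℝ) : ℝ :=
  ⨍ x in ball x₀ r, u x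

/-- Local excess `A(f; x₀, r)`. -/
def locExcess (n : ℕ) (p : ℝ) (f : Rn n → ℝ) (x₀ : Rn n) (r : ℝ) : ℝ≥0∞ :=
  ((volume (ball x₀ r))⁻¹ *
      ∫⁻ x in ball x₀ r, ENNReal.ofReal (|f x - ballAvg n f x₀ r| ^ qStar p)) ^ (1 / qStar p)

/-- Global excess `E(f; x₀, r)`. -/
def excess (n : ℕ) (s p : ℝ) (f : Rn n → ℝ) (x₀ : Rn n) (r : ℝ) : ℝ≥0∞ :=
  locExcess n p f x₀ r + tailFn n s p (fun x => f x - ballAvg n f x₀ r) x₀ r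

/-- `g ∈ W^{s,p}_loc(ℝⁿ) ∩ L^{p-1}_{sp}(ℝⁿ)`. -/
def BoundaryDatum (n : ℕ) (s p : ℝ) (g : Rn n → ℝ) : Prop :=
  (∀ z : Rn n, ∀ r : ℝ, 0 < r → memWsp n s p (ball z r) g) ∧ memTailSpace n s p g

/-- Symmetric measurable kernel with ellipticity bounds. -/
def SymKernel (n : ℕ) (Λ s p : ℝ) (Kt : Rn n → Rn n → ℝ) : Prop :=
  KernelBounds n Λ s p Kt ∧ ∀ x y : Rn n, Kt x y = Kt y x

/-- Weak solution of the kernel-`Kt` fractional `p`-Laplace equation with datum `f` in `O`. -/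
def WeakSolP (n : ℕ) (Kt : Rn n → Rn n → ℝ) (s p : ℝ) (O : Set (Rn n))
    (f u : Rn n → ℝ) : Prop :=
  memWsp n s p univ u ∧
    ∀ φ : Rn n → ℝ, IsTestFun n O φ →
      (∫ x : Rn n, ∫ y : Rn n,
          |u x - u y| ^ (p - 2) * (u x - u y) * (φ x - φ y) * Kt x y) =
        ∫ x : Rn n, φ x * f x

/-- Bernoulli's inequality in the form `f ^ p - e ^ p ≤ p f ^ (p - 1) (f - e)`. -/
lemma rpow_sub_rpow_le {p e f : ℝ} (hp : 1 ≤ p) (he : 0 ≤ e) (hf : 0 ≤ f) :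
    f ^ p - e ^ p ≤ p * f ^ (p - 1) * (f - e) := by
  rcases hf.eq_or_lt with rfl | hf
  · rw [Real.zero_rpow (by linarith)]
    rcases hp.eq_or_lt with rfl | hp
    · simp
    · rw [Real.zero_rpow (by linarith : p - 1 ≠ 0)]
      have := Real.rpow_nonneg he p
      linarith
  · have h := one_add_mul_self_le_rpow_one_add (s := e / f - 1) (by
      have : 0 ≤ e / f := by positivity
      linarith) hp
    have h1 : (1 + (e / f - 1)) ^ p = e ^ p / f ^ p := by
      rw [← Real.div_rpow he hf.le]; congr 1; ring
    rw [h1, le_div_iff₀ (by positivity)] at h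
    have h2 : f ^ p = f ^ (p - 1) * f := by
      rw [← Real.rpow_add_one hf.ne']; congr 1; ring
    rw [h2] at h ⊢
    have h3 : (1 + p * (e / f - 1)) * (f ^ (p - 1) * f) = f ^ (p - 1) * (f + p * (e - f)) := by
      field_simp
    rw [h3] at h
    linarith

/-- Absorption: the negative term `X ^ (p - 1) * Y` is controlled by `X ^ p` and `Y ^ p`. -/
lemma exists_rpow_absorb {p lam M : ℝ} (hp : 1 < p) (hl : 0 < lam) (hM : 0 < M) :
    ∃ C : ℝ, 0 < C ∧ ∀ X Y : ℝ, 0 ≤ X → 0 ≤ Y →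
      -(C * Y ^ p) ≤ lam * X ^ p - M * (X ^ (p - 1) * Y) := by
  refine ⟨M * (M / lam) ^ (p - 1), by positivity, fun X Y hX hY => ?_⟩
  have hXp : X ^ p = X ^ (p - 1) * X := by
    rw [← Real.rpow_add_one' hX (by linarith)]; congr 1; ring
  have hYp : Y ^ p = Y ^ (p - 1) * Y := by
    rw [← Real.rpow_add_one' hY (by linarith)]; congr 1; ring
  rcases le_total (M * Y) (lam * X) with h | h
  · have : 0 ≤ X ^ (p - 1) * (lam * X - M * Y) :=
      mul_nonneg (by positivity) (by linarith)
    have h2 : 0 ≤ M * (M / lam) ^ (p - 1) * Y ^ p := by positivity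
    rw [hXp]; nlinarith
  · have hX' : X ≤ M / lam * Y := by
      rw [div_mul_eq_mul_div, le_div_iff₀ hl]; linarith
    have h1 : X ^ (p - 1) ≤ (M / lam) ^ (p - 1) * Y ^ (p - 1) := by
      rw [← Real.mul_rpow (by positivity) hY]
      exact Real.rpow_le_rpow hX hX' (by linarith)
    have h2 : M * (X ^ (p - 1) * Y) ≤ M * ((M / lam) ^ (p - 1) * Y ^ (p - 1) * Y) := by
      gcongr
    have h3 : 0 ≤ lam * X ^ p := by positivity
    rw [hYp]; nlinarith

/-- `B` is comparable to `|u - v| ^ (p - 2) (u - v)`. -/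
def FluxBounds (lam M p B u v : ℝ) : Prop :=
  lam * |u - v| ^ p ≤ B * (u - v) ∧ B * (u - v) ≤ M * |u - v| ^ p ∧ (u = v → B = 0)

lemma FluxBounds.swap {lam M p B u v : ℝ} (h : FluxBounds lam M p B u v) :
    FluxBounds lam M p (-B) v u := by
  have h1 : -B * (v - u) = B * (u - v) := by ring
  unfold FluxBounds
  rw [h1, abs_sub_comm v u]
  exact ⟨h.1, h.2.1, fun e => by rw [h.2.2 e.symm, neg_zero]⟩

lemma FluxBounds.lower {lam M p B u v : ℝ} (h : FluxBounds lam M p B u v) (huv : v < u) : lam * (u - v) ^ (p - 1) ≤ B := by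
  have hd : 0 < u - v := by linarith
  have h1 := h.1
  rw [abs_of_pos hd] at h1
  have h2 : (u - v) ^ p = (u - v) ^ (p - 1) * (u - v) := by
    rw [← Real.rpow_add_one hd.ne']; congr 1; ring
  rw [h2, ← mul_assoc] at h1
  exact le_of_mul_le_mul_right h1 hd

lemma FluxBounds.upper {lam M p B u v : ℝ} (h : FluxBounds lam M p B u v) (huv : v < u) : B ≤ M * (u - v) ^ (p - 1) := by
  have hd : 0 < u - v := by linarith
  have h1 := h.2.1
  rw [abs_of_pos hd] at h1
  have h2 : (u - v) ^ p = (u - v) ^ (p - 1) * (u - v) := by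
    rw [← Real.rpow_add_one hd.ne']; congr 1; ring
  rw [h2, ← mul_assoc] at h1
  exact le_of_mul_le_mul_right h1 hd

section Pointwise

variable {p lam M : ℝ}

/-- Caccioppoli-type pointwise bound, one-sided version. -/
lemma exists_flux_cutoff_lower (hp : 1 < p) (hl : 0 < lam) (hM : 0 < M) :
    ∃ C : ℝ, 0 < C ∧ ∀ B u v h e f : ℝ, FluxBounds lam M p B u v → v < u → 0 ≤ e → 0 ≤ f →
      -(C * (max (u - h) 0 ^ p * |e - f| ^ p)) ≤
        B * (max (u - h) 0 * e ^ p - max (v - h) 0 * f ^ p) := by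
  obtain ⟨C, hC, H⟩ := exists_rpow_absorb (M := M * p) hp hl (by positivity)
  refine ⟨C, hC, fun B u v h e f hB huv he hf => ?_⟩
  have hBl := hB.lower huv
  have hBu := hB.upper huv
  have hB0 : 0 ≤ B := le_trans (by have : 0 < u - v := by linarith
                                   positivity) hBl
  set a := max (u - h) 0 with ha
  set b := max (v - h) 0 with hb
  have ha0 : 0 ≤ a := le_max_right _ _
  have hb0 : 0 ≤ b := le_max_right _ _
  have hab : b ≤ a := max_le_max (by linarith) le_rfl
  have hRHS : 0 ≤ C * (a ^ p * |e - f| ^ p) := by positivity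
  rcases le_total f e with hfe | hef
  · have h1 : f ^ p ≤ e ^ p := Real.rpow_le_rpow hf hfe (by linarith)
    have h2 : b * f ^ p ≤ a * e ^ p := mul_le_mul hab h1 (by positivity) ha0
    have := mul_nonneg hB0 (sub_nonneg.2 h2)
    linarith
  rcases le_or_gt v h with hvh | hvh
  · have : b = 0 := max_eq_right (by linarith)
    rw [this, zero_mul, sub_zero]
    have : 0 ≤ B * (a * e ^ p) := by positivity
    linarith
  have ha' : a = u - h := max_eq_left (by linarith)
  have hb' : b = v - h := max_eq_left (by linarith)
  set d := u - v with hd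
  have hd0 : 0 < d := by linarith
  have hda : a - b = d := by rw [ha', hb']; ring
  have key := H (d * f) (a * |e - f|) (by positivity) (by positivity)
  have hbern := rpow_sub_rpow_le hp.le he hf
  have habs : |e - f| = f - e := by rw [abs_of_nonpos (by linarith)]; ring
  have hdp : d ^ p = d ^ (p - 1) * d := by
    rw [← Real.rpow_add_one hd0.ne']; congr 1; ring
  rw [Real.mul_rpow hd0.le hf, Real.mul_rpow ha0 (abs_nonneg _), Real.mul_rpow hd0.le hf] at key
  have hid : B * (a * e ^ p - b * f ^ p) = B * (d * f ^ p) - B * (a * (f ^ p - e ^ p)) := by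
    rw [← hda]; ring
  rw [hid]
  have t1 : lam * (d ^ p * f ^ p) ≤ B * (d * f ^ p) := by
    rw [hdp]
    have : lam * d ^ (p - 1) * (d * f ^ p) ≤ B * (d * f ^ p) := by gcongr
    linarith
  have hfe0 : 0 ≤ f ^ p - e ^ p := by
    have := Real.rpow_le_rpow he hef (by linarith : 0 ≤ p)
    linarith
  have t2 : B * (a * (f ^ p - e ^ p)) ≤
      M * p * (d ^ (p - 1) * f ^ (p - 1) * (a * |e - f|)) := by
    calc B * (a * (f ^ p - e ^ p)) ≤ (M * d ^ (p - 1)) * (a * (p * f ^ (p - 1) * (f - e))) := by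
          gcongr
      _ = _ := by rw [habs]; ring
  linarith

/-- Caccioppoli-type pointwise bound. -/
lemma exists_flux_cutoff (hp : 1 < p) (hl : 0 < lam) (hM : 0 < M) :
    ∃ C : ℝ, 0 < C ∧ ∀ B u v h e f : ℝ, FluxBounds lam M p B u v → 0 ≤ e → 0 ≤ f →
      -(C * ((max (u - h) 0 ^ p + max (v - h) 0 ^ p) * |e - f| ^ p)) ≤
        B * (max (u - h) 0 * e ^ p - max (v - h) 0 * f ^ p) := by
  obtain ⟨C, hC, H⟩ := exists_flux_cutoff_lower (p := p) hp hl hM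
  refine ⟨C + M, by positivity, fun B u v h e f hB he hf => ?_⟩
  have ha : 0 ≤ max (u - h) 0 ^ p := Real.rpow_nonneg (le_max_right _ _) _
  have hb : 0 ≤ max (v - h) 0 ^ p := Real.rpow_nonneg (le_max_right _ _) _
  have hg : 0 ≤ |e - f| ^ p := by positivity
  rcases lt_trichotomy v u with huv | huv | huv
  · have := H B u v h e f hB huv he hf
    nlinarith [mul_nonneg hb hg, mul_nonneg ha hg, mul_nonneg hC.le (mul_nonneg hb hg),
      mul_nonneg hM.le (mul_nonneg hb hg), mul_nonneg hM.le (mul_nonneg ha hg)]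
  · rw [hB.2.2 huv.symm, zero_mul]
    have : 0 ≤ (C + M) * ((max (u - h) 0 ^ p + max (v - h) 0 ^ p) * |e - f| ^ p) := by positivity
    linarith
  · have := H (-B) v u h f e hB.swap huv hf he
    rw [abs_sub_comm f e] at this
    nlinarith [mul_nonneg hb hg, mul_nonneg ha hg, mul_nonneg hC.le (mul_nonneg ha hg),
      mul_nonneg hM.le (mul_nonneg hb hg), mul_nonneg hM.le (mul_nonneg ha hg)]

lemma FluxBounds.lower_of_snd_eq_zero (hp : 1 < p) (hl : 0 < lam) {B u v h e : ℝ}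
    (hB : FluxBounds lam M p B u v) (he : 0 ≤ e) (hv : max (v - h) 0 = 0) :
    lam * (max (u - h) 0 * e) ^ p ≤ B * (max (u - h) 0 * e ^ p) := by
  have hvh : v ≤ h := by have := (max_eq_right_iff.1 hv); linarith
  rcases le_or_gt u h with hu | hu
  · rw [max_eq_right (by linarith : u - h ≤ 0)]
    simp [Real.zero_rpow (by linarith : p ≠ 0)]
  · rw [max_eq_left (by linarith : 0 ≤ u - h)]
    have hd : 0 < u - h := by linarith
    have h1 := hB.lower (by linarith)
    have h2 : (u - h) ^ (p - 1) ≤ (u - v) ^ (p - 1) :=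
      Real.rpow_le_rpow hd.le (by linarith) (by linarith)
    have h3 : (u - h) ^ p = (u - h) ^ (p - 1) * (u - h) := by
      rw [← Real.rpow_add_one hd.ne']; congr 1; ring
    rw [Real.mul_rpow hd.le he, h3]
    calc lam * ((u - h) ^ (p - 1) * (u - h) * e ^ p)
        = lam * (u - h) ^ (p - 1) * ((u - h) * e ^ p) := by ring
      _ ≤ B * ((u - h) * e ^ p) := by
        gcongr
        exact le_trans (by gcongr) h1

lemma FluxBounds.lower_of_cutoff_eq_zero (hp : 1 < p) (hl : 0 < lam) (hM : 0 < M)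
    {B u v h e : ℝ} (hB : FluxBounds lam M p B u v) (he : 0 ≤ e) :
    -(M * (max (v - h) 0 ^ (p - 1) * (max (u - h) 0 * e ^ p))) ≤ B * (max (u - h) 0 * e ^ p) := by
  have ha : 0 ≤ max (u - h) 0 := le_max_right _ _
  have hb : 0 ≤ max (v - h) 0 := le_max_right _ _
  rcases le_or_gt u h with hu | hu
  · rw [max_eq_right (by linarith : u - h ≤ 0)]
    simp
  have key : -(M * max (v - h) 0 ^ (p - 1)) ≤ B := by
    have h0 : 0 ≤ M * max (v - h) 0 ^ (p - 1) := by positivity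
    rcases lt_trichotomy v u with huv | huv | huv
    · have h1 := hB.lower huv
      have : 0 < u - v := by linarith
      have : 0 ≤ lam * (u - v) ^ (p - 1) := by positivity
      linarith
    · rw [hB.2.2 huv.symm]; linarith
    · have h1 := hB.swap.upper huv
      have h2 : (v - u) ^ (p - 1) ≤ max (v - h) 0 ^ (p - 1) :=
        Real.rpow_le_rpow (by linarith) (le_max_of_le_left (by linarith)) (by linarith)
      have h3 : M * (v - u) ^ (p - 1) ≤ M * max (v - h) 0 ^ (p - 1) := by gcongr
      linarith
  have h4 : 0 ≤ max (u - h) 0 * e ^ p := by positivity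
  have := mul_le_mul_of_nonneg_right key h4
  linarith

/-- The pointwise energy inequality behind the Caccioppoli estimate. The numbers `X`, `Y` play the
role of the values at the two points of the indicator function of a set off which the cut-off
function vanishes. -/
lemma exists_energy_pointwise (hp : 1 < p) (hl : 0 < lam) (hM : 0 < M) :
    ∃ C : ℝ, 0 < C ∧ ∀ B u v h e f X Y : ℝ, FluxBounds lam M p B u v → 0 ≤ e → 0 ≤ f →
      (X = 1 ∨ X = 0 ∧ e = 0) → (Y = 1 ∨ Y = 0 ∧ f = 0) →
      lam * (if max (v - h) 0 * f = 0 then (max (u - h) 0 * e) ^ p else 0) ≤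
        B * (max (u - h) 0 * e ^ p - max (v - h) 0 * f ^ p) +
        C * ((X * max (u - h) 0 ^ p + Y * max (v - h) 0 ^ p) * |e - f| ^ p +
          (1 - Y) * (max (v - h) 0 ^ (p - 1) * (max (u - h) 0 * e ^ p)) +
          (1 - X) * (max (u - h) 0 ^ (p - 1) * (max (v - h) 0 * f ^ p))) := by
  obtain ⟨C, hC, H⟩ := exists_flux_cutoff (p := p) hp hl hM
  refine ⟨C + lam + M, by positivity, fun B u v h e f X Y hB he hf hX hY => ?_⟩
  have hp0 : p ≠ 0 := by linarith
  have c1 := H B u v h e f hB he hf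
  have c2 := fun hv : max (v - h) 0 = 0 => hB.lower_of_snd_eq_zero hp hl he hv
  have c3 := hB.lower_of_cutoff_eq_zero (h := h) hp hl hM he
  have c4 := hB.swap.lower_of_cutoff_eq_zero (h := h) hp hl hM hf
  set a := max (u - h) 0 with ha
  set b := max (v - h) 0 with hb
  have ha0 : 0 ≤ a := le_max_right _ _
  have hb0 : 0 ≤ b := le_max_right _ _
  have hap : 0 ≤ a ^ p := by positivity
  have hbp : 0 ≤ b ^ p := by positivity
  have hg : 0 ≤ |e - f| ^ p := by positivity
  have hT1 : 0 ≤ b ^ (p - 1) * (a * e ^ p) := by positivity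
  have hT2 : 0 ≤ a ^ (p - 1) * (b * f ^ p) := by positivity
  have hag := mul_nonneg hap hg
  have hbg := mul_nonneg hbp hg
  have hf0 : f = 0 → (a * e) ^ p = a ^ p * |e - f| ^ p := by
    rintro rfl
    rw [sub_zero, abs_of_nonneg he, Real.mul_rpow ha0 he]
  rcases hX with rfl | ⟨rfl, rfl⟩ <;> rcases hY with rfl | ⟨rfl, rfl⟩
  · have e1 : 0 ≤ (lam + M) * (a ^ p * |e - f| ^ p + b ^ p * |e - f| ^ p) := by positivity
    have e2 : 0 ≤ C * (a ^ p * |e - f| ^ p + b ^ p * |e - f| ^ p) := by positivity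
    split_ifs with hz
    · rcases mul_eq_zero.1 hz with hz | hz
      · have := c2 hz
        rw [hz] at e1 e2 ⊢
        rw [zero_mul, sub_zero]
        nlinarith
      · rw [hf0 hz]
        nlinarith [mul_nonneg hl.le hbg, mul_nonneg hM.le hbg, mul_nonneg hM.le hag]
    · nlinarith
  · rw [hf0 rfl]
    simp only [Real.zero_rpow hp0, mul_zero, sub_zero, if_true, zero_mul, one_mul, add_zero] at *
    nlinarith [mul_nonneg hC.le hT1, mul_nonneg hl.le hT1, mul_nonneg hC.le hag,
      mul_nonneg hM.le hag]
  · simp only [Real.zero_rpow hp0, mul_zero, sub_zero, zero_mul, one_mul, zero_add, zero_sub,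
      ite_self, sub_self, add_zero] at *
    nlinarith [mul_nonneg hC.le hT2, mul_nonneg hl.le hT2, mul_nonneg hC.le hbg,
      mul_nonneg hM.le hbg, mul_nonneg hl.le hbg]
  · simp [Real.zero_rpow hp0]

end Pointwise

lemma integrableOn_radial_kernel {n : ℕ} (hn : 1 ≤ n) {s p : ℝ} (hs : 0 < s) (hs1 : s < 1)
    (hp : 1 < p) :
    IntegrableOn (fun t : ℝ => t ^ (n - 1) • (min 1 t ^ p / t ^ ((n : ℝ) + s * p))) (Ioi 0) := by
  have hsp : 0 < s * p := by positivity
  have key : ∀ t : ℝ, 0 < t → t ^ (n - 1) • (min 1 t ^ p / t ^ ((n : ℝ) + s * p)) =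
      min 1 t ^ p * t ^ (-1 - s * p) := by
    intro t ht
    have h1 : t ^ (n - 1) = t ^ ((n : ℝ) - 1) := by
      rw [← Real.rpow_natCast]; congr 1; push_cast [hn]; ring
    rw [smul_eq_mul, h1, div_eq_mul_inv, ← Real.rpow_neg ht.le, mul_left_comm, ← Real.rpow_add ht]
    congr 2; ring
  rw [integrableOn_congr_fun (fun t (ht : t ∈ Ioi (0 : ℝ)) => key t ht) measurableSet_Ioi,
    ← Ioc_union_Ioi_eq_Ioi zero_le_one]
  refine IntegrableOn.union ?_ ?_
  · have h : IntegrableOn (fun t : ℝ => t ^ (p - 1 - s * p)) (Ioc 0 1) := by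
      rw [← intervalIntegrable_iff_integrableOn_Ioc_of_le zero_le_one]
      apply intervalIntegral.intervalIntegrable_rpow'
      nlinarith
    refine h.congr_fun (fun t ht => ?_) measurableSet_Ioc
    simp only
    rw [min_eq_right ht.2, ← Real.rpow_add ht.1]
    congr 1; ring
  · have h : IntegrableOn (fun t : ℝ => t ^ (-1 - s * p)) (Ioi 1) :=
      integrableOn_Ioi_rpow_of_lt (by linarith) one_pos
    refine h.congr_fun (fun t ht => ?_) measurableSet_Ioi
    simp only
    rw [min_eq_left (le_of_lt ht), Real.one_rpow, one_mul]

/-- The singular kernel integrated against a truncated power, at scale `1 / L`. -/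
lemma exists_kernel_integral_bound {n : ℕ} (hn : 1 ≤ n) {s p : ℝ} (hs : 0 < s) (hs1 : s < 1)
    (hp : 1 < p) :
    ∃ J : ℝ, 0 < J ∧ ∀ (L : ℝ) (x : Rn n), 0 < L →
      ∫⁻ y : Rn n, ENNReal.ofReal (min 1 (L * ‖x - y‖) ^ p / ‖x - y‖ ^ ((n : ℝ) + s * p)) ≤
        ENNReal.ofReal (J * L ^ (s * p)) := by
  have : NeZero n := ⟨by omega⟩
  have hfin : Module.finrank ℝ (Rn n) = n := by simp
  set f : Rn n → ℝ := fun z => min 1 ‖z‖ ^ p / ‖z‖ ^ ((n : ℝ) + s * p) with hf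
  have h_int : Integrable f := by
    rw [hf, integrable_fun_norm_addHaar volume (f := fun t => min 1 t ^ p / t ^ ((n : ℝ) + s * p)),
      hfin]
    exact integrableOn_radial_kernel hn hs hs1 hp
  have hf0 : ∀ z, 0 ≤ f z := fun z => by
    simp only [hf]; positivity
  refine ⟨(∫ z, f z) + 1, by have := integral_nonneg (μ := volume) (f := f) hf0; linarith, fun L x hL => ?_⟩
  set g : Rn n → ℝ := fun z => min 1 (L * ‖z‖) ^ p / ‖z‖ ^ ((n : ℝ) + s * p) with hg
  have hgf : g = fun z => L ^ ((n : ℝ) + s * p) * f (L • z) := by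
    funext z
    simp only [hf, hg]
    rw [norm_smul, Real.norm_of_nonneg hL.le, Real.mul_rpow hL.le (norm_nonneg _)]
    have : L ^ ((n : ℝ) + s * p) ≠ 0 := (Real.rpow_pos_of_pos hL _).ne'
    rw [← mul_div_assoc, mul_div_mul_left _ _ this]
  have hgint : Integrable g := by
    rw [hgf]
    exact ((integrable_comp_smul_iff volume f hL.ne').2 h_int).const_mul _
  have hgI : ∫ z, g z = L ^ (s * p) * ∫ z, f z := by
    rw [hgf, integral_const_mul, Measure.integral_comp_smul, hfin, smul_eq_mul,
      abs_of_pos (by positivity), Real.rpow_add hL, Real.rpow_natCast]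
    field_simp
  have hg0 : ∀ z, 0 ≤ g z := fun z => by
    simp only [hg]; positivity
  calc ∫⁻ y : Rn n, ENNReal.ofReal (g (x - y)) = ∫⁻ z, ENNReal.ofReal (g z) :=
        lintegral_sub_left_eq_self (fun z => ENNReal.ofReal (g z)) x
    _ = ENNReal.ofReal (∫ z, g z) := (ofReal_integral_eq_lintegral_ofReal hgint
        (Eventually.of_forall hg0)).symm
    _ ≤ _ := by
      apply ENNReal.ofReal_le_ofReal
      rw [hgI, mul_comm]
      gcongr
      linarith

lemma memLp_of_lintegral_rpow {α : Type*} [MeasurableSpace α] {μ : Measure α} {f : α → ℝ} {p : ℝ}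
    (hp : 0 < p) (hf : AEStronglyMeasurable f μ)
    (h : ∫⁻ x, ENNReal.ofReal (|f x| ^ p) ∂μ < ⊤) : MemLp f (ENNReal.ofReal p) μ := by
  refine ⟨hf, ?_⟩
  rw [eLpNorm_lt_top_iff_lintegral_rpow_enorm_lt_top (by simpa using hp) ENNReal.ofReal_ne_top,
    ENNReal.toReal_ofReal hp.le]
  convert h using 3 with x
  rw [Real.enorm_eq_ofReal_abs, ENNReal.ofReal_rpow_of_nonneg (abs_nonneg _) hp.le]

lemma continuous_integral_mul_diagonal_translate {n : ℕ} {p : ℝ} (hp : 1 < p)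
    {f g : Rn n × Rn n → ℝ}
    (hf : MemLp f (ENNReal.ofReal p) ((volume : Measure (Rn n)).prod volume))
    (hg : MemLp g (ENNReal.ofReal (p / (p - 1))) ((volume : Measure (Rn n)).prod volume)) :
    Continuous (fun t : Rn n => ∫ z, g z * f (z - (t, t)) ∂((volume : Measure (Rn n)).prod volume))
      ∧ ∀ t : Rn n, Integrable (fun z => g z * f (z - (t, t)))
        ((volume : Measure (Rn n)).prod volume) := by
  set μ := (volume : Measure (Rn n)).prod (volume : Measure (Rn n)) with hμ
  have hconj : Real.HolderConjugate (p / (p - 1)) p :=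
    (Real.HolderConjugate.conjExponent hp).symm
  have : ENNReal.HolderConjugate (ENNReal.ofReal (p / (p - 1))) (ENNReal.ofReal p) :=
    hconj.ennrealOfReal
  have : Fact (1 ≤ ENNReal.ofReal p) := ⟨by simpa using hp.le⟩
  have hq1 : 1 ≤ p / (p - 1) := by rw [le_div_iff₀ (by linarith)]; linarith
  have : Fact (1 ≤ ENNReal.ofReal (p / (p - 1))) := ⟨by simpa using hq1⟩
  let G : C(Rn n, C(Rn n × Rn n, Rn n × Rn n)) :=
    (ContinuousMap.mk (fun a : Rn n × (Rn n × Rn n) => a.2 - (a.1, a.1)) (by fun_prop)).curry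
  have hG : ∀ t, MeasurePreserving (G t) μ μ := fun t => measurePreserving_sub_right μ (t, t)
  have h_int : ∀ t : Rn n, Integrable (fun z => g z * f (z - (t, t))) μ := fun t =>
    MemLp.integrable_mul hg (hf.comp_measurePreserving (hG t))
  refine ⟨?_, h_int⟩
  have hc : Continuous (fun t : Rn n =>
      ((ContinuousLinearMap.mul ℝ ℝ).lpPairing μ (ENNReal.ofReal (p / (p - 1))) (ENNReal.ofReal p))
        (hg.toLp g) (Lp.compMeasurePreserving (G t) (hG t) (hf.toLp f))) := by
    refine (ContinuousLinearMap.continuous _).comp ?_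
    exact continuous_const.compMeasurePreservingLp G.continuous hG ENNReal.ofReal_ne_top
  convert hc using 2 with t
  rw [ContinuousLinearMap.lpPairing_eq_integral]
  apply integral_congr_ae
  have h1 : (Lp.compMeasurePreserving (G t) (hG t) (hf.toLp f)) =ᵐ[μ] f ∘ G t :=
    (Lp.coeFn_compMeasurePreserving _ _).trans
      ((hG t).quasiMeasurePreserving.ae_eq_comp hf.coeFn_toLp)
  filter_upwards [hg.coeFn_toLp, h1] with z hz1 hz2
  rw [hz1, hz2]
  rfl

lemma PhiBounds.abs_le {Λ p : ℝ} {Φ : ℝ → ℝ} (hΦ : PhiBounds Λ p Φ) (hΛ : 1 ≤ Λ) (hp : 1 < p)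
    (t : ℝ) : |Φ t| ≤ Λ * |t| ^ (p - 1) := by
  rcases eq_or_ne t 0 with rfl | ht
  · rw [hΦ.2.1, abs_zero, Real.zero_rpow (by linarith), mul_zero]
  · have h := hΦ.2.2 t
    have ht' : 0 < |t| := abs_pos.2 ht
    have h0 : 0 ≤ Φ t * t := le_trans (by positivity) h.1
    have h1 : |Φ t| * |t| ≤ Λ * |t| ^ (p - 1) * |t| := by
      rw [← abs_mul, abs_of_nonneg h0, mul_assoc, ← Real.rpow_add_one ht'.ne']
      convert h.2 using 3; ring
    exact le_of_mul_le_mul_right h1 ht'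

lemma KernelBounds.abs_le {n : ℕ} {Λ s p : ℝ} {K : Rn n → Rn n → ℝ} (hK : KernelBounds n Λ s p K)
    (hΛ : 1 ≤ Λ) {x y : Rn n} (hxy : x ≠ y) : |K x y| ≤ Λ / ‖x - y‖ ^ ((n : ℝ) + s * p) := by
  have h := hK.2 x y hxy
  rw [abs_of_nonneg (le_trans (by positivity) h.1)]
  exact h.2

lemma fluxBounds_of_kernel {n : ℕ} {Λ s p : ℝ} {Φ : ℝ → ℝ} {K : Rn n → Rn n → ℝ}
    (hK : KernelBounds n Λ s p K) (hΦ : PhiBounds Λ p Φ) (hΛ : 1 ≤ Λ) (u v : ℝ)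
    {x y : Rn n} (hxy : x ≠ y) :
    FluxBounds (1 / Λ ^ 2) (Λ ^ 2) p (Φ (u - v) * K x y * ‖x - y‖ ^ ((n : ℝ) + s * p)) u v := by
  have hD : 0 < ‖x - y‖ ^ ((n : ℝ) + s * p) :=
    Real.rpow_pos_of_pos (norm_pos_iff.2 (sub_ne_zero.2 hxy)) _
  set D := ‖x - y‖ ^ ((n : ℝ) + s * p) with hDdef
  have hk := hK.2 x y hxy
  have hΛ0 : 0 < Λ := by linarith
  have hk1 : 1 / Λ ≤ K x y * D := by
    have := mul_le_mul_of_nonneg_right hk.1 hD.le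
    calc 1 / Λ = 1 / (Λ * D) * D := by field_simp
      _ ≤ _ := this
  have hk2 : K x y * D ≤ Λ := by
    have := mul_le_mul_of_nonneg_right hk.2 hD.le
    calc _ ≤ _ := this
      _ = Λ := by rw [← hDdef]; field_simp
  have hφ := hΦ.2.2 (u - v)
  have hφ0 : 0 ≤ Φ (u - v) * (u - v) := le_trans (by positivity) hφ.1
  have e : Φ (u - v) * K x y * D * (u - v) = Φ (u - v) * (u - v) * (K x y * D) := by ring
  unfold FluxBounds
  refine ⟨?_, ?_, ?_⟩
  · rw [e]
    calc 1 / Λ ^ 2 * |u - v| ^ p = |u - v| ^ p / Λ * (1 / Λ) := by field_simp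
      _ ≤ _ := by gcongr; exact hφ.1
  · rw [e]
    calc _ ≤ Λ * |u - v| ^ p * Λ :=
          mul_le_mul hφ.2 hk2 (le_trans (by positivity) hk1) (by positivity)
      _ = _ := by ring
  · rintro rfl
    simp [hΦ.2.1]

section Density

variable {n : ℕ} {s p Λ : ℝ}

lemma memLp_weighted_diff (hp : 1 < p) {φ : Rn n → ℝ} (hφm : Measurable φ)
    (hφg : gagliardo n s p univ φ < ⊤) :
    MemLp (fun z : Rn n × Rn n => (φ z.1 - φ z.2) / ‖z.1 - z.2‖ ^ (((n : ℝ) + s * p) / p))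
      (ENNReal.ofReal p) ((volume : Measure (Rn n)).prod volume) := by
  have hm : Measurable (fun z : Rn n × Rn n =>
      (φ z.1 - φ z.2) / ‖z.1 - z.2‖ ^ (((n : ℝ) + s * p) / p)) := by measurability
  refine memLp_of_lintegral_rpow (by linarith) hm.aestronglyMeasurable ?_
  rw [lintegral_prod _ (by fun_prop)]
  simp only [gagliardo, Measure.restrict_univ] at hφg
  convert hφg using 6 with x y
  simp only
  rw [abs_div, Real.div_rpow (abs_nonneg _) (abs_nonneg _),
    abs_of_nonneg (Real.rpow_nonneg (norm_nonneg (x - y)) _),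
    ← Real.rpow_mul (norm_nonneg _), div_mul_cancel₀ _ (by linarith)]

lemma memLp_weighted_flux (hs : 0 < s) (hp : 1 < p) (hΛ : 1 ≤ Λ) {Φ : ℝ → ℝ}
    {K : Rn n → Rn n → ℝ} (hK : KernelBounds n Λ s p K) (hΦ : PhiBounds Λ p Φ)
    {w : Rn n → ℝ} (hwm : Measurable w) (hwg : gagliardo n s p univ w < ⊤) :
    MemLp (fun z : Rn n × Rn n => Φ (w z.1 - w z.2) * K z.1 z.2 *
        ‖z.1 - z.2‖ ^ (((n : ℝ) + s * p) / p))
      (ENNReal.ofReal (p / (p - 1))) ((volume : Measure (Rn n)).prod volume) := by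
  have hp1 : 0 < p - 1 := by linarith
  have hKm : Measurable (fun z : Rn n × Rn n => K z.1 z.2) := hK.1
  have hΦm : Measurable Φ := hΦ.1.measurable
  set q := p / (p - 1) with hq
  have hq0 : 0 < q := by positivity
  refine memLp_of_lintegral_rpow hq0 (by fun_prop) ?_
  rw [lintegral_prod _ (by fun_prop)]
  simp only [gagliardo, Measure.restrict_univ] at hwg
  have hsp : 0 < s * p := by positivity
  have hn0 : (0 : ℝ) ≤ n := Nat.cast_nonneg n
  calc _ ≤ ∫⁻ x : Rn n, ∫⁻ y : Rn n, ENNReal.ofReal ((Λ ^ 2) ^ q) *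
        ENNReal.ofReal (|w x - w y| ^ p / ‖x - y‖ ^ ((n : ℝ) + s * p)) := by
        refine lintegral_mono fun x => lintegral_mono fun y => ?_
        simp only
        rw [← ENNReal.ofReal_mul (by positivity)]
        apply ENNReal.ofReal_le_ofReal
        rcases eq_or_ne x y with rfl | hxy
        · rw [sub_self x, norm_zero, Real.zero_rpow (by positivity), mul_zero, abs_zero,
            Real.zero_rpow hq0.ne']
          positivity
        · have hd : 0 < ‖x - y‖ := norm_pos_iff.2 (sub_ne_zero.2 hxy)
          have h1 := hΦ.abs_le hΛ hp (w x - w y)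
          have h2 := hK.abs_le hΛ hxy
          have h3 : |Φ (w x - w y) * K x y * ‖x - y‖ ^ (((n : ℝ) + s * p) / p)| ≤
              Λ ^ 2 * (|w x - w y| ^ (p - 1) * ‖x - y‖ ^ (-((n : ℝ) + s * p) * ((p - 1) / p))) := by
            rw [abs_mul, abs_mul, abs_of_nonneg (Real.rpow_nonneg (norm_nonneg (x - y)) _)]
            calc _ ≤ Λ * |w x - w y| ^ (p - 1) * (Λ / ‖x - y‖ ^ ((n : ℝ) + s * p)) *
                  ‖x - y‖ ^ (((n : ℝ) + s * p) / p) := by gcongr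
              _ = Λ ^ 2 * (|w x - w y| ^ (p - 1) * (‖x - y‖ ^ (((n : ℝ) + s * p) / p) *
                  (‖x - y‖ ^ ((n : ℝ) + s * p))⁻¹)) := by ring
              _ = _ := by
                rw [← Real.rpow_neg hd.le, ← Real.rpow_add hd]
                congr 4
                field_simp
                ring
          calc _ ≤ (Λ ^ 2 * (|w x - w y| ^ (p - 1) *
                ‖x - y‖ ^ (-((n : ℝ) + s * p) * ((p - 1) / p)))) ^ q := by gcongr
            _ = _ := by
              rw [Real.mul_rpow (by positivity) (by positivity),
                Real.mul_rpow (by positivity) (by positivity), ← Real.rpow_mul (abs_nonneg _),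
                ← Real.rpow_mul hd.le, div_eq_mul_inv (|w x - w y| ^ p), ← Real.rpow_neg hd.le]
              congr 3
              · rw [hq]; field_simp
              · rw [hq]; field_simp
    _ = ENNReal.ofReal ((Λ ^ 2) ^ q) * ∫⁻ x : Rn n, ∫⁻ y : Rn n,
        ENNReal.ofReal (|w x - w y| ^ p / ‖x - y‖ ^ ((n : ℝ) + s * p)) := by
        rw [← lintegral_const_mul' _ _ ENNReal.ofReal_ne_top]
        congr 1; funext x
        rw [lintegral_const_mul' _ _ ENNReal.ofReal_ne_top]
    _ < ⊤ := ENNReal.mul_lt_top ENNReal.ofReal_lt_top hwg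

lemma weighted_flux_mul_weighted_diff {Φ : ℝ → ℝ}
    (K : Rn n → Rn n → ℝ) (w φ : Rn n → ℝ) (x y : Rn n) (h0 : x = y → φ x = φ y) :
    Φ (w x - w y) * K x y * ‖x - y‖ ^ (((n : ℝ) + s * p) / p) *
      ((φ x - φ y) / ‖x - y‖ ^ (((n : ℝ) + s * p) / p)) =
    Φ (w x - w y) * (φ x - φ y) * K x y := by
  rcases eq_or_ne x y with hxy | hxy
  · rw [h0 hxy]; simp
  · have hd : 0 < ‖x - y‖ := norm_pos_iff.2 (sub_ne_zero.2 hxy)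
    have : 0 < ‖x - y‖ ^ (((n : ℝ) + s * p) / p) := by positivity
    field_simp

end Density

section Extension

variable {n : ℕ} {s p Λ : ℝ}

/-- Mollifications of a function supported in a smaller ball are admissible test functions. -/
lemma isTestFun_convolution {Ω : Set (Rn n)} {φ : Rn n → ℝ} (hφ : LocallyIntegrable φ)
    {x₀ : Rn n} {ρ R : ℝ} (hball : ball x₀ R ⊆ Ω)
    (hsupp : ∀ x, x ∉ closedBall x₀ ρ → φ x = 0)
    (ψ : ContDiffBump (0 : Rn n)) (hψ : ρ + ψ.rOut < R) :
    IsTestFun n Ω (fun x => ∫ t, ψ t * φ (x - t)) := by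
  have hconv : (fun x => ∫ t, ψ t * φ (x - t)) =
      convolution ψ φ (ContinuousLinearMap.mul ℝ ℝ) volume := by
    funext x; rfl
  have hsub : tsupport (fun x => ∫ t, ψ t * φ (x - t)) ⊆ closedBall x₀ (ρ + ψ.rOut) := by
    refine closure_minimal (fun x hx => ?_) isClosed_closedBall
    by_contra hcon
    apply hx
    have : ∀ t, ψ t * φ (x - t) = 0 := fun t => by
      by_cases ht : t ∈ ball (0 : Rn n) ψ.rOut
      · rw [hsupp, mul_zero]
        intro h
        apply hcon
        rw [mem_closedBall, dist_eq_norm] at h ⊢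
        rw [mem_ball_zero_iff] at ht
        calc ‖x - x₀‖ = ‖(x - t - x₀) + t‖ := by congr 1; abel
          _ ≤ ‖x - t - x₀‖ + ‖t‖ := norm_add_le _ _
          _ ≤ _ := by linarith
      · rw [← ψ.support_eq, Function.mem_support, not_not] at ht
        rw [ht, zero_mul]
    simp [this]
  refine ⟨?_, (isCompact_closedBall _ _).of_isClosed_subset (isClosed_tsupport _) hsub,
    hsub.trans ((closedBall_subset_ball hψ).trans hball)⟩
  rw [hconv]
  exact ψ.hasCompactSupport.contDiff_convolution_left _ ψ.contDiff hφ

/-- Nonnegative finite-energy functions supported in a smaller ball may be used to test the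
subsolution inequality. -/
lemma WeakSubSol.integrable_and_integral_nonpos (hs : 0 < s) (hp : 1 < p) (hΛ : 1 ≤ Λ)
    {Φ : ℝ → ℝ} {K : Rn n → Rn n → ℝ} (hK : KernelBounds n Λ s p K) (hΦ : PhiBounds Λ p Φ)
    {Ω : Set (Rn n)} {w : Rn n → ℝ} (hwm : Measurable w) (hw : WeakSubSol n Φ K s p Ω w)
    {φ : Rn n → ℝ} (hφm : Measurable φ) (hφ0 : ∀ x, 0 ≤ φ x)
    (hφp : ∫⁻ x, ENNReal.ofReal (|φ x| ^ p) < ⊤) (hφg : gagliardo n s p univ φ < ⊤)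
    {x₀ : Rn n} {ρ R : ℝ} (hρR : ρ < R) (hball : ball x₀ R ⊆ Ω)
    (hsupp : ∀ x, x ∉ closedBall x₀ ρ → φ x = 0) :
    Integrable (fun z : Rn n × Rn n => Φ (w z.1 - w z.2) * (φ z.1 - φ z.2) * K z.1 z.2)
      ((volume : Measure (Rn n)).prod volume) ∧
    ∫ z : Rn n × Rn n, Φ (w z.1 - w z.2) * (φ z.1 - φ z.2) * K z.1 z.2
      ∂((volume : Measure (Rn n)).prod volume) ≤ 0 := by
  set μ := (volume : Measure (Rn n)).prod (volume : Measure (Rn n)) with hμ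
  have hKm : Measurable (fun z : Rn n × Rn n => K z.1 z.2) := hK.1
  have hΦm : Measurable Φ := hΦ.1.measurable
  have hloc : LocallyIntegrable φ := by
    have h1 : MemLp φ (ENNReal.ofReal p) volume :=
      memLp_of_lintegral_rpow (by linarith) hφm.aestronglyMeasurable hφp
    exact h1.locallyIntegrable (by simpa using hp.le)
  set f : Rn n × Rn n → ℝ := fun z => (φ z.1 - φ z.2) / ‖z.1 - z.2‖ ^ (((n : ℝ) + s * p) / p)
    with hf
  set g : Rn n × Rn n → ℝ := fun z => Φ (w z.1 - w z.2) * K z.1 z.2 *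
    ‖z.1 - z.2‖ ^ (((n : ℝ) + s * p) / p) with hg
  have hfL : MemLp f (ENNReal.ofReal p) μ := memLp_weighted_diff hp hφm hφg
  have hgL : MemLp g (ENNReal.ofReal (p / (p - 1))) μ :=
    memLp_weighted_flux hs hp hΛ hK hΦ hwm hw.1.2.2
  have hfm : Measurable f := by rw [hf]; measurability
  have hgm : Measurable g := by rw [hg]; fun_prop
  have hgf : ∀ (z : Rn n × Rn n) (t : Rn n), g z * f (z - (t, t)) =
      Φ (w z.1 - w z.2) * (φ (z.1 - t) - φ (z.2 - t)) * K z.1 z.2 := fun z t => by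
    have := weighted_flux_mul_weighted_diff (s := s) (p := p) (Φ := Φ) K w (fun x => φ (x - t))
      z.1 z.2 (fun h => by rw [h])
    simp only [hf, hg, Prod.fst_sub, Prod.snd_sub, sub_sub_sub_cancel_right]
    exact this
  obtain ⟨hHc, hHi⟩ := continuous_integral_mul_diagonal_translate hp hfL hgL
  obtain ⟨hAc, -⟩ := continuous_integral_mul_diagonal_translate hp hfL.norm hgL.norm
  set H : Rn n → ℝ := fun t => ∫ z, g z * f (z - (t, t)) ∂μ with hH
  have hF : (fun z : Rn n × Rn n => Φ (w z.1 - w z.2) * (φ z.1 - φ z.2) * K z.1 z.2) =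
      fun z => g z * f (z - ((0 : Rn n), (0 : Rn n))) := by
    funext z; rw [hgf]; simp
  rw [hF]
  refine ⟨hHi 0, ?_⟩
  change H 0 ≤ 0
  by_contra! hpos
  obtain ⟨ε, hε, hball'⟩ := Metric.continuous_iff.1 hHc 0 (H 0 / 2) (by linarith)
  set δ := min ε ((R - ρ) / 2) with hδ
  have hδ0 : 0 < δ := lt_min hε (by linarith)
  let ψ : ContDiffBump (0 : Rn n) := ⟨δ / 2, δ, by linarith, by linarith⟩
  have hψout : ψ.rOut = δ := rfl
  have htest := isTestFun_convolution hloc hball hsupp ψ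
    (by rw [hψout]; have := min_le_right ε ((R - ρ) / 2); linarith)
  have hle := hw.2 _ htest (fun x => integral_nonneg fun t => mul_nonneg ψ.nonneg (hφ0 _))
  -- Fubini for the mollified form
  set P : Rn n × (Rn n × Rn n) → ℝ := fun a => ψ a.1 * (g a.2 * f (a.2 - (a.1, a.1))) with hP
  have hψm : Measurable ψ := ψ.continuous.measurable
  have hPm : AEStronglyMeasurable P ((volume : Measure (Rn n)).prod μ) := by
    apply Measurable.aestronglyMeasurable
    rw [hP]; fun_prop
  have hPi : Integrable P ((volume : Measure (Rn n)).prod μ) := by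
    rw [integrable_prod_iff hPm]
    refine ⟨Eventually.of_forall fun t => (hHi t).const_mul (ψ t), ?_⟩
    have hcont : Continuous (fun t => ψ t * ∫ z, ‖g z‖ * ‖f (z - (t, t))‖ ∂μ) :=
      ψ.continuous.mul hAc
    have h_int := hcont.integrable_of_hasCompactSupport (μ := volume)
      (ψ.hasCompactSupport.mul_right)
    refine h_int.congr (Eventually.of_forall fun t => ?_)
    simp only [hP, norm_mul, Real.norm_of_nonneg ψ.nonneg]
    rw [integral_const_mul]
  have hinner : ∀ x y : Rn n, ∫ t, P (t, (x, y)) = Φ (w x - w y) *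
      ((∫ t, ψ t * φ (x - t)) - ∫ t, ψ t * φ (y - t)) * K x y := fun x y => by
    have hex := ψ.hasCompactSupport.convolutionExists_left (ContinuousLinearMap.mul ℝ ℝ)
      ψ.continuous hloc
    have hx : Integrable (fun t => ψ t * φ (x - t)) := hex x
    have hy : Integrable (fun t => ψ t * φ (y - t)) := hex y
    rw [← integral_sub hx hy, mul_right_comm, ← integral_const_mul]
    refine integral_congr_ae (Eventually.of_forall fun t => ?_)
    simp only [hP, hgf]
    ring
  have hform : nonlocalForm n Φ K w (fun x => ∫ t, ψ t * φ (x - t)) = ∫ t, ψ t * H t := by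
    calc _ = ∫ x : Rn n, ∫ y : Rn n, ∫ t, P (t, (x, y)) := by
          simp only [nonlocalForm, hinner]
      _ = ∫ z, (∫ t, P (t, z)) ∂μ := by
          rw [hμ, integral_prod (fun z : Rn n × Rn n => ∫ t, P (t, z)) hPi.integral_prod_right]
      _ = ∫ t, ∫ z, P (t, z) ∂μ := by
          exact (integral_integral_swap (f := fun t z => P (t, z)) hPi).symm
      _ = _ := by
          simp only [hP, integral_const_mul, hH]
  rw [hform] at hle
  have hlow : ∫ t, ψ t * (H 0 / 2) ≤ ∫ t, ψ t * H t := by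
    refine integral_mono (ψ.integrable.mul_const _) ?_ fun t => ?_
    · exact (ψ.continuous.mul hHc).integrable_of_hasCompactSupport ψ.hasCompactSupport.mul_right
    · by_cases ht : t ∈ ball (0 : Rn n) ψ.rOut
      · have h1 : dist t 0 < ε := lt_of_lt_of_le ht (min_le_left _ _)
        have h2 := hball' t h1
        rw [Real.dist_eq, abs_lt] at h2
        exact mul_le_mul_of_nonneg_left (by linarith [h2.1]) ψ.nonneg
      · rw [← ψ.support_eq, Function.mem_support, not_not] at ht
        simp [ht]
  rw [integral_mul_const] at hlow
  have := ψ.integral_pos (μ := volume)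
  have : 0 < (∫ t, ψ t) * (H 0 / 2) := by positivity
  linarith

end Extension

lemma exists_volume_ball_eq (n : ℕ) : ∃ ω : ℝ, 0 < ω ∧ ∀ (x : Rn n) (r : ℝ), 0 < r →
    volume (ball x r) = ENNReal.ofReal (ω * r ^ n) := by
  have h0 : volume (ball (0 : Rn n) 1) ≠ ⊤ := measure_ball_lt_top.ne
  refine ⟨(volume (ball (0 : Rn n) 1)).toReal,
    ENNReal.toReal_pos (measure_ball_pos _ _ one_pos).ne' h0, fun x r hr => ?_⟩
  rw [Measure.addHaar_ball_of_pos _ _ hr, mul_comm, ENNReal.ofReal_mul ENNReal.toReal_nonneg,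
    ENNReal.ofReal_toReal h0]
  simp

/-- Off a set of measure at most `m`, the kernel has mass at least of order `m ^ (-sp/n)`. -/
lemma exists_kernel_lower_bound {n : ℕ} (hn : 1 ≤ n) {s p : ℝ} (hs : 0 < s) (hp : 1 < p) :
    ∃ c : ℝ, 0 < c ∧ ∀ (A : Set (Rn n)) (m : ℝ), 0 < m → MeasurableSet A →
      volume A ≤ ENNReal.ofReal m → ∀ x : Rn n,
        ENNReal.ofReal (c * m ^ (-(s * p / n))) ≤
          ∫⁻ y in Aᶜ, ENNReal.ofReal (1 / ‖x - y‖ ^ ((n : ℝ) + s * p)) := by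
  obtain ⟨ω, hω, hvol⟩ := exists_volume_ball_eq n
  have hn0 : (0 : ℝ) < n := by exact_mod_cast hn
  have : NeZero n := ⟨by omega⟩
  refine ⟨(ω / 2) ^ (1 + s * p / n), by positivity, fun A m hm hA hAm x => ?_⟩
  set R : ℝ := (2 * m / ω) ^ (1 / (n : ℝ)) with hR
  have hR0 : 0 < R := by positivity
  have hRn : R ^ n = 2 * m / ω := by
    rw [hR, ← Real.rpow_natCast, ← Real.rpow_mul (by positivity), one_div_mul_cancel hn0.ne',
      Real.rpow_one]
  have hball : volume (ball x R) = ENNReal.ofReal (2 * m) := by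
    rw [hvol x R hR0, hRn]; congr 1; field_simp
  set S := (ball x R \ A) \ {x} with hS
  have hSm : ENNReal.ofReal m ≤ volume S := by
    rw [hS, measure_sdiff_null (measure_singleton x)]
    calc ENNReal.ofReal m = ENNReal.ofReal (2 * m) - ENNReal.ofReal m := by
          rw [← ENNReal.ofReal_sub _ hm.le]; congr 1; ring
      _ ≤ volume (ball x R) - volume A := by rw [hball]; gcongr
      _ ≤ _ := le_measure_sdiff
  have hSmeas : MeasurableSet S := (measurableSet_ball.diff hA).diff (measurableSet_singleton x)
  have hRpow : R ^ ((n : ℝ) + s * p) = (2 * m / ω) ^ (1 + s * p / n) := by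
    rw [hR, ← Real.rpow_mul (by positivity)]; congr 1; field_simp
  calc ENNReal.ofReal ((ω / 2) ^ (1 + s * p / n) * m ^ (-(s * p / n)))
      = ENNReal.ofReal (1 / R ^ ((n : ℝ) + s * p)) * ENNReal.ofReal m := by
        rw [← ENNReal.ofReal_mul (by positivity), hRpow]
        congr 1
        have h1 : (2 * m / ω) = m / (ω / 2) := by field_simp
        rw [h1, Real.div_rpow hm.le (by positivity), Real.rpow_add hm, Real.rpow_one,
          Real.rpow_neg hm.le]
        field_simp
    _ ≤ ENNReal.ofReal (1 / R ^ ((n : ℝ) + s * p)) * volume S := by gcongr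
    _ = ∫⁻ y in S, ENNReal.ofReal (1 / R ^ ((n : ℝ) + s * p)) := by
        rw [setLIntegral_const]
    _ ≤ ∫⁻ y in S, ENNReal.ofReal (1 / ‖x - y‖ ^ ((n : ℝ) + s * p)) := by
        refine setLIntegral_mono' hSmeas fun y hy => ?_
        have hy1 : ‖x - y‖ < R := by
          have := hy.1.1; rwa [mem_ball, dist_comm, dist_eq_norm] at this
        have hy0 : 0 < ‖x - y‖ := norm_pos_iff.2 (sub_ne_zero.2 (Ne.symm hy.2))
        gcongr
    _ ≤ _ := lintegral_mono_set fun y hy => hy.1.2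

/-- A radial Lipschitz cutoff supported in the ball of radius `ρ`. -/
def cutoff {n : ℕ} (L ρ : ℝ) (x₀ x : Rn n) : ℝ := min 1 (max 0 (L * (ρ - ‖x - x₀‖)))

section Cutoff

variable {n : ℕ} {L ρ : ℝ} {x₀ : Rn n}

lemma cutoff_nonneg (x : Rn n) : 0 ≤ cutoff L ρ x₀ x := le_min zero_le_one (le_max_left _ _)

lemma cutoff_le_one (x : Rn n) : cutoff L ρ x₀ x ≤ 1 := min_le_left _ _

lemma continuous_cutoff : Continuous (cutoff L ρ x₀ : Rn n → ℝ) := by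
  unfold cutoff; fun_prop

lemma cutoff_eq_zero (hL : 0 ≤ L) {x : Rn n} (hx : ρ ≤ ‖x - x₀‖) : cutoff L ρ x₀ x = 0 := by
  have : L * (ρ - ‖x - x₀‖) ≤ 0 := mul_nonpos_of_nonneg_of_nonpos hL (by linarith)
  simp [cutoff, max_eq_left this]

lemma cutoff_eq_one {x : Rn n} (hx : 1 ≤ L * (ρ - ‖x - x₀‖)) : cutoff L ρ x₀ x = 1 :=
  min_eq_left (hx.trans (le_max_right _ _))

lemma abs_cutoff_sub_le (hL : 0 ≤ L) (x y : Rn n) :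
    |cutoff L ρ x₀ x - cutoff L ρ x₀ y| ≤ min 1 (L * ‖x - y‖) := by
  refine le_min ?_ ?_
  · have := cutoff_nonneg (L := L) (ρ := ρ) (x₀ := x₀) x
    have := cutoff_nonneg (L := L) (ρ := ρ) (x₀ := x₀) y
    have := cutoff_le_one (L := L) (ρ := ρ) (x₀ := x₀) x
    have := cutoff_le_one (L := L) (ρ := ρ) (x₀ := x₀) y
    rw [abs_le]; constructor <;> linarith
  · unfold cutoff
    calc _ ≤ |max 0 (L * (ρ - ‖x - x₀‖)) - max 0 (L * (ρ - ‖y - x₀‖))| := by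
          have := abs_min_sub_min_le_max (1 : ℝ) (max 0 (L * (ρ - ‖x - x₀‖))) 1
            (max 0 (L * (ρ - ‖y - x₀‖)))
          simpa using this
      _ ≤ |L * (ρ - ‖x - x₀‖) - L * (ρ - ‖y - x₀‖)| := by
          have := abs_max_sub_max_le_max (0 : ℝ) (L * (ρ - ‖x - x₀‖)) 0 (L * (ρ - ‖y - x₀‖))
          simpa using this
      _ = L * |‖y - x₀‖ - ‖x - x₀‖| := by
          rw [← mul_sub, abs_mul, abs_of_nonneg hL]; congr 2; ring
      _ ≤ L * ‖x - y‖ := by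
          gcongr
          have := abs_norm_sub_norm_le (y - x₀) (x - x₀)
          rw [sub_sub_sub_cancel_right, norm_sub_rev y x] at this
          exact this

end Cutoff

/-- Comparison of nonnegative functions whose difference is dominated by a function with
nonpositive integral. -/
lemma lintegral_le_of_integral_nonpos {α : Type*} [MeasurableSpace α] {μ : Measure α}
    {F f g : α → ℝ} (hF : Integrable F μ) (hF0 : ∫ z, F z ∂μ ≤ 0) (hg : AEStronglyMeasurable g μ)
    (hf0 : ∀ z, 0 ≤ f z) (hg0 : ∀ z, 0 ≤ g z) (h : ∀ z, f z ≤ F z + g z) :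
    ∫⁻ z, ENNReal.ofReal (f z) ∂μ ≤ ∫⁻ z, ENNReal.ofReal (g z) ∂μ := by
  by_cases hfin : ∫⁻ z, ENNReal.ofReal (g z) ∂μ = ⊤
  · rw [hfin]; exact le_top
  have hgi : Integrable g μ := by
    refine ⟨hg, ?_⟩
    rw [hasFiniteIntegral_iff_ofReal (Eventually.of_forall hg0)]
    exact lt_top_iff_ne_top.2 hfin
  calc ∫⁻ z, ENNReal.ofReal (f z) ∂μ ≤ ∫⁻ z, ENNReal.ofReal (F z + g z) ∂μ :=
        lintegral_mono fun z => ENNReal.ofReal_le_ofReal (h z)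
    _ = ENNReal.ofReal (∫ z, (F z + g z) ∂μ) :=
        (ofReal_integral_eq_lintegral_ofReal (hF.add hgi)
          (Eventually.of_forall fun z => (hf0 z).trans (h z))).symm
    _ ≤ ENNReal.ofReal (∫ z, g z ∂μ) := by
        apply ENNReal.ofReal_le_ofReal
        rw [integral_add hF hgi]; linarith
    _ = _ := ofReal_integral_eq_lintegral_ofReal hgi (Eventually.of_forall hg0)

/-- The truncations `(w - h)₊ η ^ p` have finite energy. -/
lemma gagliardo_truncation_lt_top {n : ℕ} (hn : 1 ≤ n) {s p : ℝ} (hs : 0 < s) (hs1 : s < 1)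
    (hp : 1 < p) {w : Rn n → ℝ} (hwm : Measurable w) (hw : memWsp n s p univ w)
    {h L ρ : ℝ} (hh : 0 ≤ h) (hL : 0 < L) (x₀ : Rn n) :
    ∫⁻ x, ENNReal.ofReal (|max (w x - h) 0 * cutoff L ρ x₀ x ^ p| ^ p) < ⊤ ∧
    gagliardo n s p univ (fun x => max (w x - h) 0 * cutoff L ρ x₀ x ^ p) < ⊤ := by
  obtain ⟨J, hJ, HJ⟩ := exists_kernel_integral_bound hn hs hs1 hp
  obtain ⟨-, hwp, hwg⟩ := hw
  rw [Measure.restrict_univ] at hwp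
  have ha : ∀ x, max (w x - h) 0 ≤ |w x| := fun x =>
    max_le (by linarith [le_abs_self (w x)]) (abs_nonneg _)
  have hb1 : ∀ x, cutoff L ρ x₀ x ^ p ≤ 1 := fun x =>
    Real.rpow_le_one (cutoff_nonneg x) (cutoff_le_one x) (by linarith)
  have hb0 : ∀ x, 0 ≤ cutoff L ρ x₀ x ^ p := fun x => Real.rpow_nonneg (cutoff_nonneg x) _
  constructor
  · refine lt_of_le_of_lt (lintegral_mono fun x => ENNReal.ofReal_le_ofReal ?_) hwp
    refine Real.rpow_le_rpow (abs_nonneg _) ?_ (by linarith)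
    rw [abs_of_nonneg (mul_nonneg (le_max_right _ _) (hb0 x))]
    calc _ ≤ max (w x - h) 0 * 1 := by gcongr; exact hb1 x
      _ ≤ _ := by rw [mul_one]; exact ha x
  · have hbern : ∀ e f : ℝ, 0 ≤ e → 0 ≤ f → e ≤ 1 → f ≤ 1 → |e ^ p - f ^ p| ≤ p * |e - f| := by
      have key : ∀ e f : ℝ, 0 ≤ e → 0 ≤ f → e ≤ 1 → f ≤ 1 → e ≤ f →
          |e ^ p - f ^ p| ≤ p * |e - f| := by
        intro e f he hf he1 hf1 hef
        have h1 := rpow_sub_rpow_le hp.le he hf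
        have h2 : e ^ p ≤ f ^ p := Real.rpow_le_rpow he hef (by linarith)
        rw [abs_of_nonpos (by linarith), abs_of_nonpos (by linarith)]
        have h3 : f ^ (p - 1) ≤ 1 := Real.rpow_le_one hf hf1 (by linarith)
        have h4 : p * f ^ (p - 1) * (f - e) ≤ p * 1 * (f - e) := by
          have : 0 ≤ f - e := by linarith
          gcongr
        linarith
      intro e f he hf he1 hf1
      rcases le_total e f with hef | hef
      · exact key e f he hf he1 hf1 hef
      · rw [abs_sub_comm, abs_sub_comm e]; exact key f e hf he hf1 he1 hef
    have hpt : ∀ x y, |max (w x - h) 0 * cutoff L ρ x₀ x ^ p - max (w y - h) 0 * cutoff L ρ x₀ y ^ p| ^ p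
        ≤ 2 ^ p * (|w x - w y| ^ p + p ^ p * |w y| ^ p * min 1 (L * ‖x - y‖) ^ p) := by
      intro x y
      have e1 : |max (w x - h) 0 * cutoff L ρ x₀ x ^ p - max (w y - h) 0 * cutoff L ρ x₀ y ^ p| ≤
          |w x - w y| + p * |w y| * min 1 (L * ‖x - y‖) := by
        calc _ = |(max (w x - h) 0 - max (w y - h) 0) * cutoff L ρ x₀ x ^ p +
              max (w y - h) 0 * (cutoff L ρ x₀ x ^ p - cutoff L ρ x₀ y ^ p)| := by congr 1; ring
          _ ≤ |max (w x - h) 0 - max (w y - h) 0| * cutoff L ρ x₀ x ^ p +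
              max (w y - h) 0 * |cutoff L ρ x₀ x ^ p - cutoff L ρ x₀ y ^ p| := by
            refine (abs_add_le _ _).trans_eq ?_
            rw [abs_mul, abs_mul, abs_of_nonneg (hb0 x), abs_of_nonneg (le_max_right (w y - h) 0)]
          _ ≤ |w x - w y| * 1 + |w y| * (p * min 1 (L * ‖x - y‖)) := by
            have d1 : |max (w x - h) 0 - max (w y - h) 0| ≤ |w x - w y| := by
              have := abs_max_sub_max_le_max (w x - h) 0 (w y - h) 0
              simpa using this
            have d2 : |cutoff L ρ x₀ x ^ p - cutoff L ρ x₀ y ^ p| ≤ p * min 1 (L * ‖x - y‖) := by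
              refine (hbern _ _ (cutoff_nonneg x) (cutoff_nonneg y) (cutoff_le_one x)
                (cutoff_le_one y)).trans ?_
              gcongr
              exact abs_cutoff_sub_le hL.le x y
            exact add_le_add (mul_le_mul d1 (hb1 x) (hb0 x) (abs_nonneg _))
              (mul_le_mul (ha y) d2 (abs_nonneg _) (abs_nonneg _))
          _ = _ := by ring
      set A := |w x - w y| with hA
      have hA0 : 0 ≤ A := abs_nonneg _
      have hm0 : 0 ≤ min 1 (L * ‖x - y‖) := le_min zero_le_one (by positivity)
      set T := p * |w y| * min 1 (L * ‖x - y‖) with hT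
      have hT0 : 0 ≤ T := by positivity
      have hTp : T ^ p = p ^ p * |w y| ^ p * min 1 (L * ‖x - y‖) ^ p := by
        rw [hT, Real.mul_rpow (by positivity) hm0, Real.mul_rpow (by positivity) (by positivity)]
      rw [← hTp]
      calc _ ≤ (A + T) ^ p := Real.rpow_le_rpow (abs_nonneg _) e1 (by linarith)
        _ ≤ (2 * max A T) ^ p := by
            have h0 : 0 ≤ p := by linarith
            gcongr
            linarith [le_max_left A T, le_max_right A T]
        _ = 2 ^ p * max A T ^ p := Real.mul_rpow (by norm_num) (le_max_of_le_left hA0)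
        _ ≤ _ := by
            gcongr
            have := Real.rpow_nonneg hA0 p
            have := Real.rpow_nonneg hT0 p
            rcases max_cases A T with ⟨e, -⟩ | ⟨e, -⟩ <;> rw [e] <;> linarith
    simp only [gagliardo, Measure.restrict_univ] at hwg ⊢
    have hDm : Measurable (fun z : Rn n × Rn n => ‖z.1 - z.2‖ ^ ((n : ℝ) + s * p)) := by fun_prop
    calc _ ≤ ∫⁻ x, ∫⁻ y, ENNReal.ofReal (2 ^ p) *
          (ENNReal.ofReal (|w x - w y| ^ p / ‖x - y‖ ^ ((n : ℝ) + s * p)) +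
          ENNReal.ofReal (p ^ p * |w y| ^ p) *
            ENNReal.ofReal (min 1 (L * ‖x - y‖) ^ p / ‖x - y‖ ^ ((n : ℝ) + s * p))) := by
          refine lintegral_mono fun x => lintegral_mono fun y => ?_
          have hm0 : 0 ≤ min 1 (L * ‖x - y‖) := le_min zero_le_one (by positivity)
          simp only
          rw [← ENNReal.ofReal_mul (by positivity), ← ENNReal.ofReal_add (by positivity)
            (by positivity), ← ENNReal.ofReal_mul (by positivity)]
          apply ENNReal.ofReal_le_ofReal
          calc _ ≤ 2 ^ p * (|w x - w y| ^ p + p ^ p * |w y| ^ p * min 1 (L * ‖x - y‖) ^ p) /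
                ‖x - y‖ ^ ((n : ℝ) + s * p) := by gcongr; exact hpt x y
            _ = _ := by ring
      _ = ENNReal.ofReal (2 ^ p) * ((∫⁻ x, ∫⁻ y,
          ENNReal.ofReal (|w x - w y| ^ p / ‖x - y‖ ^ ((n : ℝ) + s * p))) +
          ∫⁻ x, ∫⁻ y, ENNReal.ofReal (p ^ p * |w y| ^ p) *
            ENNReal.ofReal (min 1 (L * ‖x - y‖) ^ p / ‖x - y‖ ^ ((n : ℝ) + s * p))) := by
          rw [← lintegral_add_left (by fun_prop), ← lintegral_const_mul _ (by fun_prop)]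
          refine lintegral_congr fun x => ?_
          rw [← lintegral_add_left (by fun_prop), ← lintegral_const_mul _ (by fun_prop)]
      _ < ⊤ := by
          refine ENNReal.mul_lt_top ENNReal.ofReal_lt_top (ENNReal.add_lt_top.2 ⟨hwg, ?_⟩)
          rw [lintegral_lintegral_swap (by fun_prop)]
          calc _ ≤ ∫⁻ y, ENNReal.ofReal (p ^ p * |w y| ^ p) * ENNReal.ofReal (J * L ^ (s * p)) := by
                refine lintegral_mono fun y => ?_
                simp only
                rw [lintegral_const_mul _ (by fun_prop)]
                gcongr
                simp only [norm_sub_rev _ y]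
                exact HJ L y hL
            _ = ENNReal.ofReal (p ^ p) * (∫⁻ y, ENNReal.ofReal (|w y| ^ p)) *
                ENNReal.ofReal (J * L ^ (s * p)) := by
                rw [lintegral_mul_const _ (by fun_prop), ← lintegral_const_mul _ (by fun_prop)]
                congr 2
                funext y
                rw [ENNReal.ofReal_mul (by positivity)]
            _ < ⊤ := ENNReal.mul_lt_top (ENNReal.mul_lt_top ENNReal.ofReal_lt_top hwp)
                ENNReal.ofReal_lt_top

/-- The level-set decay estimate resulting from the Caccioppoli inequality and the fractional
Sobolev-type lower bound. -/
def LevelDecay (n : ℕ) (s p C : ℝ) (Ω : Set (Rn n)) (w : Rn n → ℝ) : Prop :=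
  ∀ (x₀ : Rn n) (ρ₁ ρ₂ h m : ℝ), ball x₀ ρ₂ ⊆ Ω → 0 < ρ₁ → ρ₁ < ρ₂ → 0 ≤ h → 0 < m →
    volume (ball x₀ ρ₂ ∩ {x | h < w x}) ≤ ENNReal.ofReal m →
    ∫⁻ x in ball x₀ ρ₁, ENNReal.ofReal (max (w x - h) 0 ^ p) ≤
      ENNReal.ofReal (C * m ^ (s * p / n)) *
        (ENNReal.ofReal ((ρ₂ - ρ₁) ^ (-(s * p))) *
            (∫⁻ x in ball x₀ ρ₂, ENNReal.ofReal (max (w x - h) 0 ^ p)) +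
          ENNReal.ofReal ((2 * ρ₂ / (ρ₂ - ρ₁)) ^ ((n : ℝ) + s * p)) *
            (∫⁻ x in ball x₀ ρ₂, ENNReal.ofReal (max (w x - h) 0)) *
            ∫⁻ y in (ball x₀ ρ₂)ᶜ,
              ENNReal.ofReal (max (w y) 0 ^ (p - 1) / ‖y - x₀‖ ^ ((n : ℝ) + s * p)))

section LevelDecay

variable {n : ℕ} {s p Λ : ℝ}

/-- The error terms of the energy inequality. -/
def energyError (p h : ℝ) (w η X : Rn n → ℝ) (x y : Rn n) : ℝ :=
  X x * max (w x - h) 0 ^ p * |η x - η y| ^ p +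
    (1 - X y) * (max (w y - h) 0 ^ (p - 1) * (max (w x - h) 0 * η x ^ p))

lemma lintegral_energyError_le (hn : 1 ≤ n) (hs : 0 < s) (hs1 : s < 1) (hp : 1 < p) :
    ∃ J : ℝ, 0 < J ∧ ∀ (w : Rn n → ℝ) (x₀ : Rn n) (ρ₁ ρ₂ h : ℝ), Measurable w → 0 < ρ₁ →
      ρ₁ < ρ₂ → 0 ≤ h →
      ∫⁻ x, ∫⁻ y, ENNReal.ofReal (energyError p h w
          (cutoff (2 / (ρ₂ - ρ₁)) ((ρ₁ + ρ₂) / 2) x₀)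
          ((ball x₀ ρ₂).indicator fun _ => 1) x y / ‖x - y‖ ^ ((n : ℝ) + s * p)) ≤
        ENNReal.ofReal J * (ENNReal.ofReal ((ρ₂ - ρ₁) ^ (-(s * p))) *
            ∫⁻ x in ball x₀ ρ₂, ENNReal.ofReal (max (w x - h) 0 ^ p)) +
          ENNReal.ofReal ((2 * ρ₂ / (ρ₂ - ρ₁)) ^ ((n : ℝ) + s * p)) *
            (∫⁻ x in ball x₀ ρ₂, ENNReal.ofReal (max (w x - h) 0)) *
            ∫⁻ y in (ball x₀ ρ₂)ᶜ,
              ENNReal.ofReal (max (w y) 0 ^ (p - 1) / ‖y - x₀‖ ^ ((n : ℝ) + s * p)) := by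
  obtain ⟨J, hJ, HJ⟩ := exists_kernel_integral_bound hn hs hs1 hp
  refine ⟨J * 2 ^ (s * p), by positivity, fun w x₀ ρ₁ ρ₂ h hwm hρ₁ hρ hh => ?_⟩
  have hd : 0 < ρ₂ - ρ₁ := by linarith
  set L := 2 / (ρ₂ - ρ₁) with hL
  have hL0 : 0 < L := by positivity
  set η := cutoff L ((ρ₁ + ρ₂) / 2) x₀ with hη
  set X : Rn n → ℝ := (ball x₀ ρ₂).indicator fun _ => 1 with hX
  set κ := (2 * ρ₂ / (ρ₂ - ρ₁)) ^ ((n : ℝ) + s * p) with hκ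
  have hκ0 : 0 ≤ κ := Real.rpow_nonneg (div_nonneg (by linarith) hd.le) _
  have hηm : Measurable η := continuous_cutoff.measurable
  have hXm : Measurable X := measurable_const.indicator measurableSet_ball
  set a : Rn n → ℝ := fun x => max (w x - h) 0 with ha
  have ham : Measurable a := by rw [ha]; fun_prop
  have ha0 : ∀ x, 0 ≤ a x := fun x => le_max_right _ _
  have hη0 : ∀ x, 0 ≤ η x := cutoff_nonneg
  have hpt : ∀ x y, ENNReal.ofReal (energyError p h w η X x y / ‖x - y‖ ^ ((n : ℝ) + s * p)) ≤
      (ball x₀ ρ₂).indicator (fun x => ENNReal.ofReal (a x ^ p)) x *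
        ENNReal.ofReal (min 1 (L * ‖x - y‖) ^ p / ‖x - y‖ ^ ((n : ℝ) + s * p)) +
      ENNReal.ofReal κ * ((ball x₀ ρ₂).indicator (fun x => ENNReal.ofReal (a x)) x *
        ((ball x₀ ρ₂)ᶜ).indicator (fun y =>
          ENNReal.ofReal (max (w y) 0 ^ (p - 1) / ‖y - x₀‖ ^ ((n : ℝ) + s * p))) y) := by
    intro x y
    rw [energyError, add_div]
    refine ENNReal.ofReal_add_le.trans (add_le_add ?_ ?_)
    · by_cases hx : x ∈ ball x₀ ρ₂
      · rw [hX, indicator_of_mem hx, indicator_of_mem hx,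
          ← ENNReal.ofReal_mul (Real.rpow_nonneg (ha0 x) _)]
        apply ENNReal.ofReal_le_ofReal
        rw [one_mul, mul_div_assoc]
        gcongr
        exact abs_cutoff_sub_le hL0.le x y
      · rw [hX, indicator_of_notMem hx]
        simp
    · by_cases hy : y ∈ ball x₀ ρ₂
      · rw [hX, indicator_of_mem hy]; simp
      by_cases hηx : η x = 0
      · rw [hηx, Real.zero_rpow (by linarith)]; simp
      have hxm : ‖x - x₀‖ < (ρ₁ + ρ₂) / 2 := by
        by_contra! hcon
        exact hηx (cutoff_eq_zero hL0.le hcon)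
      have hx : x ∈ ball x₀ ρ₂ := by rw [mem_ball, dist_eq_norm]; linarith
      have hyn : ρ₂ ≤ ‖y - x₀‖ := by
        rw [mem_ball, dist_eq_norm, not_lt] at hy; exact hy
      have hxy : (ρ₂ - ρ₁) / (2 * ρ₂) * ‖y - x₀‖ ≤ ‖x - y‖ := by
        have h1 : ‖y - x₀‖ ≤ ‖x - y‖ + ‖x - x₀‖ := by
          calc ‖y - x₀‖ = ‖(x - x₀) - (x - y)‖ := by congr 1; abel
            _ ≤ _ := by rw [add_comm]; exact norm_sub_le _ _
        have hρ2 : 0 < ρ₂ := by linarith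
        rw [div_mul_eq_mul_div, div_le_iff₀ (by linarith)]
        nlinarith
      have hy0 : 0 < ‖y - x₀‖ := by linarith
      rw [indicator_of_mem hx, indicator_of_mem (show y ∈ (ball x₀ ρ₂)ᶜ from hy), hX,
        indicator_of_notMem hy, ← ENNReal.ofReal_mul (ha0 x), ← ENNReal.ofReal_mul hκ0]
      apply ENNReal.ofReal_le_ofReal
      have hD : 1 / ‖x - y‖ ^ ((n : ℝ) + s * p) ≤ κ / ‖y - x₀‖ ^ ((n : ℝ) + s * p) := by
        have hq : 0 < (ρ₂ - ρ₁) / (2 * ρ₂) * ‖y - x₀‖ :=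
          mul_pos (div_pos hd (by linarith)) hy0
        calc _ ≤ 1 / ((ρ₂ - ρ₁) / (2 * ρ₂) * ‖y - x₀‖) ^ ((n : ℝ) + s * p) := by gcongr
          _ = _ := by
            have hq1 : 0 ≤ (ρ₂ - ρ₁) / (2 * ρ₂) := (div_pos hd (by linarith)).le
            rw [Real.mul_rpow hq1 hy0.le, hκ, ← inv_div (ρ₂ - ρ₁) (2 * ρ₂), Real.inv_rpow hq1]
            rw [one_div, mul_inv, div_eq_mul_inv (Inv.inv _)]
      have hay : a y ≤ max (w y) 0 := max_le_max (by linarith) le_rfl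
      have hηp : η x ^ p ≤ 1 := Real.rpow_le_one (hη0 x) (cutoff_le_one x) (by linarith)
      calc (1 - 0) * (a y ^ (p - 1) * (a x * η x ^ p)) / ‖x - y‖ ^ ((n : ℝ) + s * p)
          = (a y ^ (p - 1) * (a x * η x ^ p)) * (1 / ‖x - y‖ ^ ((n : ℝ) + s * p)) := by ring
        _ ≤ (max (w y) 0 ^ (p - 1) * (a x * 1)) * (κ / ‖y - x₀‖ ^ ((n : ℝ) + s * p)) := by
            have := ha0 x
            have := ha0 y
            have := hη0 x
            gcongr
        _ = _ := by ring
  have hT : Measurable (fun y => ENNReal.ofReal (max (w y) 0 ^ (p - 1) /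
      ‖y - x₀‖ ^ ((n : ℝ) + s * p))) := by fun_prop
  have hI1 : Measurable ((ball x₀ ρ₂).indicator (fun x => ENNReal.ofReal (a x ^ p))) :=
    Measurable.indicator (by fun_prop) measurableSet_ball
  have hI2 : Measurable ((ball x₀ ρ₂).indicator (fun x => ENNReal.ofReal (a x))) :=
    Measurable.indicator (by fun_prop) measurableSet_ball
  have hI3 := hT.indicator (measurableSet_ball (x := x₀) (ε := ρ₂)).compl
  calc _ ≤ ∫⁻ x, ((ball x₀ ρ₂).indicator (fun x => ENNReal.ofReal (a x ^ p)) x *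
        ENNReal.ofReal (J * L ^ (s * p)) +
      ENNReal.ofReal κ * ((ball x₀ ρ₂).indicator (fun x => ENNReal.ofReal (a x)) x *
        ∫⁻ y in (ball x₀ ρ₂)ᶜ,
          ENNReal.ofReal (max (w y) 0 ^ (p - 1) / ‖y - x₀‖ ^ ((n : ℝ) + s * p)))) := by
        refine lintegral_mono fun x => (lintegral_mono fun y => hpt x y).trans ?_
        rw [lintegral_add_left (by fun_prop), lintegral_const_mul _ (by fun_prop),
          lintegral_const_mul _ (by fun_prop), lintegral_const_mul _ hI3,
          lintegral_indicator measurableSet_ball.compl]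
        gcongr
        exact HJ L x hL0
    _ = _ := by
        rw [lintegral_add_left (by fun_prop), lintegral_mul_const _ hI1,
          lintegral_const_mul _ (by fun_prop), lintegral_mul_const _ hI2,
          lintegral_indicator measurableSet_ball, lintegral_indicator measurableSet_ball, mul_assoc]
        congr 1
        have : J * L ^ (s * p) = J * 2 ^ (s * p) * (ρ₂ - ρ₁) ^ (-(s * p)) := by
          rw [hL, Real.div_rpow (by norm_num) hd.le, Real.rpow_neg hd.le]; ring
        rw [this, ENNReal.ofReal_mul (by positivity)]
        ring

lemma lintegral_prod_symmetrize {E : Rn n → Rn n → ℝ} {C : ℝ} (hC : 0 ≤ C)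
    (hEm : Measurable (fun z : Rn n × Rn n => E z.1 z.2)) (hE0 : ∀ x y, 0 ≤ E x y) :
    ∫⁻ z : Rn n × Rn n, ENNReal.ofReal (C * (E z.1 z.2 + E z.2 z.1))
        ∂((volume : Measure (Rn n)).prod volume) =
      ENNReal.ofReal C * (2 * ∫⁻ x, ∫⁻ y, ENNReal.ofReal (E x y)) := by
  have hEm' : Measurable (fun z : Rn n × Rn n => E z.2 z.1) := hEm.comp measurable_swap
  rw [lintegral_prod _ (by fun_prop)]
  have e1 : ∀ x y, ENNReal.ofReal (C * (E x y + E y x)) =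
      ENNReal.ofReal C * (ENNReal.ofReal (E x y) + ENNReal.ofReal (E y x)) := fun x y => by
    rw [ENNReal.ofReal_mul hC, ENNReal.ofReal_add (hE0 _ _) (hE0 _ _)]
  simp only [e1]
  have m1 : ∀ x, Measurable fun y => E x y := fun x => hEm.comp measurable_prodMk_left
  have m2 : ∀ x, Measurable fun y => E y x := fun x => hEm.comp measurable_prodMk_right
  have m3 : Measurable fun x => ∫⁻ y, ENNReal.ofReal (E x y) :=
    Measurable.lintegral_prod_right' (f := fun z : Rn n × Rn n => ENNReal.ofReal (E z.1 z.2))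
      (by fun_prop)
  have m4 : Measurable fun x => ∫⁻ y, ENNReal.ofReal (E y x) :=
    Measurable.lintegral_prod_right' (f := fun z : Rn n × Rn n => ENNReal.ofReal (E z.2 z.1))
      (by fun_prop)
  have e2 : ∀ x, ∫⁻ y, ENNReal.ofReal C * (ENNReal.ofReal (E x y) + ENNReal.ofReal (E y x)) =
      ENNReal.ofReal C * ((∫⁻ y, ENNReal.ofReal (E x y)) + ∫⁻ y, ENNReal.ofReal (E y x)) :=
    fun x => by
      have := m1 x
      have := m2 x
      rw [lintegral_const_mul _ (by fun_prop), lintegral_add_left (by fun_prop)]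
  simp only [e2]
  rw [lintegral_const_mul _ (by fun_prop), lintegral_add_left m3,
    lintegral_lintegral_swap (f := fun x y => ENNReal.ofReal (E y x))
      (hEm'.ennreal_ofReal.aemeasurable), two_mul]

lemma lintegral_kernel_level_lower {w η : Rn n → ℝ} {x₀ : Rn n} {ρ₁ ρ₂ h m lam c : ℝ}
    (hl0 : 0 ≤ lam) (hwm : Measurable w) (hηm : Measurable η)
    (hη1 : ∀ x ∈ ball x₀ ρ₁, η x = 1) (hηs : ∀ x, x ∉ ball x₀ ρ₂ → η x = 0)
    (Hc : ∀ x : Rn n, ENNReal.ofReal (c * m ^ (-(s * p / n))) ≤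
      ∫⁻ y in (ball x₀ ρ₂ ∩ {x | h < w x})ᶜ, ENNReal.ofReal (1 / ‖x - y‖ ^ ((n : ℝ) + s * p))) :
    (∫⁻ x in ball x₀ ρ₁, ENNReal.ofReal (max (w x - h) 0 ^ p)) *
      ENNReal.ofReal (lam * (c * m ^ (-(s * p / n)))) ≤
    ∫⁻ z : Rn n × Rn n, ENNReal.ofReal (lam *
      (if max (w z.2 - h) 0 * η z.2 = 0 then (max (w z.1 - h) 0 * η z.1) ^ p else 0) /
        ‖z.1 - z.2‖ ^ ((n : ℝ) + s * p)) ∂((volume : Measure (Rn n)).prod volume) := by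
  have ha0 : ∀ x, 0 ≤ max (w x - h) 0 := fun x => le_max_right _ _
  have hGm : Measurable fun z : Rn n × Rn n => lam *
      (if max (w z.2 - h) 0 * η z.2 = 0 then (max (w z.1 - h) 0 * η z.1) ^ p else 0) /
        ‖z.1 - z.2‖ ^ ((n : ℝ) + s * p) := by
    refine ((Measurable.ite ?_ (by fun_prop) measurable_const).const_mul _).div (by fun_prop)
    exact measurableSet_eq_fun (by fun_prop) measurable_const
  set A := ball x₀ ρ₂ ∩ {x | h < w x} with hA
  have hAm : MeasurableSet A := measurableSet_ball.inter (measurableSet_lt measurable_const hwm)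
  rw [lintegral_prod _ hGm.ennreal_ofReal.aemeasurable, ← lintegral_mul_const _ (by fun_prop)]
  refine le_trans (setLIntegral_mono' measurableSet_ball fun x hx => ?_)
    (setLIntegral_le_lintegral (ball x₀ ρ₁) _)
  have hηx : η x = 1 := hη1 x hx
  have hcst : 0 ≤ lam * max (w x - h) 0 ^ p :=
    mul_nonneg hl0 (Real.rpow_nonneg (ha0 x) _)
  calc _ = ENNReal.ofReal (lam * max (w x - h) 0 ^ p) *
        ENNReal.ofReal (c * m ^ (-(s * p / n))) := by
        rw [← ENNReal.ofReal_mul (Real.rpow_nonneg (ha0 x) _), ← ENNReal.ofReal_mul hcst]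
        congr 1; ring
    _ ≤ ENNReal.ofReal (lam * max (w x - h) 0 ^ p) *
        ∫⁻ y in Aᶜ, ENNReal.ofReal (1 / ‖x - y‖ ^ ((n : ℝ) + s * p)) := by
        gcongr
        exact Hc x
    _ = ∫⁻ y in Aᶜ, ENNReal.ofReal (lam *
          (if max (w y - h) 0 * η y = 0 then (max (w x - h) 0 * η x) ^ p else 0) /
            ‖x - y‖ ^ ((n : ℝ) + s * p)) := by
        rw [← lintegral_const_mul _ (by fun_prop)]
        refine setLIntegral_congr_fun hAm.compl fun y hy => ?_
        have h0 : max (w y - h) 0 * η y = 0 := by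
          by_cases hyb : y ∈ ball x₀ ρ₂
          · have : ¬ h < w y := fun hlt => hy ⟨hyb, hlt⟩
            rw [max_eq_right (by linarith), zero_mul]
          · rw [hηs y hyb, mul_zero]
        rw [if_pos h0, hηx, mul_one, ← ENNReal.ofReal_mul hcst, mul_one_div]
    _ ≤ _ := setLIntegral_le_lintegral _ _

set_option maxHeartbeats 1000000 in
/-- Subsolutions satisfy the level-set decay estimate. -/
theorem exists_levelDecay (hn : 1 ≤ n) (hs : 0 < s) (hs1 : s < 1) (hp : 1 < p) (hΛ : 1 ≤ Λ) :
    ∃ C : ℝ, 0 < C ∧ ∀ (Φ : ℝ → ℝ) (K : Rn n → Rn n → ℝ) (Ω : Set (Rn n)) (w : Rn n → ℝ),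
      KernelBounds n Λ s p K → PhiBounds Λ p Φ → Measurable w → WeakSubSol n Φ K s p Ω w →
      LevelDecay n s p C Ω w := by
  have hΛ0 : 0 < Λ := by linarith
  obtain ⟨c, hc, Hc⟩ := exists_kernel_lower_bound (n := n) hn hs hp
  obtain ⟨J, hJ, HJ⟩ := lintegral_energyError_le (n := n) hn hs hs1 hp
  set lam := 1 / Λ ^ 2 with hlam
  have hl0 : 0 < lam := by positivity
  obtain ⟨C, hC, HC⟩ := exists_energy_pointwise (p := p) (lam := lam) (M := Λ ^ 2) hp hl0
    (by positivity)
  refine ⟨(lam * c)⁻¹ * (C * (2 * (J + 1))), by positivity,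
    fun Φ K Ω w hK hΦ hwm hw x₀ ρ₁ ρ₂ h m hball hρ₁ hρ hh hm hvol => ?_⟩
  have HE := HJ w x₀ ρ₁ ρ₂ h hwm hρ₁ hρ hh
  have hd : 0 < ρ₂ - ρ₁ := by linarith
  set L := 2 / (ρ₂ - ρ₁) with hL
  have hL0 : 0 < L := by positivity
  set η := cutoff L ((ρ₁ + ρ₂) / 2) x₀ with hη
  set X : Rn n → ℝ := (ball x₀ ρ₂).indicator fun _ => 1 with hX
  have hηm : Measurable η := continuous_cutoff.measurable
  have hXm : Measurable X := measurable_const.indicator measurableSet_ball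
  have hη0 : ∀ x, 0 ≤ η x := cutoff_nonneg
  have hX01 : ∀ x, X x = 1 ∨ X x = 0 ∧ η x = 0 := fun x => by
    by_cases hx : x ∈ ball x₀ ρ₂
    · left; rw [hX, indicator_of_mem hx]
    · right
      refine ⟨by rw [hX, indicator_of_notMem hx], cutoff_eq_zero hL0.le ?_⟩
      rw [mem_ball, dist_eq_norm, not_lt] at hx; linarith
  have hX1 : ∀ x, 0 ≤ X x ∧ 0 ≤ 1 - X x := fun x => by
    rcases hX01 x with h | ⟨h, -⟩ <;> rw [h] <;> norm_num
  have ha0 : ∀ x, 0 ≤ max (w x - h) 0 := fun x => le_max_right _ _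
  obtain ⟨hφp, hφg⟩ := gagliardo_truncation_lt_top hn hs hs1 hp hwm hw.1 hh hL0 x₀
    (ρ := (ρ₁ + ρ₂) / 2)
  obtain ⟨hFi, hF0⟩ := hw.integrable_and_integral_nonpos hs hp hΛ hK hΦ hwm
    (φ := fun x => max (w x - h) 0 * η x ^ p) (by fun_prop)
    (fun x => mul_nonneg (ha0 x) (Real.rpow_nonneg (hη0 x) _)) hφp hφg
    (show (ρ₁ + ρ₂) / 2 < ρ₂ by linarith) hball (fun x hx => by
      have : η x = 0 := cutoff_eq_zero hL0.le (by
        rw [mem_closedBall, dist_eq_norm, not_le] at hx; exact hx.le)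
      rw [this, Real.zero_rpow (by linarith), mul_zero])
  set G : Rn n × Rn n → ℝ := fun z => lam *
    (if max (w z.2 - h) 0 * η z.2 = 0 then (max (w z.1 - h) 0 * η z.1) ^ p else 0) /
      ‖z.1 - z.2‖ ^ ((n : ℝ) + s * p) with hG
  set E : Rn n → Rn n → ℝ := fun x y => energyError p h w η X x y / ‖x - y‖ ^ ((n : ℝ) + s * p)
    with hE
  have hE0 : ∀ x y, 0 ≤ E x y := fun x y => by
    rw [hE]
    refine div_nonneg (add_nonneg ?_ ?_) (by positivity)
    · have := (hX1 x).1; have := ha0 x; positivity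
    · have := (hX1 y).2; have := ha0 x; have := ha0 y; have := hη0 x; positivity
  have hEm : Measurable (fun z : Rn n × Rn n => E z.1 z.2) := by
    simp only [hE, energyError]; fun_prop
  have hG0 : ∀ z, 0 ≤ G z := fun z => by
    rw [hG]
    refine div_nonneg (mul_nonneg hl0.le ?_) (by positivity)
    split_ifs
    · have := ha0 z.1; have := hη0 z.1; positivity
    · exact le_rfl
  have hmain : ∫⁻ z, ENNReal.ofReal (G z) ∂((volume : Measure (Rn n)).prod volume) ≤
      ∫⁻ z : Rn n × Rn n, ENNReal.ofReal (C * (E z.1 z.2 + E z.2 z.1))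
        ∂((volume : Measure (Rn n)).prod volume) := by
    refine lintegral_le_of_integral_nonpos hFi hF0 (by fun_prop) hG0
      (fun z => mul_nonneg hC.le (add_nonneg (hE0 _ _) (hE0 _ _))) fun z => ?_
    obtain ⟨x, y⟩ := z
    rcases eq_or_ne x y with rfl | hxy
    · simp only [hG, hE, sub_self, norm_zero]
      rw [Real.zero_rpow (by positivity)]
      simp
    · have hD : 0 < ‖x - y‖ ^ ((n : ℝ) + s * p) :=
        Real.rpow_pos_of_pos (norm_pos_iff.2 (sub_ne_zero.2 hxy)) _
      have key := HC _ (w x) (w y) h (η x) (η y) (X x) (X y)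
        (fluxBounds_of_kernel hK hΦ hΛ (w x) (w y) hxy) (hη0 x) (hη0 y) (hX01 x) (hX01 y)
      have hsym : ‖y - x‖ = ‖x - y‖ := norm_sub_rev _ _
      simp only [hG, hE, hsym, energyError]
      rw [div_le_iff₀ hD]
      refine key.trans_eq ?_
      rw [abs_sub_comm (η y)]
      field_simp
      ring
  have hupper := lintegral_prod_symmetrize hC.le hEm hE0
  have hlower := lintegral_kernel_level_lower hl0.le hwm hηm
    (fun x hx => cutoff_eq_one (L := L) (ρ := (ρ₁ + ρ₂) / 2) (by
      rw [mem_ball, dist_eq_norm] at hx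
      rw [hL, div_mul_eq_mul_div, le_div_iff₀ hd]
      linarith))
    (fun y hy => (hX01 y).elim (fun h1 => by
      rw [hX, indicator_of_notMem hy] at h1; norm_num at h1) And.right) (Hc _ m hm
        (measurableSet_ball.inter (measurableSet_lt measurable_const hwm)) hvol) (s := s) (p := p) (ρ₁ := ρ₁)
  have hfin := hlower.trans (hmain.trans hupper.le)
  set I := ∫⁻ x in ball x₀ ρ₁, ENNReal.ofReal (max (w x - h) 0 ^ p)
  set S1 := ENNReal.ofReal ((ρ₂ - ρ₁) ^ (-(s * p))) *
            ∫⁻ x in ball x₀ ρ₂, ENNReal.ofReal (max (w x - h) 0 ^ p)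
  set S2 := ENNReal.ofReal ((2 * ρ₂ / (ρ₂ - ρ₁)) ^ ((n : ℝ) + s * p)) *
            (∫⁻ x in ball x₀ ρ₂, ENNReal.ofReal (max (w x - h) 0)) *
            ∫⁻ y in (ball x₀ ρ₂)ᶜ,
              ENNReal.ofReal (max (w y) 0 ^ (p - 1) / ‖y - x₀‖ ^ ((n : ℝ) + s * p))
  have hmul : 0 < lam * (c * m ^ (-(s * p / n))) := by positivity
  calc I = I * ENNReal.ofReal (lam * (c * m ^ (-(s * p / n)))) *
        ENNReal.ofReal ((lam * (c * m ^ (-(s * p / n))))⁻¹) := by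
        rw [mul_assoc, ← ENNReal.ofReal_mul hmul.le, mul_inv_cancel₀ hmul.ne',
          ENNReal.ofReal_one, mul_one]
    _ ≤ ENNReal.ofReal C * (2 * (ENNReal.ofReal (J + 1) * (S1 + S2))) *
        ENNReal.ofReal ((lam * (c * m ^ (-(s * p / n))))⁻¹) := by
        refine mul_le_mul_left (hfin.trans ?_) _
        gcongr
        refine HE.trans ?_
        rw [mul_add]
        gcongr
        · linarith
        · refine le_mul_of_one_le_left zero_le ?_
          rw [← ENNReal.ofReal_one]
          exact ENNReal.ofReal_le_ofReal (by linarith)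
    _ = _ := by
        have e : (lam * c)⁻¹ * (C * (2 * (J + 1))) * m ^ (s * p / n) =
            C * (2 * (J + 1)) * (lam * (c * m ^ (-(s * p / n))))⁻¹ := by
          rw [Real.rpow_neg hm.le]; field_simp
        rw [e, ENNReal.ofReal_mul (by positivity), ENNReal.ofReal_mul hC.le,
          ENNReal.ofReal_mul (by norm_num), ENNReal.ofReal_ofNat]
        ring

end LevelDecay

/-- The `(p - 1)`-th power of the tail of the positive part. -/
def tailMass (n : ℕ) (s p : ℝ) (w : Rn n → ℝ) (x₀ : Rn n) (r : ℝ) : ℝ≥0∞ :=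
  ENNReal.ofReal (r ^ (s * p)) * ∫⁻ y in (ball x₀ r)ᶜ,
    ENNReal.ofReal (max (w y) 0 ^ (p - 1) / ‖y - x₀‖ ^ ((n : ℝ) + s * p))

section DeGiorgi

variable {n : ℕ} {s p : ℝ}

lemma LevelDecay.step (hp : 1 < p) {C : ℝ} (hC : 0 < C)
    {Ω : Set (Rn n)} {w : Rn n → ℝ} (hwm : Measurable w) (hw : LevelDecay n s p C Ω w)
    {x₀ : Rn n} {ρ₁ ρ₂ h d a T : ℝ} (hball : ball x₀ ρ₂ ⊆ Ω) (hρ₁ : 0 < ρ₁) (hρ : ρ₁ < ρ₂)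
    (hh : 0 ≤ h) (hd : 0 < d) (ha : 0 < a) (hT : 0 ≤ T)
    (h_int : ∫⁻ x in ball x₀ ρ₂, ENNReal.ofReal (max (w x - h) 0 ^ p) ≤ ENNReal.ofReal a)
    (htail : ∫⁻ y in (ball x₀ ρ₂)ᶜ, ENNReal.ofReal (max (w y) 0 ^ (p - 1) /
      ‖y - x₀‖ ^ ((n : ℝ) + s * p)) ≤ ENNReal.ofReal T) :
    ∫⁻ x in ball x₀ ρ₁, ENNReal.ofReal (max (w x - (h + d)) 0 ^ p) ≤
      ENNReal.ofReal (C * (a / d ^ p) ^ (s * p / n) * ((ρ₂ - ρ₁) ^ (-(s * p)) * a +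
        (2 * ρ₂ / (ρ₂ - ρ₁)) ^ ((n : ℝ) + s * p) * (a / d ^ (p - 1)) * T)) := by
  have hρd : 0 < ρ₂ - ρ₁ := by linarith
  have hp0 : 0 < p := by linarith
  have hdp : 0 < d ^ p := by positivity
  have hdp1 : 0 < d ^ (p - 1) := by positivity
  have hκ : 0 ≤ (2 * ρ₂ / (ρ₂ - ρ₁)) ^ ((n : ℝ) + s * p) :=
    Real.rpow_nonneg (div_nonneg (by linarith) hρd.le) _
  have hvol : volume (ball x₀ ρ₂ ∩ {x | h + d < w x}) ≤ ENNReal.ofReal (a / d ^ p) := by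
    have hA : MeasurableSet (ball x₀ ρ₂ ∩ {x | h + d < w x}) :=
      measurableSet_ball.inter (measurableSet_lt measurable_const hwm)
    have key : ENNReal.ofReal (d ^ p) * volume (ball x₀ ρ₂ ∩ {x | h + d < w x}) ≤
        ENNReal.ofReal a := by
      rw [← setLIntegral_const]
      refine le_trans ?_ h_int
      refine (setLIntegral_mono' hA fun x hx => ?_).trans (lintegral_mono_set inter_subset_left)
      apply ENNReal.ofReal_le_ofReal
      have hx2 : h + d < w x := hx.2
      exact Real.rpow_le_rpow hd.le (le_max_of_le_left (by linarith)) hp0.le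
    rw [ENNReal.ofReal_div_of_pos hdp, ENNReal.le_div_iff_mul_le (by simp [hdp]) (by simp), mul_comm]
    exact key
  have h1 : ∫⁻ x in ball x₀ ρ₂, ENNReal.ofReal (max (w x - (h + d)) 0 ^ p) ≤ ENNReal.ofReal a := by
    refine le_trans (lintegral_mono fun x => ENNReal.ofReal_le_ofReal ?_) h_int
    exact Real.rpow_le_rpow (le_max_right _ _) (max_le_max (by linarith) le_rfl) hp0.le
  have h2 : ∫⁻ x in ball x₀ ρ₂, ENNReal.ofReal (max (w x - (h + d)) 0) ≤
      ENNReal.ofReal (a / d ^ (p - 1)) := by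
    rw [div_eq_inv_mul, ENNReal.ofReal_mul (by positivity)]
    refine le_trans ?_ (mul_le_mul_right h_int _)
    rw [← lintegral_const_mul _ (by fun_prop)]
    refine lintegral_mono fun x => ?_
    simp only
    rw [← ENNReal.ofReal_mul (by positivity)]
    apply ENNReal.ofReal_le_ofReal
    rcases le_or_gt (w x) (h + d) with hx | hx
    · rw [max_eq_right (by linarith)]
      exact mul_nonneg (by positivity) (Real.rpow_nonneg (le_max_right _ _) _)
    · have hu : d ≤ w x - h := by linarith
      rw [max_eq_left (by linarith), max_eq_left (by linarith), inv_mul_eq_div,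
        le_div_iff₀ hdp1]
      have hpow : (w x - h) ^ p = (w x - h) * (w x - h) ^ (p - 1) := by
        rw [mul_comm, ← Real.rpow_add_one (by linarith)]; congr 1; ring
      rw [hpow]
      have : d ^ (p - 1) ≤ (w x - h) ^ (p - 1) := Real.rpow_le_rpow hd.le hu (by linarith)
      exact mul_le_mul (by linarith) this hdp1.le (by linarith)
  refine (hw x₀ ρ₁ ρ₂ (h + d) (a / d ^ p) hball hρ₁ hρ (by linarith) (by positivity) hvol).trans ?_
  have hκ2 : 0 ≤ (2 * ρ₂ / (ρ₂ - ρ₁)) ^ ((n : ℝ) + s * p) * (a / d ^ (p - 1)) := by positivity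
  rw [ENNReal.ofReal_mul (p := C * (a / d ^ p) ^ (s * p / n)) (by positivity),
    ENNReal.ofReal_add (by positivity) (mul_nonneg hκ2 hT),
    ENNReal.ofReal_mul (p := (ρ₂ - ρ₁) ^ (-(s * p))) (by positivity),
    ENNReal.ofReal_mul hκ2, ENNReal.ofReal_mul hκ]
  gcongr

/-- De Giorgi iteration: smallness of the `L ^ p` norm and control of the tail give boundedness. -/
lemma exists_deGiorgi (hn : 1 ≤ n) (hs : 0 < s) (hp : 1 < p) {C A : ℝ} (hC : 0 < C) (hA : 0 < A) :
    ∃ ε : ℝ, 0 < ε ∧ ∀ (Ω : Set (Rn n)) (w : Rn n → ℝ) (x₀ : Rn n) (r k : ℝ), Measurable w →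
      LevelDecay n s p C Ω w → ball x₀ r ⊆ Ω → 0 < r → 0 < k →
      tailMass n s p w x₀ (r / 2) ≤ ENNReal.ofReal (A * k ^ (p - 1)) →
      ∫⁻ x in ball x₀ r, ENNReal.ofReal (max (w x) 0 ^ p) ≤ ENNReal.ofReal (ε * k ^ p * r ^ n) →
      ∀ᵐ x ∂volume.restrict (ball x₀ (r / 2)), w x ≤ k := by
  have hn0 : (0 : ℝ) < n := by exact_mod_cast hn
  have hp0 : 0 < p := by linarith
  set α := s * p / n with hα
  have hα0 : 0 < α := by positivity
  set N := (n : ℝ) + s * p + p with hN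
  have hN0 : 0 < N := by positivity
  set β := p * α + N with hβ
  have hβ0 : 0 < β := by positivity
  set θ := (2 : ℝ) ^ (-(β / α)) with hθ
  have hθ0 : 0 < θ := by positivity
  have hθ1 : θ < 1 := Real.rpow_lt_one_of_one_lt_of_neg (by norm_num) (by
    have := div_pos hβ0 hα0; linarith)
  set M := C * 8 ^ β * (1 + 2 ^ (s * p) * A) with hM
  have hM0 : 0 < M := by positivity
  set ε := (θ / M) ^ (1 / α) with hε
  have hε0 : 0 < ε := by positivity
  have hεα : M * ε ^ α = θ := by
    rw [hε, ← Real.rpow_mul (by positivity), one_div_mul_cancel hα0.ne', Real.rpow_one]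
    field_simp
  refine ⟨ε, hε0, fun Ω w x₀ r k hwm hw hball hr hk hQ hI => ?_⟩
  set T := (r / 2) ^ (-(s * p)) * (A * k ^ (p - 1)) with hT
  have hT0 : 0 ≤ T := by positivity
  have htail : ∀ ρ, r / 2 ≤ ρ → ∫⁻ y in (ball x₀ ρ)ᶜ, ENNReal.ofReal (max (w y) 0 ^ (p - 1) /
      ‖y - x₀‖ ^ ((n : ℝ) + s * p)) ≤ ENNReal.ofReal T := by
    intro ρ hρ
    refine (lintegral_mono_set (compl_subset_compl.2 (ball_subset_ball hρ))).trans ?_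
    rw [tailMass] at hQ
    set I := ∫⁻ y in (ball x₀ (r / 2))ᶜ, ENNReal.ofReal (max (w y) 0 ^ (p - 1) /
      ‖y - x₀‖ ^ ((n : ℝ) + s * p))
    calc I = ENNReal.ofReal ((r / 2) ^ (-(s * p))) * (ENNReal.ofReal ((r / 2) ^ (s * p)) * I) := by
          rw [← mul_assoc, ← ENNReal.ofReal_mul (by positivity), ← Real.rpow_add (by positivity)]
          simp
      _ ≤ _ := by
          rw [hT, ENNReal.ofReal_mul (by positivity)]
          gcongr
  set rr : ℕ → ℝ := fun j => r / 2 * (1 + 1 / 2 ^ j) with hrr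
  set kk : ℕ → ℝ := fun j => k * (1 - 1 / 2 ^ j) with hkk
  have hmain : ∀ j : ℕ, ∫⁻ x in ball x₀ (rr j), ENNReal.ofReal (max (w x - kk j) 0 ^ p) ≤
      ENNReal.ofReal (ε * θ ^ j * k ^ p * r ^ n) := by
    intro j
    induction j with
    | zero =>
      have h1 : rr 0 = r := by simp only [hrr]; norm_num
      have h2 : kk 0 = 0 := by simp [hkk]
      rw [h1, h2]
      simpa using hI
    | succ j ih =>
      set t : ℝ := 2 ^ j with ht
      have ht1 : 1 ≤ t := one_le_pow₀ (by norm_num)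
      have ht0 : 0 < t := by linarith
      have e1 : rr j - rr (j + 1) = r / (4 * t) := by
        simp only [hrr, pow_succ]; rw [← ht]; field_simp; ring
      have e2 : kk (j + 1) = kk j + k / (2 * t) := by
        simp only [hkk, pow_succ]; rw [← ht]; field_simp; ring
      have e3 : rr j ≤ r := by
        have : 1 / t ≤ 1 := by rw [div_le_one ht0]; exact ht1
        simp only [hrr]; rw [← ht]; nlinarith
      have e4 : ∀ i, r / 2 < rr i := fun i => by
        simp only [hrr]
        have : (0 : ℝ) < 1 / 2 ^ i := by positivity
        nlinarith
      have e5 : 0 ≤ kk j := by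
        have : 1 / t ≤ 1 := by rw [div_le_one ht0]; exact ht1
        simp only [hkk]; rw [← ht]; exact mul_nonneg hk.le (by linarith)
      set a := ε * θ ^ j * k ^ p * r ^ n with ha
      have ha0 : 0 < a := by positivity
      have hgap : 0 < r / (4 * t) := by positivity
      have step := hw.step hp hC hwm (x₀ := x₀) (ρ₁ := rr (j + 1)) (ρ₂ := rr j) (h := kk j)
        (d := k / (2 * t)) (a := a) (T := T) ((ball_subset_ball e3).trans hball)
        (by linarith [e4 (j + 1)]) (by linarith) e5 (by positivity) ha0 hT0 ih
        (htail _ (e4 j).le)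
      rw [← e2, e1] at step
      refine step.trans (ENNReal.ofReal_le_ofReal ?_)
      have f1 : 2 * rr j / (r / (4 * t)) ≤ 8 * t := by
        rw [div_le_iff₀ hgap]
        have : 8 * t * (r / (4 * t)) = 2 * r := by field_simp; norm_num
        rw [this]; linarith
      have f1' : 0 ≤ 2 * rr j / (r / (4 * t)) :=
        div_nonneg (by linarith [e4 j]) hgap.le
      have f2 : (a / (k / (2 * t)) ^ p) ^ α =
          (2 * t) ^ (p * α) * ε ^ α * (t ^ β)⁻¹ * r ^ (s * p) := by
        have g1 : a / (k / (2 * t)) ^ p = (2 * t) ^ p * ε * θ ^ j * r ^ n := by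
          rw [Real.div_rpow hk.le (by positivity), ha]
          field_simp
        have g2 : (θ ^ j) ^ α = (t ^ β)⁻¹ := by
          rw [← Real.rpow_natCast, ← Real.rpow_mul hθ0.le, hθ, ← Real.rpow_mul (by norm_num),
            ht, ← Real.rpow_natCast, ← Real.rpow_mul (by norm_num), ← Real.rpow_neg (by norm_num)]
          congr 1
          field_simp
        have g3 : (r ^ n) ^ α = r ^ (s * p) := by
          rw [← Real.rpow_natCast, ← Real.rpow_mul hr.le]
          congr 1
          rw [hα]; field_simp
        rw [g1, Real.mul_rpow (by positivity) (by positivity),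
          Real.mul_rpow (by positivity) (by positivity),
          Real.mul_rpow (by positivity) (by positivity), g2, g3, ← Real.rpow_mul (by positivity)]
      have f3 : (r / (4 * t)) ^ (-(s * p)) = (4 * t) ^ (s * p) * (r ^ (s * p))⁻¹ := by
        rw [Real.div_rpow hr.le (by positivity), Real.rpow_neg hr.le, Real.rpow_neg (by positivity)]
        field_simp
      have f4 : a / (k / (2 * t)) ^ (p - 1) * T =
          (2 * t) ^ (p - 1) * (2 ^ (s * p) * A) * (r ^ (s * p))⁻¹ * a := by
        rw [hT, Real.div_rpow hk.le (by positivity), Real.rpow_neg (by positivity),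
          Real.div_rpow hr.le (by norm_num)]
        field_simp
      have f5 : (4 * t) ^ (s * p) ≤ (8 * t) ^ N := by
        calc (4 * t) ^ (s * p) ≤ (8 * t) ^ (s * p) := by gcongr; norm_num
          _ ≤ _ := Real.rpow_le_rpow_of_exponent_le (by linarith) (by rw [hN]; linarith)
      have f6 : (2 * rr j / (r / (4 * t))) ^ ((n : ℝ) + s * p) * (2 * t) ^ (p - 1) ≤
          (8 * t) ^ N := by
        have hp1 : 0 ≤ p - 1 := by linarith
        calc _ ≤ (8 * t) ^ ((n : ℝ) + s * p) * (8 * t) ^ (p - 1) := by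
              gcongr
              norm_num
          _ = (8 * t) ^ ((n : ℝ) + s * p + (p - 1)) := (Real.rpow_add (by positivity) _ _).symm
          _ ≤ _ := Real.rpow_le_rpow_of_exponent_le (by linarith) (by rw [hN]; linarith)
      have f7 : (2 * t) ^ (p * α) ≤ (8 * t) ^ (p * α) := by gcongr; norm_num
      rw [f2, f3, mul_assoc ((2 * rr j / (r / (4 * t))) ^ ((n : ℝ) + s * p)), f4]
      have hRr : 0 < r ^ (s * p) := by positivity
      calc C * ((2 * t) ^ (p * α) * ε ^ α * (t ^ β)⁻¹ * r ^ (s * p)) *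
            ((4 * t) ^ (s * p) * (r ^ (s * p))⁻¹ * a +
              (2 * rr j / (r / (4 * t))) ^ ((n : ℝ) + s * p) *
                ((2 * t) ^ (p - 1) * (2 ^ (s * p) * A) * (r ^ (s * p))⁻¹ * a))
          = C * (2 * t) ^ (p * α) * ε ^ α * (t ^ β)⁻¹ * a * ((4 * t) ^ (s * p) +
              ((2 * rr j / (r / (4 * t))) ^ ((n : ℝ) + s * p) * (2 * t) ^ (p - 1)) *
                (2 ^ (s * p) * A)) := by field_simp
        _ ≤ C * (8 * t) ^ (p * α) * ε ^ α * (t ^ β)⁻¹ * a * ((8 * t) ^ N +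
              (8 * t) ^ N * (2 ^ (s * p) * A)) := by gcongr
        _ = (C * 8 ^ β * (1 + 2 ^ (s * p) * A) * ε ^ α) * a := by
            have : (8 * t) ^ (p * α) * (8 * t) ^ N = 8 ^ β * t ^ β := by
              rw [← Real.rpow_add (by positivity), ← hβ, Real.mul_rpow (by norm_num) ht0.le]
            have htb : 0 < t ^ β := by positivity
            calc _ = C * ((8 * t) ^ (p * α) * (8 * t) ^ N) * ε ^ α * (t ^ β)⁻¹ * a *
                  (1 + 2 ^ (s * p) * A) := by ring
              _ = _ := by rw [this]; field_simp
        _ = θ * a := by rw [← hM, hεα]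
        _ = _ := by rw [ha, pow_succ]; ring
  have hlim : Tendsto (fun j : ℕ => ENNReal.ofReal (ε * θ ^ j * k ^ p * r ^ n)) atTop (𝓝 0) := by
    have h1 : Tendsto (fun j : ℕ => ε * θ ^ j * k ^ p * r ^ n) atTop (𝓝 0) := by
      have := (((tendsto_pow_atTop_nhds_zero_of_lt_one hθ0.le hθ1).const_mul ε).mul_const
        (k ^ p)).mul_const (r ^ n)
      simpa using this
    have := (ENNReal.continuous_ofReal.tendsto 0).comp h1
    rw [ENNReal.ofReal_zero] at this
    exact this
  have hzero : ∫⁻ x in ball x₀ (r / 2), ENNReal.ofReal (max (w x - k) 0 ^ p) = 0 := by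
    refine le_antisymm (ge_of_tendsto' hlim fun j => ?_) zero_le
    refine le_trans ?_ (hmain j)
    have hj : (0 : ℝ) < 1 / 2 ^ j := by positivity
    refine (lintegral_mono fun x => ENNReal.ofReal_le_ofReal ?_).trans
      (lintegral_mono_set (ball_subset_ball (by simp only [hrr]; nlinarith)))
    refine Real.rpow_le_rpow (le_max_right _ _) (max_le_max ?_ le_rfl) hp0.le
    simp only [hkk]; nlinarith
  rw [lintegral_eq_zero_iff (by fun_prop)] at hzero
  filter_upwards [hzero] with x hx
  by_contra! hcon
  have : 0 < max (w x - k) 0 ^ p := Real.rpow_pos_of_pos (lt_max_of_lt_left (by linarith)) _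
  simp only [Pi.zero_apply, ENNReal.ofReal_eq_zero] at hx
  linarith

end DeGiorgi

section TailComparison

variable {n : ℕ} {s p : ℝ}

lemma exists_kernel_tail_bound (hn : 1 ≤ n) (hs : 0 < s) (hs1 : s < 1) (hp : 1 < p) :
    ∃ J : ℝ, 0 < J ∧ ∀ (x : Rn n) (ρ : ℝ), 0 < ρ → ENNReal.ofReal (ρ ^ (s * p)) *
      ∫⁻ y in (ball x ρ)ᶜ, ENNReal.ofReal (1 / ‖y - x‖ ^ ((n : ℝ) + s * p)) ≤
        ENNReal.ofReal J := by
  obtain ⟨J, hJ, h⟩ := exists_kernel_integral_bound (n := n) hn hs hs1 hp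
  refine ⟨J, hJ, fun x ρ hρ => ?_⟩
  have h1 : ∫⁻ y in (ball x ρ)ᶜ, ENNReal.ofReal (1 / ‖y - x‖ ^ ((n : ℝ) + s * p)) ≤
      ENNReal.ofReal (J * ρ⁻¹ ^ (s * p)) := by
    refine le_trans (le_trans (setLIntegral_mono' measurableSet_ball.compl fun y hy => ?_)
      (setLIntegral_le_lintegral _ _)) (h ρ⁻¹ x (by positivity))
    have hy' : ρ ≤ ‖x - y‖ := by
      simpa [dist_eq_norm, norm_sub_rev] using hy
    have : 1 ≤ ρ⁻¹ * ‖x - y‖ := by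
      rw [inv_mul_eq_div, one_le_div hρ]; exact hy'
    rw [min_eq_left this, Real.one_rpow, norm_sub_rev]
  refine (mul_le_mul_right h1 _).trans ?_
  rw [← ENNReal.ofReal_mul (by positivity), Real.inv_rpow hρ.le]
  apply ENNReal.ofReal_le_ofReal
  have : 0 < ρ ^ (s * p) := by positivity
  field_simp
  exact le_rfl

/-- Recentring and rescaling the tail, given a bound on the half ball. -/
lemma exists_tailMass_comparison (hn : 1 ≤ n) (hs : 0 < s) (hs1 : s < 1) (hp : 1 < p) :
    ∃ J : ℝ, 0 < J ∧ ∀ (w : Rn n → ℝ) (x₀ x : Rn n) (r τ S : ℝ), 0 < r → 0 < τ →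
      τ ≤ 1 → ‖x - x₀‖ ≤ r → 0 ≤ S → (∀ᵐ y ∂volume.restrict (ball x₀ (r / 2)), w y ≤ S) →
      tailMass n s p w x (τ * r / 2) ≤ ENNReal.ofReal (J * S ^ (p - 1)) +
        ENNReal.ofReal (3 ^ ((n : ℝ) + s * p) * τ ^ (-(n : ℝ))) * tailMass n s p w x₀ (r / 2) := by
  obtain ⟨J, hJ, h⟩ := exists_kernel_tail_bound (n := n) hn hs hs1 hp
  refine ⟨J, hJ, fun w x₀ x r τ S hr hτ hτ1 hx hS hw => ?_⟩
  have hp0 : 0 < p := by linarith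
  have hp1 : 0 ≤ p - 1 := by linarith
  set e := (n : ℝ) + s * p with he
  have he0 : 0 < e := by positivity
  set ρ := τ * r / 2 with hρ
  have hρ0 : 0 < ρ := by positivity
  set f : Rn n → ℝ≥0∞ := fun y => ENNReal.ofReal (max (w y) 0 ^ (p - 1) / ‖y - x‖ ^ e) with hf
  have hsplit : ∫⁻ y in (ball x ρ)ᶜ, f y ≤ (∫⁻ y in (ball x ρ)ᶜ ∩ ball x₀ (r / 2), f y) +
      ∫⁻ y in (ball x ρ)ᶜ ∩ (ball x₀ (r / 2))ᶜ, f y := by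
    refine le_trans (lintegral_mono_set ?_) (lintegral_union_le f _ _)
    rw [← inter_union_distrib_left, union_compl_self, inter_univ]
  have hnear : ∫⁻ y in (ball x ρ)ᶜ ∩ ball x₀ (r / 2), f y ≤
      ENNReal.ofReal (S ^ (p - 1)) * ∫⁻ y in (ball x ρ)ᶜ, ENNReal.ofReal (1 / ‖y - x‖ ^ e) := by
    rw [← lintegral_const_mul _ (by fun_prop)]
    refine le_trans (lintegral_mono_ae ?_) (lintegral_mono_set inter_subset_left)
    filter_upwards [ae_restrict_of_ae_restrict_of_subset inter_subset_right hw] with y hy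
    rw [hf, ← ENNReal.ofReal_mul (by positivity)]
    apply ENNReal.ofReal_le_ofReal
    rw [mul_one_div]
    have : max (w y) 0 ≤ S := max_le hy hS
    have h0 : 0 ≤ max (w y) 0 := le_max_right _ _
    gcongr
  have hfar : ∫⁻ y in (ball x ρ)ᶜ ∩ (ball x₀ (r / 2))ᶜ, f y ≤ ENNReal.ofReal ((3 / τ) ^ e) *
      ∫⁻ y in (ball x₀ (r / 2))ᶜ, ENNReal.ofReal (max (w y) 0 ^ (p - 1) / ‖y - x₀‖ ^ e) := by
    rw [← lintegral_const_mul' _ _ ENNReal.ofReal_ne_top]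
    refine le_trans (setLIntegral_mono' (measurableSet_ball.compl.inter measurableSet_ball.compl)
      fun y hy => ?_) (lintegral_mono_set inter_subset_right)
    have hy1 : ρ ≤ ‖y - x‖ := by simpa [dist_eq_norm] using hy.1
    have hy2 : r / 2 ≤ ‖y - x₀‖ := by simpa [dist_eq_norm] using hy.2
    rw [hf, ← ENNReal.ofReal_mul (by positivity)]
    apply ENNReal.ofReal_le_ofReal
    have h0 : 0 ≤ max (w y) 0 := le_max_right _ _
    have hyx : 0 < ‖y - x‖ := by linarith
    have hyx₀ : 0 < ‖y - x₀‖ := by linarith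
    have h3 : ‖y - x₀‖ ≤ 3 / τ * ‖y - x‖ := by
      have t1 : ‖y - x₀‖ ≤ ‖y - x‖ + ‖x - x₀‖ := by
        simpa using norm_add_le (y - x) (x - x₀)
      have t2 : r ≤ 2 / τ * ‖y - x‖ := by
        calc r = 2 / τ * ρ := by rw [hρ]; field_simp
          _ ≤ _ := by gcongr
      have t3 : ‖y - x‖ ≤ 1 / τ * ‖y - x‖ :=
        le_mul_of_one_le_left hyx.le ((one_le_div hτ).2 hτ1)
      calc ‖y - x₀‖ ≤ 1 / τ * ‖y - x‖ + 2 / τ * ‖y - x‖ := by linarith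
        _ = _ := by ring
    have h4 : ‖y - x₀‖ ^ e ≤ (3 / τ) ^ e * ‖y - x‖ ^ e := by
      rw [← Real.mul_rpow (by positivity) (by positivity)]
      gcongr
    rw [← mul_div_assoc, div_le_div_iff₀ (by positivity) (by positivity)]
    calc max (w y) 0 ^ (p - 1) * ‖y - x₀‖ ^ e
        ≤ max (w y) 0 ^ (p - 1) * ((3 / τ) ^ e * ‖y - x‖ ^ e) := by gcongr
      _ = _ := by ring
  have hmass : tailMass n s p w x ρ = ENNReal.ofReal (ρ ^ (s * p)) * ∫⁻ y in (ball x ρ)ᶜ, f y := rfl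
  rw [hmass]
  refine (mul_le_mul_right (hsplit.trans (add_le_add hnear hfar)) _).trans ?_
  rw [mul_add]
  refine add_le_add ?_ (le_of_eq ?_)
  · rw [mul_left_comm, mul_comm J, ENNReal.ofReal_mul (by positivity)]
    gcongr
    exact h x ρ hρ0
  · rw [tailMass, ← mul_assoc, ← mul_assoc, ← ENNReal.ofReal_mul (by positivity),
      ← ENNReal.ofReal_mul (by positivity)]
    congr 2
    rw [hρ, mul_div_assoc, Real.mul_rpow hτ.le (by positivity), Real.div_rpow (by norm_num) hτ.le,
      Real.rpow_neg hτ.le, he, Real.rpow_add hτ]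
    have : 0 < τ ^ (s * p) := by positivity
    field_simp

lemma ae_restrict_of_forall_ball {P : Rn n → Prop} {S : Set (Rn n)} {δ : ℝ} (hδ : 0 < δ)
    (h : ∀ x ∈ S, ∀ᵐ y ∂volume.restrict (ball x δ), P y) (hS : MeasurableSet S) :
    ∀ᵐ y ∂volume.restrict S, P y := by
  rw [ae_restrict_iff' hS]
  have : volume {y | y ∈ S ∧ ¬ P y} = 0 := by
    refine measure_null_of_locally_null _ fun x hx => ?_
    refine ⟨ball x δ ∩ {y | y ∈ S ∧ ¬ P y}, ?_, ?_⟩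
    · exact inter_mem (mem_nhdsWithin_of_mem_nhds (ball_mem_nhds x hδ)) self_mem_nhdsWithin
    · have h1 := (ae_restrict_iff' measurableSet_ball).1 (h x hx.1)
      refine measure_mono_null (fun y hy => ?_) h1
      simp only [mem_compl_iff, mem_ofPred_eq, not_forall]
      exact ⟨hy.1, hy.2.2⟩
  filter_upwards [compl_mem_ae_iff.2 this] with y hy hyS
  by_contra hP
  exact hy ⟨hyS, hP⟩

end TailComparison

section LocalBoundedness

variable {n : ℕ} {s p : ℝ}

/-- One interpolation step: an a priori bound on a ball improves on a smaller ball. -/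
lemma exists_interpolation_step (hn : 1 ≤ n) (hs : 0 < s) (hs1 : s < 1) (hp : 1 < p) {C θ : ℝ}
    (hC : 0 < C) (hθ : 0 < θ) :
    ∃ B : ℝ, 0 < B ∧ ∀ (Ω : Set (Rn n)) (w : Rn n → ℝ) (x₀ : Rn n) (r t t' X M : ℝ),
      Measurable w → LevelDecay n s p C Ω w → ball x₀ r ⊆ Ω → 0 < r → 0 < X → 0 ≤ M →
      ∫⁻ x in ball x₀ r, ENNReal.ofReal (max (w x) 0) ≤ ENNReal.ofReal (X * r ^ n) →
      tailMass n s p w x₀ (r / 2) ≤ ENNReal.ofReal (X ^ (p - 1)) →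
      1 / 2 ≤ t → t < t' → t' ≤ 1 →
      (∀ᵐ x ∂volume.restrict (ball x₀ (t' * r)), w x ≤ M) →
      ∀ᵐ x ∂volume.restrict (ball x₀ (t * r)),
        w x ≤ θ * M + B * (t' - t) ^ (-((n : ℝ) * p / (p - 1))) * X := by
  obtain ⟨J, hJ, hcomp⟩ := exists_tailMass_comparison (n := n) hn hs hs1 hp
  have hp0 : 0 < p := by linarith
  have hp1 : 0 < p - 1 := by linarith
  have hn0 : (0 : ℝ) < n := by exact_mod_cast hn
  set e := (n : ℝ) + s * p with he
  set N := (n : ℝ) * p / (p - 1) with hN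
  have hNn : (n : ℝ) ≤ N := by
    rw [hN, le_div_iff₀ hp1]; nlinarith
  have hNp : N * (p - 1) = n * p := by rw [hN]; field_simp
  obtain ⟨ε, hε, hDG⟩ := exists_deGiorgi (n := n) hn hs hp hC
    (A := J * θ ^ (-(p - 1)) + 1) (by positivity)
  set B := (3 ^ e) ^ (1 / (p - 1)) + 1 / (ε * θ ^ (p - 1)) with hB
  have hB0 : 0 < B := by positivity
  refine ⟨B, hB0, fun Ω w x₀ r t t' X M hwm hw hball hr hX hM hI hQ ht htt ht' hbd => ?_⟩
  set τ := t' - t with hτ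
  have hτ0 : 0 < τ := by linarith
  have hτ1 : τ ≤ 1 := by linarith
  set k := θ * M + B * τ ^ (-N) * X with hk
  have hk0 : 0 < k := by positivity
  refine ae_restrict_of_forall_ball (δ := τ * r / 2) (by positivity) (fun x hx => ?_)
    measurableSet_ball
  have hxx : ‖x - x₀‖ < t * r := by simpa [dist_eq_norm] using hx
  have hsub : ball x (τ * r) ⊆ ball x₀ (t' * r) := by
    refine ball_subset_ball' ?_
    rw [dist_eq_norm, hτ]; linarith
  have hsub' : ball x (τ * r) ⊆ ball x₀ r :=
    hsub.trans (ball_subset_ball (by nlinarith))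
  refine hDG Ω w x (τ * r) k hwm hw (hsub'.trans hball) (by positivity) hk0 ?_ ?_
  · refine (hcomp w x₀ x r τ M hr hτ0 hτ1 (by nlinarith) hM
      (ae_restrict_of_ae_restrict_of_subset (ball_subset_ball (by nlinarith)) hbd)).trans ?_
    refine (add_le_add le_rfl (mul_le_mul_right hQ _)).trans ?_
    rw [← ENNReal.ofReal_mul (by positivity), ← ENNReal.ofReal_add (by positivity) (by positivity)]
    apply ENNReal.ofReal_le_ofReal
    have h1 : M ^ (p - 1) ≤ θ ^ (-(p - 1)) * k ^ (p - 1) := by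
      have : (θ * M) ^ (p - 1) ≤ k ^ (p - 1) := by
        have : 0 ≤ B * τ ^ (-N) * X := by positivity
        gcongr
        linarith
      rw [Real.mul_rpow hθ.le hM] at this
      rw [Real.rpow_neg hθ.le]
      rwa [inv_mul_eq_div, le_div_iff₀ (by positivity), mul_comm]
    have h2 : 3 ^ e * τ ^ (-(n : ℝ)) * X ^ (p - 1) ≤ k ^ (p - 1) := by
      calc 3 ^ e * τ ^ (-(n : ℝ)) * X ^ (p - 1)
          ≤ 3 ^ e * τ ^ (-N * (p - 1)) * X ^ (p - 1) := by
            have : τ ^ (-(n : ℝ)) ≤ τ ^ (-N * (p - 1)) := by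
              apply Real.rpow_le_rpow_of_exponent_ge hτ0 hτ1
              rw [neg_mul, hNp]; nlinarith
            gcongr
        _ = ((3 ^ e) ^ (1 / (p - 1)) * τ ^ (-N) * X) ^ (p - 1) := by
            rw [Real.mul_rpow (by positivity) hX.le, Real.mul_rpow (by positivity) (by positivity),
              ← Real.rpow_mul (by positivity), one_div_mul_cancel hp1.ne', Real.rpow_one,
              ← Real.rpow_mul hτ0.le]
        _ ≤ k ^ (p - 1) := by
            have hB1 : (3 ^ e) ^ (1 / (p - 1)) ≤ B := by
              have : 0 < 1 / (ε * θ ^ (p - 1)) := by positivity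
              linarith
            have hM' : 0 ≤ θ * M := by positivity
            refine Real.rpow_le_rpow (by positivity) ?_ hp1.le
            calc _ ≤ B * τ ^ (-N) * X := by gcongr
              _ ≤ _ := by linarith
    calc _ ≤ J * (θ ^ (-(p - 1)) * k ^ (p - 1)) + k ^ (p - 1) := by gcongr
      _ = _ := by ring
  · have h1 : ∫⁻ y in ball x (τ * r), ENNReal.ofReal (max (w y) 0 ^ p) ≤
        ENNReal.ofReal (M ^ (p - 1)) * ∫⁻ y in ball x₀ r, ENNReal.ofReal (max (w y) 0) := by
      rw [← lintegral_const_mul' _ _ ENNReal.ofReal_ne_top]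
      refine le_trans (lintegral_mono_ae ?_) (lintegral_mono_set hsub')
      filter_upwards [ae_restrict_of_ae_restrict_of_subset hsub hbd] with y hy
      rw [← ENNReal.ofReal_mul (by positivity)]
      apply ENNReal.ofReal_le_ofReal
      have h0 : 0 ≤ max (w y) 0 := le_max_right _ _
      have : max (w y) 0 ^ p = max (w y) 0 ^ (p - 1) * max (w y) 0 := by
        rw [← Real.rpow_add_one' h0 (by linarith)]; congr 1; ring
      rw [this]
      have hyM : max (w y) 0 ≤ M := max_le hy hM
      gcongr
    refine h1.trans ((mul_le_mul_right hI _).trans ?_)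
    rw [← ENNReal.ofReal_mul (by positivity)]
    apply ENNReal.ofReal_le_ofReal
    have hkp : k ^ p = k ^ (p - 1) * k := by
      rw [← Real.rpow_add_one hk0.ne']; congr 1; ring
    have h2 : θ ^ (p - 1) * M ^ (p - 1) ≤ k ^ (p - 1) := by
      rw [← Real.mul_rpow hθ.le hM]
      have : 0 ≤ B * τ ^ (-N) * X := by positivity
      gcongr
      linarith
    have h3 : 1 / (ε * θ ^ (p - 1)) * τ ^ (-(n : ℝ)) * X ≤ k := by
      have hB1 : 1 / (ε * θ ^ (p - 1)) ≤ B := by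
        have : 0 < ((3 : ℝ) ^ e) ^ (1 / (p - 1)) := by positivity
        linarith
      have h4 : τ ^ (-(n : ℝ)) ≤ τ ^ (-N) :=
        Real.rpow_le_rpow_of_exponent_ge hτ0 hτ1 (by linarith)
      have hM' : 0 ≤ θ * M := by positivity
      calc _ ≤ B * τ ^ (-N) * X := by gcongr
        _ ≤ _ := by linarith
    have h5 : τ ^ (-(n : ℝ)) * τ ^ n = 1 := by
      rw [Real.rpow_neg hτ0.le, Real.rpow_natCast, inv_mul_cancel₀ (by positivity)]
    calc M ^ (p - 1) * (X * r ^ n)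
        = ε * ((θ ^ (p - 1) * M ^ (p - 1)) * (1 / (ε * θ ^ (p - 1)) * τ ^ (-(n : ℝ)) * X)) *
            (τ * r) ^ n := by
          rw [mul_pow]
          have hθp : 0 < θ ^ (p - 1) := by positivity
          calc M ^ (p - 1) * (X * r ^ n)
              = M ^ (p - 1) * (X * r ^ n) * (τ ^ (-(n : ℝ)) * τ ^ n) := by rw [h5, mul_one]
            _ = _ := by field_simp
      _ ≤ ε * (k ^ (p - 1) * k) * (τ * r) ^ n := by gcongr
      _ = _ := by rw [hkp]

/-- Qualitative local boundedness. -/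
lemma exists_ae_le_of_levelDecay (hn : 1 ≤ n) (hs : 0 < s) (hs1 : s < 1) (hp : 1 < p) {C : ℝ}
    (hC : 0 < C) {Ω : Set (Rn n)} {w : Rn n → ℝ} {x₀ : Rn n} {r : ℝ} (hwm : Measurable w)
    (hw : LevelDecay n s p C Ω w) (hwp : ∫⁻ x, ENNReal.ofReal (|w x| ^ p) < ⊤)
    (hball : ball x₀ r ⊆ Ω) (hr : 0 < r) :
    ∃ M : ℝ, 0 ≤ M ∧ ∀ᵐ x ∂volume.restrict (ball x₀ (3 / 4 * r)), w x ≤ M := by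
  obtain ⟨J, hJ, hker⟩ := exists_kernel_tail_bound (n := n) hn hs hs1 hp
  have hp0 : 0 < p := by linarith
  have hp1 : 0 < p - 1 := by linarith
  obtain ⟨ε, hε, hDG⟩ := exists_deGiorgi (n := n) hn hs hp hC (A := 1) one_pos
  set I := (∫⁻ x, ENNReal.ofReal (|w x| ^ p)).toReal with hI
  have hI' : ∫⁻ x, ENNReal.ofReal (|w x| ^ p) = ENNReal.ofReal I :=
    (ENNReal.ofReal_toReal hwp.ne).symm
  have hI0 : 0 ≤ I := ENNReal.toReal_nonneg
  set e := (n : ℝ) + s * p with he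
  have he0 : 0 < e := by positivity
  set ρ := r / 4 / 2 with hρ
  have hρ0 : 0 < ρ := by positivity
  have hmax : ∀ y, max (w y) 0 ≤ |w y| := fun y => max_le (le_abs_self _) (abs_nonneg _)
  have hQ : ∀ x, tailMass n s p w x ρ ≤ ENNReal.ofReal (J + ρ ^ (s * p) * (1 / ρ ^ e * I)) := by
    intro x
    have h1 : ∫⁻ y in (ball x ρ)ᶜ, ENNReal.ofReal (max (w y) 0 ^ (p - 1) / ‖y - x‖ ^ e) ≤
        (∫⁻ y in (ball x ρ)ᶜ, ENNReal.ofReal (1 / ‖y - x‖ ^ e)) +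
          ENNReal.ofReal (1 / ρ ^ e * I) := by
      rw [ENNReal.ofReal_mul (by positivity), ← hI', ← lintegral_const_mul' _ _ ENNReal.ofReal_ne_top]
      refine le_trans ?_ (add_le_add le_rfl (setLIntegral_le_lintegral (ball x ρ)ᶜ _))
      rw [← lintegral_add_left (by fun_prop)]
      refine setLIntegral_mono' measurableSet_ball.compl fun y hy => ?_
      have hy1 : ρ ≤ ‖y - x‖ := by simpa [dist_eq_norm] using hy
      rw [← ENNReal.ofReal_mul (by positivity),
        ← ENNReal.ofReal_add (by positivity) (by positivity)]
      apply ENNReal.ofReal_le_ofReal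
      have h0 : 0 ≤ max (w y) 0 := le_max_right _ _
      have h2 : max (w y) 0 ^ (p - 1) ≤ 1 + |w y| ^ p := by
        rcases le_or_gt (max (w y) 0) 1 with h | h
        · have : max (w y) 0 ^ (p - 1) ≤ 1 := Real.rpow_le_one h0 h hp1.le
          have : 0 ≤ |w y| ^ p := by positivity
          linarith
        · have h3 : max (w y) 0 ^ (p - 1) ≤ max (w y) 0 ^ p :=
            Real.rpow_le_rpow_of_exponent_le h.le (by linarith)
          have h4 : max (w y) 0 ^ p ≤ |w y| ^ p := Real.rpow_le_rpow h0 (hmax y) hp0.le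
          linarith
      have hyx : 0 < ‖y - x‖ := by linarith
      calc max (w y) 0 ^ (p - 1) / ‖y - x‖ ^ e ≤ (1 + |w y| ^ p) / ‖y - x‖ ^ e := by gcongr
        _ = 1 / ‖y - x‖ ^ e + 1 / ‖y - x‖ ^ e * |w y| ^ p := by ring
        _ ≤ 1 / ‖y - x‖ ^ e + 1 / ρ ^ e * |w y| ^ p := by gcongr
    rw [tailMass]
    refine (mul_le_mul_right h1 _).trans ?_
    rw [mul_add, ENNReal.ofReal_add hJ.le (by positivity),
      ENNReal.ofReal_mul (p := ρ ^ (s * p)) (by positivity)]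
    gcongr
    exact hker x ρ hρ0
  set Q := J + ρ ^ (s * p) * (1 / ρ ^ e * I) with hQdef
  have hQ0 : 0 < Q := by positivity
  set k := Q ^ (1 / (p - 1)) + (I / (ε * (r / 4) ^ n)) ^ (1 / p) with hk
  have hk0 : 0 < k := by positivity
  refine ⟨k, hk0.le, ae_restrict_of_forall_ball (δ := ρ) hρ0 (fun x hx => ?_) measurableSet_ball⟩
  have hxx : ‖x - x₀‖ < 3 / 4 * r := by simpa [dist_eq_norm] using hx
  refine hDG Ω w x (r / 4) k hwm hw ((ball_subset_ball' ?_).trans hball) (by positivity) hk0 ?_ ?_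
  · rw [dist_eq_norm]; linarith
  · refine (hQ x).trans (ENNReal.ofReal_le_ofReal ?_)
    rw [one_mul]
    calc Q = (Q ^ (1 / (p - 1))) ^ (p - 1) := by
          rw [← Real.rpow_mul hQ0.le, one_div_mul_cancel hp1.ne', Real.rpow_one]
      _ ≤ _ := by
          gcongr
          have : 0 ≤ (I / (ε * (r / 4) ^ n)) ^ (1 / p) := by positivity
          linarith
  · have h1 : ∫⁻ y in ball x (r / 4), ENNReal.ofReal (max (w y) 0 ^ p) ≤ ENNReal.ofReal I := by
      rw [← hI']
      refine le_trans (setLIntegral_le_lintegral _ _) (lintegral_mono fun y => ?_)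
      apply ENNReal.ofReal_le_ofReal
      exact Real.rpow_le_rpow (le_max_right _ _) (hmax y) hp0.le
    refine h1.trans (ENNReal.ofReal_le_ofReal ?_)
    have h2 : I / (ε * (r / 4) ^ n) ≤ k ^ p := by
      have h0 : 0 ≤ I / (ε * (r / 4) ^ n) := by positivity
      calc I / (ε * (r / 4) ^ n) = ((I / (ε * (r / 4) ^ n)) ^ (1 / p)) ^ p := by
            rw [← Real.rpow_mul h0, one_div_mul_cancel hp0.ne', Real.rpow_one]
        _ ≤ _ := by
            gcongr
            have : 0 < Q ^ (1 / (p - 1)) := by positivity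
            linarith
    rw [div_le_iff₀ (by positivity)] at h2
    linarith

/-- The `L ^ 1`-to-`L ^ ∞` estimate on the half ball. -/
lemma exists_half_ball_bound (hn : 1 ≤ n) (hs : 0 < s) (hs1 : s < 1) (hp : 1 < p) {C : ℝ}
    (hC : 0 < C) :
    ∃ D : ℝ, 0 < D ∧ ∀ (Ω : Set (Rn n)) (w : Rn n → ℝ) (x₀ : Rn n) (r X : ℝ),
      Measurable w → LevelDecay n s p C Ω w → ∫⁻ x, ENNReal.ofReal (|w x| ^ p) < ⊤ →
      ball x₀ r ⊆ Ω → 0 < r → 0 < X →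
      ∫⁻ x in ball x₀ r, ENNReal.ofReal (max (w x) 0) ≤ ENNReal.ofReal (X * r ^ n) →
      tailMass n s p w x₀ (r / 2) ≤ ENNReal.ofReal (X ^ (p - 1)) →
      ∀ᵐ x ∂volume.restrict (ball x₀ (r / 2)), w x ≤ D * X := by
  have hp1 : 0 < p - 1 := by linarith
  set N := (n : ℝ) * p / (p - 1) with hN
  have hN0 : 0 ≤ N := by positivity
  set θ : ℝ := (2 * 2 ^ N)⁻¹ with hθ
  have hθ0 : 0 < θ := by positivity
  have h2N : (1 : ℝ) ≤ 2 ^ N := Real.one_le_rpow (by norm_num) hN0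
  have hθ1 : θ < 1 := inv_lt_one_of_one_lt₀ (by linarith)
  obtain ⟨B, hB, hstep⟩ := exists_interpolation_step (n := n) hn hs hs1 hp hC hθ0
  refine ⟨2 * (B * 8 ^ N), by positivity, fun Ω w x₀ r X hwm hw hwp hball hr hX hI hQ => ?_⟩
  obtain ⟨M, hM, hbd⟩ := exists_ae_le_of_levelDecay hn hs hs1 hp hC hwm hw hwp hball hr
  set t : ℕ → ℝ := fun i => 3 / 4 - 1 / 2 ^ i / 4 with ht
  have hiter : ∀ k i : ℕ, ∀ᵐ x ∂volume.restrict (ball x₀ (t i * r)),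
      w x ≤ θ ^ k * M + 2 * (B * 8 ^ N) * (2 ^ i) ^ N * X := by
    intro k
    induction k with
    | zero =>
      intro i
      have hi : (0 : ℝ) < 1 / 2 ^ i := by positivity
      have : t i * r ≤ 3 / 4 * r := by
        simp only [ht]; nlinarith
      filter_upwards [ae_restrict_of_ae_restrict_of_subset (ball_subset_ball this) hbd] with x hx
      have : 0 < 2 * (B * 8 ^ N) * (2 ^ i) ^ N * X := by positivity
      rw [pow_zero, one_mul]; linarith
    | succ k ih =>
      intro i
      have hi : (0 : ℝ) < 1 / 2 ^ i := by positivity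
      have hi1 : 1 / (2 : ℝ) ^ i ≤ 1 := by
        rw [div_le_one (by positivity)]; exact one_le_pow₀ (by norm_num)
      have e1 : t (i + 1) - t i = (8 * 2 ^ i)⁻¹ := by
        simp only [ht, pow_succ]; field_simp; ring
      have e2 : 0 < (8 * (2 : ℝ) ^ i)⁻¹ := by positivity
      have e3 : t (i + 1) ≤ 1 := by
        have : (0 : ℝ) < 1 / 2 ^ (i + 1) := by positivity
        simp only [ht]; linarith
      have := hstep Ω w x₀ r (t i) (t (i + 1)) X _ hwm hw hball hr hX (by positivity) hI hQ
        (by simp only [ht]; linarith) (by linarith) e3 (ih (i + 1))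
      rw [e1] at this
      filter_upwards [this] with x hx
      refine hx.trans (le_of_eq ?_)
      rw [Real.inv_rpow (by positivity), Real.rpow_neg (by positivity), inv_inv,
        Real.mul_rpow (by norm_num) (by positivity), pow_succ 2 i,
        Real.mul_rpow (by positivity) (by norm_num), pow_succ θ k]
      have hθ2 : θ * (2 * 2 ^ N) = 1 := inv_mul_cancel₀ (by positivity)
      linear_combination (B * 8 ^ N * (2 ^ i) ^ N * X) * hθ2
  have h0 : t 0 * r = r / 2 := by simp only [ht]; norm_num; ring
  have hall : ∀ᵐ x ∂volume.restrict (ball x₀ (r / 2)), ∀ k : ℕ,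
      w x ≤ θ ^ k * M + 2 * (B * 8 ^ N) * X := by
    rw [ae_all_iff]
    intro k
    have := hiter k 0
    rw [h0] at this
    simpa using this
  filter_upwards [hall] with x hx
  have hlim : Tendsto (fun k : ℕ => θ ^ k * M + 2 * (B * 8 ^ N) * X) atTop
      (𝓝 (0 * M + 2 * (B * 8 ^ N) * X)) :=
    ((tendsto_pow_atTop_nhds_zero_of_lt_one hθ0.le hθ1).mul_const M).add_const _
  rw [zero_mul, zero_add] at hlim
  exact ge_of_tendsto' hlim hx

/-- The `L ^ 1`-to-`L ^ ∞` estimate on a concentric ball of any smaller radius. -/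
lemma exists_ball_bound (hn : 1 ≤ n) (hs : 0 < s) (hs1 : s < 1) (hp : 1 < p) {C : ℝ}
    (hC : 0 < C) :
    ∃ D : ℝ, 0 < D ∧ ∀ (Ω : Set (Rn n)) (w : Rn n → ℝ) (x₀ : Rn n) (r X σ : ℝ),
      Measurable w → LevelDecay n s p C Ω w → ∫⁻ x, ENNReal.ofReal (|w x| ^ p) < ⊤ →
      ball x₀ r ⊆ Ω → 0 < r → 0 < X → 0 < σ → σ < 1 →
      ∫⁻ x in ball x₀ r, ENNReal.ofReal (max (w x) 0) ≤ ENNReal.ofReal (X * r ^ n) →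
      tailMass n s p w x₀ (r / 2) ≤ ENNReal.ofReal (X ^ (p - 1)) →
      ∀ᵐ x ∂volume.restrict (ball x₀ (σ * r)),
        w x ≤ D / (1 - σ) ^ ((n : ℝ) * p / (p - 1)) * X := by
  obtain ⟨J, hJ, hcomp⟩ := exists_tailMass_comparison (n := n) hn hs hs1 hp
  obtain ⟨D, hD, hhalf⟩ := exists_half_ball_bound (n := n) hn hs hs1 hp hC
  have hp0 : 0 < p := by linarith
  have hp1 : 0 < p - 1 := by linarith
  have hn0 : (0 : ℝ) < n := by exact_mod_cast hn
  set e := (n : ℝ) + s * p with he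
  set N := (n : ℝ) * p / (p - 1) with hN
  have hNn : (n : ℝ) ≤ N := by
    rw [hN, le_div_iff₀ hp1]; nlinarith
  have hNp : N * (p - 1) = n * p := by rw [hN]; field_simp
  set G := J * D ^ (p - 1) + 3 ^ e + 1 with hG
  have hG0 : 0 < G := by positivity
  have hG1 : 1 ≤ G := by
    have : 0 < J * D ^ (p - 1) + 3 ^ e := by positivity
    linarith
  set E := G ^ (1 / (p - 1)) with hE
  have hE0 : 0 < E := by positivity
  have hE1 : 1 ≤ E := Real.one_le_rpow hG1 (by positivity)
  have hEG : E ^ (p - 1) = G := by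
    rw [hE, ← Real.rpow_mul hG0.le, one_div_mul_cancel hp1.ne', Real.rpow_one]
  refine ⟨D * E, by positivity, fun Ω w x₀ r X σ hwm hw hwp hball hr hX hσ hσ1 hI hQ => ?_⟩
  have hhb := hhalf Ω w x₀ r X hwm hw hwp hball hr hX hI hQ
  set τ := 1 - σ with hτ
  have hτ0 : 0 < τ := by linarith
  have hτ1 : τ ≤ 1 := by linarith
  have hgoal : D * E / τ ^ N * X = D * (E * τ ^ (-N) * X) := by
    rw [Real.rpow_neg hτ0.le]; ring
  rw [hgoal]
  refine ae_restrict_of_forall_ball (δ := τ * r / 2) (by positivity) (fun x hx => ?_)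
    measurableSet_ball
  have hxx : ‖x - x₀‖ < σ * r := by simpa [dist_eq_norm] using hx
  have hsub : ball x (τ * r) ⊆ ball x₀ r := by
    refine ball_subset_ball' ?_
    rw [dist_eq_norm, hτ]; linarith
  have hτn : 1 ≤ τ ^ (-(n : ℝ)) := Real.one_le_rpow_of_pos_of_le_one_of_nonpos hτ0 hτ1 (by linarith)
  refine hhalf Ω w x (τ * r) (E * τ ^ (-N) * X) hwm hw hwp (hsub.trans hball) (by positivity)
    (by positivity) ?_ ?_
  · refine (lintegral_mono_set hsub).trans (hI.trans (ENNReal.ofReal_le_ofReal ?_))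
    have h4 : τ ^ (-(n : ℝ)) ≤ τ ^ (-N) :=
      Real.rpow_le_rpow_of_exponent_ge hτ0 hτ1 (by linarith)
    have h5 : τ ^ (-(n : ℝ)) * τ ^ n = 1 := by
      rw [Real.rpow_neg hτ0.le, Real.rpow_natCast, inv_mul_cancel₀ (by positivity)]
    calc X * r ^ n = 1 * (τ ^ (-(n : ℝ)) * τ ^ n) * X * r ^ n := by rw [h5]; ring
      _ ≤ E * (τ ^ (-N) * τ ^ n) * X * r ^ n := by gcongr
      _ = _ := by rw [mul_pow]; ring
  · refine (hcomp w x₀ x r τ (D * X) hr hτ0 hτ1 (by nlinarith) (by positivity) hhb).trans ?_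
    refine (add_le_add le_rfl (mul_le_mul_right hQ _)).trans ?_
    rw [← ENNReal.ofReal_mul (by positivity), ← ENNReal.ofReal_add (by positivity) (by positivity)]
    apply ENNReal.ofReal_le_ofReal
    have h6 : τ ^ (-(n : ℝ)) ≤ τ ^ (-N * (p - 1)) := by
      apply Real.rpow_le_rpow_of_exponent_ge hτ0 hτ1
      rw [neg_mul, hNp]; nlinarith
    rw [Real.mul_rpow (by positivity) hX.le, Real.mul_rpow (by positivity) hX.le,
      Real.mul_rpow (by positivity) (by positivity), hEG, ← Real.rpow_mul hτ0.le]
    calc J * (D ^ (p - 1) * X ^ (p - 1)) + 3 ^ e * τ ^ (-(n : ℝ)) * X ^ (p - 1)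
        ≤ J * (D ^ (p - 1) * X ^ (p - 1)) * τ ^ (-(n : ℝ)) +
            3 ^ e * τ ^ (-(n : ℝ)) * X ^ (p - 1) := by
          exact add_le_add (le_mul_of_one_le_right (by positivity) hτn) le_rfl
      _ = (J * D ^ (p - 1) + 3 ^ e) * τ ^ (-(n : ℝ)) * X ^ (p - 1) := by ring
      _ ≤ G * τ ^ (-N * (p - 1)) * X ^ (p - 1) := by
          gcongr
          linarith

end LocalBoundedness

section Congruence

variable {n : ℕ} {s p : ℝ}

lemma memWsp_univ_congr {v v' : Rn n → ℝ} (h : v =ᵐ[volume] v') (hv : memWsp n s p univ v) :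
    memWsp n s p univ v' := by
  obtain ⟨h1, h2, h3⟩ := hv
  have h' : v =ᵐ[volume.restrict univ] v' := by rwa [Measure.restrict_univ]
  refine ⟨h1.congr h', lt_of_le_of_lt (le_of_eq ?_) h2, lt_of_le_of_lt (le_of_eq ?_) h3⟩
  · exact lintegral_congr_ae (h'.mono fun x hx => by simp only [hx])
  · refine lintegral_congr_ae (h'.mono fun x hx => ?_)
    exact lintegral_congr_ae (h'.mono fun y hy => by simp only [hx, hy])

lemma WeakSubSol.congr_ae {Φ : ℝ → ℝ} {K : Rn n → Rn n → ℝ} {Ω : Set (Rn n)} {w w' : Rn n → ℝ}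
    (h : w =ᵐ[volume] w') (hw : WeakSubSol n Φ K s p Ω w) : WeakSubSol n Φ K s p Ω w' := by
  refine ⟨memWsp_univ_congr h hw.1, fun φ hφ hφ0 => le_of_eq_of_le ?_ (hw.2 φ hφ hφ0)⟩
  refine integral_congr_ae (h.mono fun x hx => ?_)
  exact integral_congr_ae (h.mono fun y hy => by simp only [hx, hy])

lemma tailFn_posPart_eq (w : Rn n → ℝ) (x₀ : Rn n) (r : ℝ) :
    tailFn n s p (fun x => max (w x) 0) x₀ r = tailMass n s p w x₀ r ^ (1 / (p - 1)) := by
  have : ∀ x, |max (w x) 0| = max (w x) 0 := fun x => abs_of_nonneg (le_max_right _ _)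
  simp only [tailFn, tailMass, this]

lemma tailMass_congr_ae {w w' : Rn n → ℝ} (h : w =ᵐ[volume] w') (x₀ : Rn n) (r : ℝ) :
    tailMass n s p w x₀ r = tailMass n s p w' x₀ r := by
  rw [tailMass, tailMass]
  congr 1
  exact lintegral_congr_ae ((ae_restrict_of_ae h).mono fun x hx => by simp only [hx])

lemma integrableOn_posPart_of_lintegral_lt_top (hp : 1 < p) {w : Rn n → ℝ} (hwm : Measurable w)
    (hwp : ∫⁻ x, ENNReal.ofReal (|w x| ^ p) < ⊤) (x₀ : Rn n) (r : ℝ) :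
    IntegrableOn (fun x => max (w x) 0) (ball x₀ r) := by
  have hmem : MemLp w (ENNReal.ofReal p) volume :=
    memLp_of_lintegral_rpow (by linarith) hwm.aestronglyMeasurable hwp
  have h1 : MemLp w 1 (volume.restrict (ball x₀ r)) := by
    have : IsFiniteMeasure (volume.restrict (ball x₀ r)) := ⟨by simpa using measure_ball_lt_top⟩
    exact (hmem.restrict (ball x₀ r)).mono_exponent (ENNReal.one_le_ofReal.2 hp.le)
  exact (memLp_one_iff_integrable.1 h1).pos_part

end Congruence

/-- Lemma 2.1, Local boundedness for subsolutions. -/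
theorem local_boundedness_subsolution
    (n : ℕ) (s p Λ : ℝ)
    (hn : 2 ≤ n) (hs : 0 < s) (hs1 : s < 1) (hp1 : 1 < p) (hΛ : 1 ≤ Λ) :
    ∃ c : ℝ, 0 < c ∧
      ∀ (Φ : ℝ → ℝ) (K : Rn n → Rn n → ℝ) (Ω : Set (Rn n)) (g w : Rn n → ℝ)
        (x₀ : Rn n) (r : ℝ),
        KernelBounds n Λ s p K → PhiBounds Λ p Φ → IsOpen Ω →
        memWsp n s p univ g →
        (∀ᵐ x : Rn n, x ∉ Ω → w x = g x) →
        WeakSubSol n Φ K s p Ω w →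
        0 < r → ball x₀ r ⊆ Ω →
        ∀ σ : ℝ, 0 < σ → σ < 1 →
          essSup (fun x => ENNReal.ofReal (max (w x) 0))
              (volume.restrict (ball x₀ (σ * r))) ≤
            ENNReal.ofReal (c / (1 - σ) ^ ((n : ℝ) * p / (p - 1))) *
              (ENNReal.ofReal (⨍ x in ball x₀ r, max (w x) 0) +
                tailFn n s p (fun x => max (w x) 0) x₀ (r / 2)) := by
  have hn1 : 1 ≤ n := by omega
  have hpm : 0 < p - 1 := by linarith
  obtain ⟨C, hC, hdecay⟩ := exists_levelDecay (n := n) hn1 hs hs1 hp1 hΛ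
  obtain ⟨D, hD, hbound⟩ := exists_ball_bound (n := n) hn1 hs hs1 hp1 hC
  obtain ⟨ω, hω, hvol⟩ := exists_volume_ball_eq n
  refine ⟨D * (ω + 1), by positivity,
    fun Φ K Ω _ w₀ x₀ r hK hΦ _ _ _ hsub₀ hr hball σ hσ hσ1 => ?_⟩
  have hm₀ : AEMeasurable w₀ volume := by simpa using hsub₀.1.1
  set w := hm₀.mk w₀ with hw
  have hww : w₀ =ᵐ[volume] w := hm₀.ae_eq_mk
  have hwm : Measurable w := hm₀.measurable_mk
  have hsub : WeakSubSol n Φ K s p Ω w := hsub₀.congr_ae hww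
  have hwp : ∫⁻ x, ENNReal.ofReal (|w x| ^ p) < ⊤ := by simpa using hsub.1.2.1
  have hdec := hdecay Φ K Ω w hK hΦ hwm hsub
  have hsup : essSup (fun x => ENNReal.ofReal (max (w₀ x) 0))
      (volume.restrict (ball x₀ (σ * r))) = essSup (fun x => ENNReal.ofReal (max (w x) 0))
      (volume.restrict (ball x₀ (σ * r))) :=
    essSup_congr_ae ((ae_restrict_of_ae hww).mono fun x hx => by simp only [hx])
  have havg : ⨍ x in ball x₀ r, max (w₀ x) 0 = ⨍ x in ball x₀ r, max (w x) 0 :=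
    average_congr ((ae_restrict_of_ae hww).mono fun x hx => by simp only [hx])
  rw [hsup, havg, tailFn_posPart_eq, tailMass_congr_ae hww]
  set a := ⨍ x in ball x₀ r, max (w x) 0 with ha
  have hvr : (volume.restrict (ball x₀ r)).real univ = ω * r ^ n := by
    rw [Measure.real, Measure.restrict_apply_univ, hvol x₀ r hr, ENNReal.toReal_ofReal (by positivity)]
  have ha' : ∫ x in ball x₀ r, max (w x) 0 = a * (ω * r ^ n) := by
    rw [ha, average_eq, hvr, smul_eq_mul]
    field_simp
  have ha0 : 0 ≤ a := by
    rw [ha, average_eq]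
    exact smul_nonneg (by positivity) (integral_nonneg fun x => le_max_right _ _)
  have h_int : ∫⁻ x in ball x₀ r, ENNReal.ofReal (max (w x) 0) = ENNReal.ofReal (a * (ω * r ^ n)) := by
    rw [← ha', ofReal_integral_eq_lintegral_ofReal
      (integrableOn_posPart_of_lintegral_lt_top hp1 hwm hwp x₀ r)
      (ae_of_all _ fun x => le_max_right _ _)]
  have hτ : 0 < 1 - σ := by linarith
  have hc0 : 0 < D * (ω + 1) / (1 - σ) ^ ((n : ℝ) * p / (p - 1)) := by positivity
  by_cases hQ : tailMass n s p w x₀ (r / 2) = ⊤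
  · rw [hQ, ENNReal.top_rpow_of_pos (by positivity), add_top, ENNReal.mul_top]
    · exact le_top
    · simpa using hc0
  set q := (tailMass n s p w x₀ (r / 2)).toReal with hq
  have hq0 : 0 ≤ q := ENNReal.toReal_nonneg
  have hqQ : tailMass n s p w x₀ (r / 2) = ENNReal.ofReal q := (ENNReal.ofReal_toReal hQ).symm
  have hqr : 0 ≤ q ^ (1 / (p - 1)) := by positivity
  have hkey : ∀ δ : ℝ, 0 < δ → essSup (fun x => ENNReal.ofReal (max (w x) 0))
      (volume.restrict (ball x₀ (σ * r))) ≤ ENNReal.ofReal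
        (D / (1 - σ) ^ ((n : ℝ) * p / (p - 1)) * (ω * a + q ^ (1 / (p - 1)) + δ)) := by
    intro δ hδ
    have h := hbound Ω w x₀ r (ω * a + q ^ (1 / (p - 1)) + δ) σ hwm hdec hwp hball hr
      (by positivity) hσ hσ1 ?_ ?_
    · refine essSup_le_of_ae_le _ (h.mono fun x hx => ENNReal.ofReal_le_ofReal ?_)
      exact max_le hx (by positivity)
    · rw [h_int]
      apply ENNReal.ofReal_le_ofReal
      calc a * (ω * r ^ n) = ω * a * r ^ n := by ring
        _ ≤ _ := by gcongr; linarith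
    · rw [hqQ]
      apply ENNReal.ofReal_le_ofReal
      calc q = (q ^ (1 / (p - 1))) ^ (p - 1) := by
            rw [← Real.rpow_mul hq0, one_div_mul_cancel hpm.ne', Real.rpow_one]
        _ ≤ _ := by
          have : 0 ≤ ω * a := by positivity
          gcongr
          linarith
  have hlim : Tendsto (fun δ : ℝ => ENNReal.ofReal
      (D / (1 - σ) ^ ((n : ℝ) * p / (p - 1)) * (ω * a + q ^ (1 / (p - 1)) + δ))) (𝓝[>] 0)
      (𝓝 (ENNReal.ofReal
        (D / (1 - σ) ^ ((n : ℝ) * p / (p - 1)) * (ω * a + q ^ (1 / (p - 1)) + 0)))) := by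
    refine Tendsto.mono_left (Continuous.tendsto ?_ 0) nhdsWithin_le_nhds
    exact ENNReal.continuous_ofReal.comp (by fun_prop)
  refine (ge_of_tendsto hlim (eventually_mem_nhdsWithin.mono hkey)).trans ?_
  rw [hqQ, ENNReal.ofReal_rpow_of_nonneg hq0 (by positivity), ← ENNReal.ofReal_add ha0 hqr,
    ← ENNReal.ofReal_mul hc0.le]
  apply ENNReal.ofReal_le_ofReal
  calc D / (1 - σ) ^ ((n : ℝ) * p / (p - 1)) * (ω * a + q ^ (1 / (p - 1)) + 0)
      ≤ D / (1 - σ) ^ ((n : ℝ) * p / (p - 1)) * ((ω + 1) * (a + q ^ (1 / (p - 1)))) := by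
        gcongr
        nlinarith
    _ = _ := by ring
end
end

section
/- Let p ∈ (1,∞), s ∈ (0,1), q_* := max{1, p−1}, and let f ∈ L^{q_*}_loc(ℝⁿ) ∩ L^{p−1}_{sp}(ℝⁿ). For every ball B_R(x₀) ⊂ ℝⁿ and every r ∈ (0, R], there is a constant c depending only on n, s, p such that: Tail(f − (f)_{B_r(x₀)}; x₀, r) ≤ c (r/R)^{sp/q_*} E(f; x₀, R) + c ∫_r^R (r/t)^{sp/q_*} A(f; x₀, t) dt/t. -/
noncomputable section

open MeasureTheory Metric Set Filter Topology
open scoped ENNReal NNReal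

theorem le_mul_setLIntegral_of_doubling {A : ℝ → ℝ≥0∞} {α : ℝ} {K : ℝ≥0∞} (hα : 0 < α) (hK : K ≠ ⊤)
    (hA : ∀ r ρ, 0 < r → r ≤ ρ → ρ ≤ 2 * r → A r ≤ K * A ρ) {r : ℝ} (hr : 0 < r) :
    A r ≤ ENNReal.ofReal (2 ^ (α + 1)) * K *
      ∫⁻ t in Ioc r (2 * r), ENNReal.ofReal ((r / t) ^ α / t) * A t := by
  set w : ℝ := ((2 : ℝ) ^ (α + 1))⁻¹ * r⁻¹ with hw
  have h1 : ∀ t ∈ Ioc r (2 * r), ENNReal.ofReal w * A r ≤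
      K * (ENNReal.ofReal ((r / t) ^ α / t) * A t) := by
    intro t ht
    have ht0 : 0 < t := hr.trans ht.1
    have h2 : w ≤ (r / t) ^ α / t := by
      have h3 : (2 : ℝ)⁻¹ ^ α ≤ (r / t) ^ α := by
        apply Real.rpow_le_rpow (by norm_num) _ hα.le
        rw [le_div_iff₀ ht0]
        linarith [ht.2]
      have h4 : w = (2 : ℝ)⁻¹ ^ α / (2 * r) := by
        rw [hw, Real.rpow_add (by norm_num), Real.inv_rpow (by norm_num), Real.rpow_one]
        field_simp
      rw [h4]
      exact div_le_div₀ (by positivity) h3 ht0 ht.2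
    calc ENNReal.ofReal w * A r ≤ ENNReal.ofReal ((r / t) ^ α / t) * (K * A t) := by
          gcongr
          exact hA r t hr ht.1.le ht.2
      _ = _ := by ring
  have h5 : ENNReal.ofReal w * A r * ENNReal.ofReal r ≤
      ∫⁻ t in Ioc r (2 * r), K * (ENNReal.ofReal ((r / t) ^ α / t) * A t) := by
    calc _ = ∫⁻ _ in Ioc r (2 * r), ENNReal.ofReal w * A r := by
          rw [setLIntegral_const, Real.volume_Ioc]
          congr 2
          ring
      _ ≤ _ := setLIntegral_mono' measurableSet_Ioc h1
  rw [lintegral_const_mul' _ _ hK] at h5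
  have h8 : ENNReal.ofReal (2 ^ (α + 1)) * (ENNReal.ofReal w * A r * ENNReal.ofReal r) = A r := by
    have : ENNReal.ofReal (2 ^ (α + 1)) * ENNReal.ofReal w * ENNReal.ofReal r = 1 := by
      rw [← ENNReal.ofReal_mul (by positivity), ← ENNReal.ofReal_mul (by positivity), hw]
      rw [← ENNReal.ofReal_one]
      congr 1
      field_simp
    calc _ = (ENNReal.ofReal (2 ^ (α + 1)) * ENNReal.ofReal w * ENNReal.ofReal r) * A r := by ring
      _ = _ := by rw [this, one_mul]
  calc A r = _ := h8.symm
    _ ≤ ENNReal.ofReal (2 ^ (α + 1)) *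
        (K * ∫⁻ t in Ioc r (2 * r), ENNReal.ofReal ((r / t) ^ α / t) * A t) := by gcongr
    _ = _ := (mul_assoc _ _ _).symm

/-- A doubling quantity `A` and a quantity `T` that contracts under doubling the radius, up to
`A`, satisfy an integrated decay estimate. -/
theorem le_of_dyadic_recursion {α : ℝ} {K : ℝ≥0∞} (hα : 0 < α) (hK : K ≠ ⊤) :
    ∃ c : ℝ≥0∞, c ≠ ⊤ ∧ ∀ T A : ℝ → ℝ≥0∞,
      (∀ r ρ, 0 < r → r ≤ ρ → ρ ≤ 2 * r → A r ≤ K * A ρ) →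
      (∀ r ρ, 0 < r → r ≤ ρ → ρ ≤ 2 * r → T r ≤ K * (A ρ + T ρ)) →
      (∀ r, 0 < r → T r ≤ ENNReal.ofReal (2⁻¹ ^ α) * T (2 * r) + K * A (2 * r)) →
      ∀ r R, 0 < r → r ≤ R → T r ≤ c * (ENNReal.ofReal ((r / R) ^ α) * (A R + T R) +
        ∫⁻ t in Ioc r R, ENNReal.ofReal ((r / t) ^ α / t) * A t) := by
  set L := ENNReal.ofReal (2 ^ α) with hL
  set θ := ENNReal.ofReal (2⁻¹ ^ α) with hθ
  have hθL : θ * L = 1 := by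
    rw [hθ, hL, ← ENNReal.ofReal_mul (by positivity), ← Real.mul_rpow (by norm_num) (by norm_num)]
    norm_num
  set M := K * L with hM
  have hθM : θ * M = K := by rw [hM, mul_left_comm, hθL, mul_one]
  set c := (K + M * K) * L + M * (ENNReal.ofReal (2 ^ (α + 1)) * K) with hc
  refine ⟨c, ?_, fun T A hA hT hT2 ↦ ?_⟩
  · simp only [hc, hL]
    finiteness
  suffices H : ∀ N : ℕ, ∀ r R, 0 < r → r ≤ R → R ≤ 2 ^ (N + 1) * r →
      T r + M * A r ≤ c * (ENNReal.ofReal ((r / R) ^ α) * (A R + T R) +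
        ∫⁻ t in Ioc r R, ENNReal.ofReal ((r / t) ^ α / t) * A t) by
    intro r R hr hrR
    obtain ⟨N, hN⟩ := pow_unbounded_of_one_lt (R / r) (one_lt_two)
    refine le_self_add.trans (H N r R hr hrR ?_)
    rw [div_lt_iff₀ hr] at hN
    rw [pow_succ]
    nlinarith
  have base : ∀ r R, 0 < r → r ≤ R → R ≤ 2 * r →
      T r + M * A r ≤ c * (ENNReal.ofReal ((r / R) ^ α) * (A R + T R) +
        ∫⁻ t in Ioc r R, ENNReal.ofReal ((r / t) ^ α / t) * A t) := by
    intro r R hr hrR hR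
    have hR0 := hr.trans_le hrR
    have h1 : 1 ≤ L * ENNReal.ofReal ((r / R) ^ α) := by
      rw [hL, ← ENNReal.ofReal_mul (by positivity), ← Real.mul_rpow (by norm_num) (by positivity),
        ENNReal.one_le_ofReal]
      apply Real.one_le_rpow _ hα.le
      rw [← mul_div_assoc, le_div_iff₀ hR0]
      linarith
    calc T r + M * A r ≤ K * (A R + T R) + M * (K * (A R + T R)) := by
          gcongr
          · exact hT r R hr hrR hR
          · exact (hA r R hr hrR hR).trans (by gcongr; exact le_self_add)
      _ = (K + M * K) * 1 * (A R + T R) := by ring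
      _ ≤ (K + M * K) * (L * ENNReal.ofReal ((r / R) ^ α)) * (A R + T R) := by gcongr
      _ = ((K + M * K) * L) * (ENNReal.ofReal ((r / R) ^ α) * (A R + T R)) := by ring
      _ ≤ c * (ENNReal.ofReal ((r / R) ^ α) * (A R + T R)) := by gcongr; exact le_self_add
      _ ≤ _ := by gcongr; exact le_self_add
  intro N
  induction N with
  | zero => simpa using base
  | succ N ih =>
    intro r R hr hrR hR
    rcases le_total R (2 * r) with h | h
    · exact base r R hr hrR h
    have hR0 := hr.trans_le hrR
    have hI : θ * ∫⁻ t in Ioc (2 * r) R, ENNReal.ofReal ((2 * r / t) ^ α / t) * A t =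
        ∫⁻ t in Ioc (2 * r) R, ENNReal.ofReal ((r / t) ^ α / t) * A t := by
      rw [← lintegral_const_mul' _ _ ENNReal.ofReal_ne_top]
      refine setLIntegral_congr_fun measurableSet_Ioc fun t ht ↦ ?_
      have ht0 : 0 < t := by linarith [ht.1]
      rw [← mul_assoc, ← ENNReal.ofReal_mul (by positivity), ← mul_div_assoc,
        ← Real.mul_rpow (by norm_num) (by positivity)]
      congr 4
      ring
    have hE : θ * ENNReal.ofReal ((2 * r / R) ^ α) = ENNReal.ofReal ((r / R) ^ α) := by
      rw [hθ, ← ENNReal.ofReal_mul (by positivity), ← Real.mul_rpow (by norm_num) (by positivity)]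
      congr 2
      ring
    have hU : ∫⁻ t in Ioc r R, ENNReal.ofReal ((r / t) ^ α / t) * A t =
        (∫⁻ t in Ioc r (2 * r), ENNReal.ofReal ((r / t) ^ α / t) * A t) +
        ∫⁻ t in Ioc (2 * r) R, ENNReal.ofReal ((r / t) ^ α / t) * A t := by
      rw [← lintegral_union measurableSet_Ioc, Ioc_union_Ioc_eq_Ioc (by linarith) h]
      exact Set.Ioc_disjoint_Ioc_of_le le_rfl
    have ih' := ih (2 * r) R (by positivity) h (by rw [pow_succ] at hR; linarith)
    calc T r + M * A r ≤ (θ * T (2 * r) + K * A (2 * r)) + M * A r := by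
          gcongr
          exact hT2 r hr
      _ = θ * (T (2 * r) + M * A (2 * r)) + M * A r := by rw [mul_add, ← mul_assoc θ M, hθM]
      _ ≤ θ * (c * (ENNReal.ofReal ((2 * r / R) ^ α) * (A R + T R) +
            ∫⁻ t in Ioc (2 * r) R, ENNReal.ofReal ((2 * r / t) ^ α / t) * A t)) +
          M * (ENNReal.ofReal (2 ^ (α + 1)) * K *
            ∫⁻ t in Ioc r (2 * r), ENNReal.ofReal ((r / t) ^ α / t) * A t) := by
          gcongr
          exact le_mul_setLIntegral_of_doubling hα hK hA hr
      _ ≤ θ * (c * (ENNReal.ofReal ((2 * r / R) ^ α) * (A R + T R) +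
            ∫⁻ t in Ioc (2 * r) R, ENNReal.ofReal ((2 * r / t) ^ α / t) * A t)) +
          c * ∫⁻ t in Ioc r (2 * r), ENNReal.ofReal ((r / t) ^ α / t) * A t := by
          rw [← mul_assoc M]
          gcongr
          exact le_add_self
      _ = c * ((θ * ENNReal.ofReal ((2 * r / R) ^ α)) * (A R + T R) +
            ((∫⁻ t in Ioc r (2 * r), ENNReal.ofReal ((r / t) ^ α / t) * A t) +
            θ * ∫⁻ t in Ioc (2 * r) R, ENNReal.ofReal ((2 * r / t) ^ α / t) * A t)) := by ring
      _ = _ := by rw [hI, hE, hU]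

theorem ENNReal.le_mul_add_of_rpow_le {m : ℝ} (hm : 0 < m) {a b x C : ℝ≥0∞}
    (h : x ^ m ≤ b ^ m + C * a ^ m) : x ≤ (1 + C) ^ (1 / m) * (a + b) := by
  have h1 : x ^ m ≤ (1 + C) * (a + b) ^ m := by
    calc x ^ m ≤ (a + b) ^ m + C * (a + b) ^ m := by
          refine h.trans ?_
          gcongr
          · exact le_add_self
          · exact le_self_add
      _ = _ := by ring
  calc x = (x ^ m) ^ (1 / m) := by
        rw [← ENNReal.rpow_mul, mul_one_div_cancel hm.ne', ENNReal.rpow_one]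
    _ ≤ ((1 + C) * (a + b) ^ m) ^ (1 / m) := by gcongr
    _ = _ := by
      rw [ENNReal.mul_rpow_of_nonneg _ _ (by positivity), ← ENNReal.rpow_mul (a + b),
        mul_one_div_cancel hm.ne', ENNReal.rpow_one]

theorem ENNReal.le_convex_add_of_rpow_le {m : ℝ} (hm : 0 < m) (hm1 : m ≤ 1) {θ C : ℝ≥0∞}
    (hθ : θ < 1) {a b x : ℝ≥0∞} (h : x ^ m ≤ θ * b ^ m + C * a ^ m) :
    x ≤ θ * b + (1 - θ) * (C / (1 - θ)) ^ (1 / m) * a := by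
  have h0 : 1 - θ ≠ 0 := (tsub_pos_of_lt hθ).ne'
  have ht : 1 - θ ≠ ⊤ := (tsub_le_self.trans_lt one_lt_top).ne
  have hw : θ + (1 - θ) = 1 := add_tsub_cancel_of_le hθ.le
  have hr (y : ℝ≥0∞) : (y ^ m) ^ (1 / m) = y := by
    rw [← ENNReal.rpow_mul, mul_one_div_cancel hm.ne', ENNReal.rpow_one]
  calc x = (x ^ m) ^ (1 / m) := (hr x).symm
    _ ≤ (θ * b ^ m + (1 - θ) * (C / (1 - θ) * a ^ m)) ^ (1 / m) := by
      rw [← mul_assoc, ENNReal.mul_div_cancel h0 ht]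
      gcongr
    _ ≤ θ * (b ^ m) ^ (1 / m) + (1 - θ) * (C / (1 - θ) * a ^ m) ^ (1 / m) :=
      ENNReal.rpow_arith_mean_le_arith_mean2_rpow _ _ _ _ hw (by rwa [le_div_iff₀ hm, one_mul])
    _ = _ := by rw [ENNReal.mul_rpow_of_nonneg _ _ (by positivity), hr, hr, mul_assoc]

theorem lintegral_enorm_rpow_add_le {X : Type*} [MeasurableSpace X] {μ : Measure X} {e : ℝ}
    (he : 0 < e) {v w : X → ℝ} (hv : AEMeasurable v μ) (hw : AEMeasurable w μ) :
    (∫⁻ x, ‖v x + w x‖ₑ ^ e ∂μ) ^ (1 / max 1 e) ≤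
      (∫⁻ x, ‖v x‖ₑ ^ e ∂μ) ^ (1 / max 1 e) + (∫⁻ x, ‖w x‖ₑ ^ e ∂μ) ^ (1 / max 1 e) := by
  rcases le_total 1 e with h | h
  · rw [max_eq_right h]
    exact eLpNorm'_add_le hv.aestronglyMeasurable hw.aestronglyMeasurable h
  · simp only [max_eq_left h, div_one, ENNReal.rpow_one]
    rw [← lintegral_add_left' (hv.enorm.pow_const e)]
    refine lintegral_mono fun x ↦ ?_
    calc ‖v x + w x‖ₑ ^ e ≤ (‖v x‖ₑ + ‖w x‖ₑ) ^ e := by gcongr; exact enorm_add_le _ _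
      _ ≤ _ := ENNReal.rpow_add_le_add_rpow _ _ he.le h

theorem lintegral_enorm_rpow_le_eLpNorm'_rpow {X : Type*} [MeasurableSpace X] {ν : Measure X}
    [IsProbabilityMeasure ν] {e : ℝ} (he : 0 < e) {v : X → ℝ} (hv : AEMeasurable v ν) :
    (∫⁻ x, ‖v x‖ₑ ^ e ∂ν) ^ (1 / max 1 e) ≤ eLpNorm' v (max 1 e) ν ^ (e / max 1 e) := by
  calc _ = eLpNorm' v e ν ^ (e / max 1 e) := by
        rw [eLpNorm'_eq_lintegral_enorm, ← ENNReal.rpow_mul]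
        congr 1
        field_simp
    _ ≤ _ := by
      gcongr
      exact eLpNorm'_le_eLpNorm'_of_exponent_le he (le_max_right _ _) ν hv.aestronglyMeasurable

/-- The normalised Lebesgue measure on a ball. -/
def ballMeasure (n : ℕ) (x₀ : Rn n) (r : ℝ) : Measure (Rn n) :=
  (volume (ball x₀ r))⁻¹ • volume.restrict (ball x₀ r)

/-- The weighted measure on the complement of a ball that defines the tail. -/
def tailMeasure (n : ℕ) (a : ℝ) (x₀ : Rn n) (r : ℝ) : Measure (Rn n) :=
  (volume.restrict (ball x₀ r)ᶜ).withDensity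
    fun x ↦ ENNReal.ofReal (r ^ a / ‖x - x₀‖ ^ ((n : ℝ) + a))

theorem measurable_tailDensity (n : ℕ) (a : ℝ) (x₀ : Rn n) (r : ℝ) :
    Measurable fun x : Rn n ↦ ENNReal.ofReal (r ^ a / ‖x - x₀‖ ^ ((n : ℝ) + a)) := by
  fun_prop

theorem ballMeasure_absolutelyContinuous (n : ℕ) (x₀ : Rn n) (r : ℝ) :
    ballMeasure n x₀ r ≪ volume :=
  Measure.restrict_le_self.absolutelyContinuous.smul_left _

theorem tailMeasure_absolutelyContinuous (n : ℕ) (a : ℝ) (x₀ : Rn n) (r : ℝ) :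
    tailMeasure n a x₀ r ≪ volume :=
  (withDensity_absolutelyContinuous _ _).trans Measure.restrict_le_self.absolutelyContinuous

theorem isProbabilityMeasure_ballMeasure (n : ℕ) (x₀ : Rn n) {r : ℝ} (hr : 0 < r) :
    IsProbabilityMeasure (ballMeasure n x₀ r) :=
  ⟨by simp [ballMeasure, ENNReal.inv_mul_cancel (measure_ball_pos volume x₀ hr).ne'
    measure_ball_lt_top.ne]⟩

theorem volume_ball_eq (n : ℕ) (x₀ : Rn n) {r : ℝ} (hr : 0 < r) :
    volume (ball x₀ r) = ENNReal.ofReal (r ^ n) * volume (ball (0 : Rn n) 1) := by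
  rw [Measure.addHaar_ball_of_pos volume x₀ hr, finrank_euclideanSpace_fin]

theorem ballAvg_eq_integral (n : ℕ) (f : Rn n → ℝ) (x₀ : Rn n) (r : ℝ) :
    ballAvg n f x₀ r = ∫ x, f x ∂ballMeasure n x₀ r := by
  rw [ballAvg, average_eq', ballMeasure, Measure.restrict_apply_univ]

theorem locExcess_eq_eLpNorm' (n : ℕ) (p : ℝ) (f : Rn n → ℝ) (x₀ : Rn n) (r : ℝ) :
    locExcess n p f x₀ r =
      eLpNorm' (fun x ↦ f x - ballAvg n f x₀ r) (qStar p) (ballMeasure n x₀ r) := by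
  have hq : 0 ≤ qStar p := zero_le_one.trans (le_max_left _ _)
  rw [locExcess, eLpNorm'_eq_lintegral_enorm, ballMeasure, lintegral_smul_measure, smul_eq_mul]
  simp only [Real.enorm_eq_ofReal_abs, ENNReal.ofReal_rpow_of_nonneg (abs_nonneg _) hq]

theorem tailFn_rpow (n : ℕ) {s p : ℝ} (hp : 1 < p) {v : Rn n → ℝ}
    (hv : AEMeasurable v volume) (x₀ : Rn n) {r : ℝ} (hr : 0 < r) :
    tailFn n s p v x₀ r ^ ((p - 1) / qStar p) =
      (∫⁻ x, ‖v x‖ₑ ^ (p - 1) ∂tailMeasure n (s * p) x₀ r) ^ (1 / qStar p) := by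
  have hp0 : p - 1 ≠ 0 := by linarith
  have hp1 : 0 ≤ p - 1 := by linarith
  rw [tailFn, ← ENNReal.rpow_mul, tailMeasure, lintegral_withDensity_eq_lintegral_mul₀
    (measurable_tailDensity n (s * p) x₀ r).aemeasurable (hv.restrict.enorm.pow_const _),
    ← lintegral_const_mul' _ _ ENNReal.ofReal_ne_top]
  congr 1
  · refine lintegral_congr fun x ↦ ?_
    rw [Pi.mul_apply, Real.enorm_eq_ofReal_abs, ENNReal.ofReal_rpow_of_nonneg (abs_nonneg _) hp1,
      ← ENNReal.ofReal_mul (by positivity), ← ENNReal.ofReal_mul (by positivity)]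
    congr 1
    ring
  · field_simp

theorem lintegral_ballMeasure_le (n : ℕ) (x₀ : Rn n) {r ρ : ℝ} (hr : 0 < r) (hrρ : r ≤ ρ)
    (hρ : ρ ≤ 2 * r) (g : Rn n → ℝ≥0∞) :
    ∫⁻ x, g x ∂ballMeasure n x₀ r ≤ 2 ^ n * ∫⁻ x, g x ∂ballMeasure n x₀ ρ := by
  have hρ0 := hr.trans_le hrρ
  have hV : volume (ball x₀ ρ) ≤ 2 ^ n * volume (ball x₀ r) := by
    rw [volume_ball_eq n x₀ hr, volume_ball_eq n x₀ hρ0, ← mul_assoc]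
    gcongr
    rw [show (2 : ℝ≥0∞) ^ n = ENNReal.ofReal (2 ^ n) by simp [ENNReal.ofReal_pow],
      ← ENNReal.ofReal_mul (by positivity), ← mul_pow]
    gcongr
  have hI : (volume (ball x₀ r))⁻¹ ≤ 2 ^ n * (volume (ball x₀ ρ))⁻¹ := by
    rw [← div_eq_mul_inv, ENNReal.le_div_iff_mul_le
      (.inl (measure_ball_pos volume x₀ hρ0).ne') (.inl measure_ball_lt_top.ne)]
    calc _ ≤ (volume (ball x₀ r))⁻¹ * (2 ^ n * volume (ball x₀ r)) := by gcongr
      _ = 2 ^ n * ((volume (ball x₀ r))⁻¹ * volume (ball x₀ r)) := by ring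
      _ = 2 ^ n := by
        rw [ENNReal.inv_mul_cancel (measure_ball_pos volume x₀ hr).ne' measure_ball_lt_top.ne,
          mul_one]
  simp only [ballMeasure, lintegral_smul_measure, smul_eq_mul]
  rw [← mul_assoc]
  gcongr

theorem lintegral_tailMeasure_le (n : ℕ) {a : ℝ} (ha : 0 < a) (x₀ : Rn n) {r ρ : ℝ} (hr : 0 < r)
    (hrρ : r ≤ ρ) (hρ : ρ ≤ 2 * r) {g : Rn n → ℝ≥0∞} (hg : AEMeasurable g volume) :
    ∫⁻ x, g x ∂tailMeasure n a x₀ r ≤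
      ENNReal.ofReal ((r / ρ) ^ a) * ∫⁻ x, g x ∂tailMeasure n a x₀ ρ +
        2 ^ n * volume (ball (0 : Rn n) 1) * ∫⁻ x, g x ∂ballMeasure n x₀ ρ := by
  have hρ0 := hr.trans_le hrρ
  simp only [tailMeasure, lintegral_withDensity_eq_lintegral_mul₀
    (measurable_tailDensity n a x₀ _).aemeasurable hg.restrict]
  rw [← lintegral_const_mul' _ _ ENNReal.ofReal_ne_top, ballMeasure, lintegral_smul_measure,
    smul_eq_mul]
  have hU : (ball x₀ r)ᶜ ⊆ (ball x₀ ρ)ᶜ ∪ (ball x₀ ρ \ ball x₀ r) := by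
    intro x hx
    by_cases h : x ∈ ball x₀ ρ
    · exact .inr ⟨h, hx⟩
    · exact .inl h
  refine (lintegral_mono_set hU).trans ((lintegral_union_le _ _ _).trans (add_le_add ?_ ?_))
  · refine lintegral_mono fun x ↦ ?_
    simp only [Pi.mul_apply]
    rw [← mul_assoc, ← ENNReal.ofReal_mul (by positivity), Real.div_rpow hr.le hρ0.le]
    apply le_of_eq
    congr 2
    have := (Real.rpow_pos_of_pos hρ0 a).ne'
    field_simp
  · have hB0 := (measure_ball_pos volume x₀ hρ0).ne'
    have hBt : volume (ball x₀ ρ) ≠ ⊤ := measure_ball_lt_top.ne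
    have hd : ∀ x ∈ ball x₀ ρ \ ball x₀ r,
        ENNReal.ofReal (r ^ a / ‖x - x₀‖ ^ ((n : ℝ) + a)) ≤
          2 ^ n * volume (ball (0 : Rn n) 1) * (volume (ball x₀ ρ))⁻¹ := by
      intro x hx
      have hx' : r ≤ ‖x - x₀‖ := by simpa [dist_eq_norm] using hx.2
      rw [← div_eq_mul_inv, ENNReal.le_div_iff_mul_le (.inl hB0) (.inl hBt),
        volume_ball_eq n x₀ hρ0, ← mul_assoc]
      gcongr
      rw [show (2 : ℝ≥0∞) ^ n = ENNReal.ofReal (2 ^ n) by simp [ENNReal.ofReal_pow],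
        ← ENNReal.ofReal_mul (by positivity)]
      apply ENNReal.ofReal_le_ofReal
      calc r ^ a / ‖x - x₀‖ ^ ((n : ℝ) + a) * ρ ^ n
          ≤ r ^ a / r ^ ((n : ℝ) + a) * (2 * r) ^ n := by gcongr
        _ = 2 ^ n := by
          rw [Real.rpow_add hr, Real.rpow_natCast, mul_pow]
          have := (Real.rpow_pos_of_pos hr a).ne'
          field_simp
    calc _ ≤ ∫⁻ x in ball x₀ ρ \ ball x₀ r,
          2 ^ n * volume (ball (0 : Rn n) 1) * (volume (ball x₀ ρ))⁻¹ * g x := by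
          refine setLIntegral_mono' (measurableSet_ball.diff measurableSet_ball) fun x hx ↦ ?_
          rw [Pi.mul_apply]
          gcongr
          exact hd x hx
      _ ≤ ∫⁻ x in ball x₀ ρ,
          2 ^ n * volume (ball (0 : Rn n) 1) * (volume (ball x₀ ρ))⁻¹ * g x :=
          lintegral_mono_set sdiff_subset
      _ = _ := by
        rw [lintegral_const_mul' _ _ (ENNReal.mul_ne_top (ENNReal.mul_ne_top (by simp)
          measure_ball_lt_top.ne) (ENNReal.inv_ne_top.2 hB0)), mul_assoc]

theorem exists_tailMeasure_univ_le (n : ℕ) {a : ℝ} (ha : 0 < a) :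
    ∃ κ : ℝ≥0∞, κ ≠ ⊤ ∧ ∀ (x₀ : Rn n) (r : ℝ), 0 < r → tailMeasure n a x₀ r univ ≤ κ := by
  set b : ℝ := (n : ℝ) + a with hb
  have hb0 : 0 < b := by positivity
  set G : Rn n → ℝ≥0∞ := fun x ↦ ENNReal.ofReal ((1 + ‖x‖) ^ (-b)) with hG
  have hGm : Measurable G := by fun_prop
  have hfin : ∫⁻ x, G x < ⊤ := finite_integral_one_add_norm (by
    rw [finrank_euclideanSpace_fin]; linarith)
  refine ⟨ENNReal.ofReal (2 ^ b) * ∫⁻ x, G x, by finiteness, fun x₀ r hr ↦ ?_⟩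
  have hpt : ∀ x ∈ (ball x₀ r)ᶜ, ENNReal.ofReal (r ^ a / ‖x - x₀‖ ^ b) ≤
      ENNReal.ofReal (2 ^ b * (r⁻¹) ^ n) * G (r⁻¹ • (x - x₀)) := by
    intro x hx
    have hx' : r ≤ ‖x - x₀‖ := by simpa [dist_eq_norm] using hx
    have hx0 := hr.trans_le hx'
    rw [hG, ← ENNReal.ofReal_mul (by positivity)]
    apply ENNReal.ofReal_le_ofReal
    rw [norm_smul, norm_inv, Real.norm_of_nonneg hr.le]
    have h1 : (1 + r⁻¹ * ‖x - x₀‖) ≤ 2 * r⁻¹ * ‖x - x₀‖ := by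
      have : 1 ≤ r⁻¹ * ‖x - x₀‖ := by rw [inv_mul_eq_div, le_div_iff₀ hr]; linarith
      linarith
    have h2 : (2 * r⁻¹ * ‖x - x₀‖) ^ (-b) ≤ (1 + r⁻¹ * ‖x - x₀‖) ^ (-b) :=
      Real.rpow_le_rpow_of_nonpos (by positivity) h1 (by linarith)
    calc r ^ a / ‖x - x₀‖ ^ b = 2 ^ b * r⁻¹ ^ n * (2 * r⁻¹ * ‖x - x₀‖) ^ (-b) := by
          rw [Real.rpow_neg (by positivity), Real.mul_rpow (by positivity) (by positivity),
            Real.mul_rpow (by positivity) (by positivity), Real.inv_rpow hr.le, hb,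
            Real.rpow_add hr, Real.rpow_natCast]
          have := (Real.rpow_pos_of_pos hr a).ne'
          rw [inv_pow]
          field_simp
      _ ≤ _ := by gcongr
  have hscale : ∫⁻ x, G (r⁻¹ • (x - x₀)) = ENNReal.ofReal (r ^ n) * ∫⁻ x, G x := by
    rw [lintegral_sub_right_eq_self (fun x ↦ G (r⁻¹ • x)) x₀,
      ← lintegral_map hGm (measurable_const_smul r⁻¹),
      Measure.map_addHaar_smul _ (inv_ne_zero hr.ne'), lintegral_smul_measure,
      finrank_euclideanSpace_fin, smul_eq_mul, inv_pow, inv_inv, abs_of_pos (by positivity)]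
  calc tailMeasure n a x₀ r univ
      = ∫⁻ x in (ball x₀ r)ᶜ, ENNReal.ofReal (r ^ a / ‖x - x₀‖ ^ b) := by
        rw [tailMeasure, withDensity_apply _ MeasurableSet.univ, Measure.restrict_univ]
    _ ≤ ∫⁻ x in (ball x₀ r)ᶜ, ENNReal.ofReal (2 ^ b * (r⁻¹) ^ n) * G (r⁻¹ • (x - x₀)) :=
        setLIntegral_mono' measurableSet_ball.compl hpt
    _ ≤ ∫⁻ x, ENNReal.ofReal (2 ^ b * (r⁻¹) ^ n) * G (r⁻¹ • (x - x₀)) :=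
        setLIntegral_le_lintegral _ _
    _ = ENNReal.ofReal (2 ^ b) * ∫⁻ x, G x := by
      rw [lintegral_const_mul' _ _ ENNReal.ofReal_ne_top, hscale, ← mul_assoc,
        ← ENNReal.ofReal_mul (by positivity), mul_assoc, ← mul_pow, inv_mul_cancel₀ hr.ne',
        one_pow, mul_one]

theorem integrable_ballMeasure {n : ℕ} {q : ℝ} (hq : 1 ≤ q) {f : Rn n → ℝ}
    (hf : AEMeasurable f volume)
    (hfq : ∀ ρ : ℝ, (∫⁻ x in ball (0 : Rn n) ρ, ENNReal.ofReal (|f x| ^ q)) < ⊤)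
    (x₀ : Rn n) {r : ℝ} (hr : 0 < r) : Integrable f (ballMeasure n x₀ r) := by
  refine Integrable.smul_measure ?_ (ENNReal.inv_ne_top.2 (measure_ball_pos volume x₀ hr).ne')
  refine ⟨hf.restrict.aestronglyMeasurable, ?_⟩
  have hsub : ball x₀ r ⊆ ball 0 (r + dist x₀ 0) := ball_subset_ball' le_rfl
  calc ∫⁻ x in ball x₀ r, ‖f x‖ₑ
      ≤ ∫⁻ x in ball x₀ r, (1 + ENNReal.ofReal (|f x| ^ q)) := by
        refine lintegral_mono fun x ↦ ?_
        rw [← ENNReal.ofReal_one, ← ENNReal.ofReal_add zero_le_one (by positivity),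
          Real.enorm_eq_ofReal_abs]
        apply ENNReal.ofReal_le_ofReal
        rcases le_total |f x| 1 with h | h
        · linarith [Real.rpow_nonneg (abs_nonneg (f x)) q]
        · linarith [Real.self_le_rpow_of_one_le h hq]
    _ = volume (ball x₀ r) + ∫⁻ x in ball x₀ r, ENNReal.ofReal (|f x| ^ q) := by
        rw [lintegral_add_left measurable_const, setLIntegral_one]
    _ < ⊤ := ENNReal.add_lt_top.2
        ⟨measure_ball_lt_top, (lintegral_mono_set hsub).trans_lt (hfq _)⟩

theorem enorm_ballAvg_sub_le {n : ℕ} {q : ℝ} (hq : 1 ≤ q) {f : Rn n → ℝ}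
    (hf : AEMeasurable f volume) (x₀ : Rn n) {r ρ : ℝ} (hr : 0 < r) (hrρ : r ≤ ρ)
    (hρ : ρ ≤ 2 * r) (hfi : Integrable f (ballMeasure n x₀ r)) (a : ℝ) :
    ‖ballAvg n f x₀ r - a‖ₑ ≤ 2 ^ n * eLpNorm' (fun x ↦ f x - a) q (ballMeasure n x₀ ρ) := by
  have := isProbabilityMeasure_ballMeasure n x₀ hr
  have := isProbabilityMeasure_ballMeasure n x₀ (hr.trans_le hrρ)
  have hm : AEStronglyMeasurable (fun x ↦ f x - a) (ballMeasure n x₀ ρ) :=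
    ((hf.sub_const a).mono_ac (ballMeasure_absolutelyContinuous n x₀ ρ)).aestronglyMeasurable
  calc ‖ballAvg n f x₀ r - a‖ₑ = ‖∫ x, (f x - a) ∂ballMeasure n x₀ r‖ₑ := by
        rw [integral_sub hfi (integrable_const a), integral_const, ballAvg_eq_integral]
        simp
    _ ≤ ∫⁻ x, ‖f x - a‖ₑ ∂ballMeasure n x₀ r := enorm_integral_le_lintegral_enorm _
    _ ≤ 2 ^ n * ∫⁻ x, ‖f x - a‖ₑ ∂ballMeasure n x₀ ρ :=
        lintegral_ballMeasure_le n x₀ hr hrρ hρ _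
    _ ≤ _ := by
      gcongr
      simpa [eLpNorm'_eq_lintegral_enorm] using
        eLpNorm'_le_eLpNorm'_of_exponent_le one_pos hq (ballMeasure n x₀ ρ) hm

theorem locExcess_le_of_le_two_mul {n : ℕ} {p : ℝ} {f : Rn n → ℝ}
    (hf : AEMeasurable f volume) (x₀ : Rn n) {r ρ : ℝ} (hr : 0 < r) (hrρ : r ≤ ρ)
    (hρ : ρ ≤ 2 * r) (hfi : Integrable f (ballMeasure n x₀ r)) :
    locExcess n p f x₀ r ≤ 2 * 2 ^ n * locExcess n p f x₀ ρ := by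
  have hq : 1 ≤ qStar p := le_max_left _ _
  have hq0 : 0 < qStar p := zero_lt_one.trans_le hq
  have := isProbabilityMeasure_ballMeasure n x₀ hr
  set m := ballAvg n f x₀ ρ
  set d := ballAvg n f x₀ r
  have h1 : ‖d - m‖ₑ ≤ 2 ^ n * locExcess n p f x₀ ρ := by
    rw [locExcess_eq_eLpNorm']
    exact enorm_ballAvg_sub_le hq hf x₀ hr hrρ hρ hfi m
  have h2 : eLpNorm' (fun x ↦ f x - m) (qStar p) (ballMeasure n x₀ r) ≤
      2 ^ n * locExcess n p f x₀ ρ := by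
    rw [locExcess_eq_eLpNorm']
    calc eLpNorm' (fun x ↦ f x - m) (qStar p) (ballMeasure n x₀ r)
        ≤ (2 ^ n * ∫⁻ x, ‖f x - m‖ₑ ^ qStar p ∂ballMeasure n x₀ ρ) ^ (1 / qStar p) := by
          rw [eLpNorm'_eq_lintegral_enorm]
          gcongr
          exact lintegral_ballMeasure_le n x₀ hr hrρ hρ _
      _ = (2 ^ n) ^ (1 / qStar p) *
          eLpNorm' (fun x ↦ f x - m) (qStar p) (ballMeasure n x₀ ρ) := by
          rw [ENNReal.mul_rpow_of_nonneg _ _ (by positivity), eLpNorm'_eq_lintegral_enorm]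
      _ ≤ _ := by
        gcongr
        calc ((2 : ℝ≥0∞) ^ n) ^ (1 / qStar p) ≤ ((2 : ℝ≥0∞) ^ n) ^ (1 : ℝ) :=
              ENNReal.rpow_le_rpow_of_exponent_le (one_le_pow₀ one_le_two)
                ((div_le_one hq0).2 hq)
          _ = 2 ^ n := ENNReal.rpow_one _
  calc locExcess n p f x₀ r
      = eLpNorm' ((fun x ↦ f x - m) + fun _ ↦ m - d) (qStar p) (ballMeasure n x₀ r) := by
        rw [locExcess_eq_eLpNorm']
        congr 1
        ext x
        simp [d]
    _ ≤ eLpNorm' (fun x ↦ f x - m) (qStar p) (ballMeasure n x₀ r) +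
        eLpNorm' (fun _ ↦ m - d) (qStar p) (ballMeasure n x₀ r) :=
        eLpNorm'_add_le ((hf.sub_const m).mono_ac
          (ballMeasure_absolutelyContinuous n x₀ r)).aestronglyMeasurable
          aestronglyMeasurable_const hq
    _ ≤ 2 ^ n * locExcess n p f x₀ ρ + 2 ^ n * locExcess n p f x₀ ρ := by
        gcongr
        rw [eLpNorm'_const_of_isProbabilityMeasure _ hq0, ← enorm_neg, neg_sub]
        exact h1
    _ = _ := by ring

theorem exists_tailFn_rpow_le (n : ℕ) {s p : ℝ} (hs : 0 < s) (hp : 1 < p) :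
    ∃ C : ℝ≥0∞, C ≠ ⊤ ∧ ∀ (f : Rn n → ℝ) (x₀ : Rn n) (r ρ : ℝ), AEMeasurable f volume →
      Integrable f (ballMeasure n x₀ r) → 0 < r → r ≤ ρ → ρ ≤ 2 * r →
      tailFn n s p (fun x ↦ f x - ballAvg n f x₀ r) x₀ r ^ ((p - 1) / qStar p) ≤
        ENNReal.ofReal ((r / ρ) ^ (s * p / qStar p)) *
          tailFn n s p (fun x ↦ f x - ballAvg n f x₀ ρ) x₀ ρ ^ ((p - 1) / qStar p) +
        C * locExcess n p f x₀ ρ ^ ((p - 1) / qStar p) := by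
  have hq : 1 ≤ qStar p := le_max_left _ _
  have hq0 : 0 < qStar p := zero_lt_one.trans_le hq
  have he : 0 < p - 1 := by linarith
  have ha : 0 < s * p := by positivity
  obtain ⟨κ, hκ, hκ'⟩ := exists_tailMeasure_univ_le n ha
  set m := (p - 1) / qStar p with hm
  have hm0 : 0 < m := by positivity
  set D : ℝ≥0∞ := 2 ^ n * volume (ball (0 : Rn n) 1)
  have hDt : D ≠ ⊤ := ENNReal.mul_ne_top (by simp) measure_ball_lt_top.ne
  refine ⟨D ^ (1 / qStar p) + (2 ^ n) ^ m * κ ^ (1 / qStar p), ?_, ?_⟩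
  · have h1 : 0 ≤ 1 / qStar p := by positivity
    finiteness
  intro f x₀ r ρ hf hfi hr hrρ hρ
  have hρ0 := hr.trans_le hrρ
  have := isProbabilityMeasure_ballMeasure n x₀ hρ0
  set a := ballAvg n f x₀ ρ
  set d := ballAvg n f x₀ r
  have hfa : AEMeasurable (fun x ↦ f x - a) volume := hf.sub_const a
  have hd : ‖a - d‖ₑ ≤ 2 ^ n * locExcess n p f x₀ ρ := by
    rw [← enorm_neg, neg_sub, locExcess_eq_eLpNorm']
    exact enorm_ballAvg_sub_le hq hf x₀ hr hrρ hρ hfi a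
  have hA : (∫⁻ x, ‖f x - a‖ₑ ^ (p - 1) ∂ballMeasure n x₀ ρ) ^ (1 / qStar p) ≤
      locExcess n p f x₀ ρ ^ m := by
    rw [locExcess_eq_eLpNorm']
    exact lintegral_enorm_rpow_le_eLpNorm'_rpow he
      (hfa.mono_ac (ballMeasure_absolutelyContinuous n x₀ ρ))
  rw [tailFn_rpow n hp (hf.sub_const d) x₀ hr, tailFn_rpow n hp hfa x₀ hρ0]
  set τ := tailMeasure n (s * p) x₀ r
  calc (∫⁻ x, ‖f x - d‖ₑ ^ (p - 1) ∂τ) ^ (1 / qStar p)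
      = (∫⁻ x, ‖(f x - a) + (a - d)‖ₑ ^ (p - 1) ∂τ) ^ (1 / qStar p) := by
        simp only [sub_add_sub_cancel]
    _ ≤ (∫⁻ x, ‖f x - a‖ₑ ^ (p - 1) ∂τ) ^ (1 / qStar p) +
        (∫⁻ _, ‖a - d‖ₑ ^ (p - 1) ∂τ) ^ (1 / qStar p) :=
        lintegral_enorm_rpow_add_le he
          (hfa.mono_ac (tailMeasure_absolutelyContinuous n _ x₀ r)) aemeasurable_const
    _ ≤ (ENNReal.ofReal ((r / ρ) ^ (s * p)) *
          ∫⁻ x, ‖f x - a‖ₑ ^ (p - 1) ∂tailMeasure n (s * p) x₀ ρ +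
          D * ∫⁻ x, ‖f x - a‖ₑ ^ (p - 1) ∂ballMeasure n x₀ ρ) ^ (1 / qStar p) +
        ((2 ^ n * locExcess n p f x₀ ρ) ^ (p - 1) * κ) ^ (1 / qStar p) := by
        rw [lintegral_const]
        gcongr
        · exact lintegral_tailMeasure_le n ha x₀ hr hrρ hρ (hfa.enorm.pow_const _)
        · exact hκ' x₀ r hr
    _ ≤ ((ENNReal.ofReal ((r / ρ) ^ (s * p)) *
          ∫⁻ x, ‖f x - a‖ₑ ^ (p - 1) ∂tailMeasure n (s * p) x₀ ρ) ^ (1 / qStar p) +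
          (D * ∫⁻ x, ‖f x - a‖ₑ ^ (p - 1) ∂ballMeasure n x₀ ρ) ^ (1 / qStar p)) +
        ((2 ^ n * locExcess n p f x₀ ρ) ^ (p - 1) * κ) ^ (1 / qStar p) := by
        gcongr
        exact ENNReal.rpow_add_le_add_rpow _ _ (by positivity) ((div_le_one hq0).2 hq)
    _ = (ENNReal.ofReal ((r / ρ) ^ (s * p / qStar p)) *
          (∫⁻ x, ‖f x - a‖ₑ ^ (p - 1) ∂tailMeasure n (s * p) x₀ ρ) ^ (1 / qStar p) +
          D ^ (1 / qStar p) *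
            (∫⁻ x, ‖f x - a‖ₑ ^ (p - 1) ∂ballMeasure n x₀ ρ) ^ (1 / qStar p)) +
        (2 ^ n) ^ m * locExcess n p f x₀ ρ ^ m * κ ^ (1 / qStar p) := by
        have hq' : 0 ≤ 1 / qStar p := by positivity
        rw [ENNReal.mul_rpow_of_nonneg _ _ hq', ENNReal.mul_rpow_of_nonneg D _ hq',
          ENNReal.mul_rpow_of_nonneg _ κ hq', ← ENNReal.rpow_mul, mul_one_div, ← hm,
          ENNReal.mul_rpow_of_nonneg _ _ hm0.le,
          ENNReal.ofReal_rpow_of_nonneg (by positivity) hq', ← Real.rpow_mul (by positivity),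
          mul_one_div]
    _ ≤ (ENNReal.ofReal ((r / ρ) ^ (s * p / qStar p)) *
          (∫⁻ x, ‖f x - a‖ₑ ^ (p - 1) ∂tailMeasure n (s * p) x₀ ρ) ^ (1 / qStar p) +
          D ^ (1 / qStar p) * locExcess n p f x₀ ρ ^ m) +
        (2 ^ n) ^ m * locExcess n p f x₀ ρ ^ m * κ ^ (1 / qStar p) := by gcongr
    _ = _ := by ring

/-- Lemma 2.4(3), structure property of the global excess. -/
theorem tail_excess_estimate
    (n : ℕ) (s p : ℝ)
    (hn : 2 ≤ n) (hs : 0 < s) (hs1 : s < 1) (hp1 : 1 < p) :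
    ∃ c : ℝ, 0 < c ∧
      ∀ (f : Rn n → ℝ) (x₀ : Rn n) (R r : ℝ),
        -- f ∈ L^{q_*}_loc(ℝⁿ) ∩ L^{p-1}_{sp}(ℝⁿ)
        AEMeasurable f (volume : Measure (Rn n)) →
        (∀ ρ : ℝ, (∫⁻ x in ball (0 : Rn n) ρ, ENNReal.ofReal (|f x| ^ qStar p)) < ⊤) →
        memTailSpace n s p f →
        0 < R → 0 < r → r ≤ R →
        tailFn n s p (fun x => f x - ballAvg n f x₀ r) x₀ r ≤
          ENNReal.ofReal (c * (r / R) ^ (s * p / qStar p)) * excess n s p f x₀ R +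
            ENNReal.ofReal c *
              ∫⁻ t in Ioc r R,
                ENNReal.ofReal ((r / t) ^ (s * p / qStar p) / t) *
                  locExcess n p f x₀ t := by
  have hq : 1 ≤ qStar p := le_max_left _ _
  have hq0 : 0 < qStar p := zero_lt_one.trans_le hq
  set α := s * p / qStar p
  have hα : 0 < α := by positivity
  set m := (p - 1) / qStar p
  have hm0 : 0 < m := div_pos (by linarith) hq0
  have hm1 : m ≤ 1 := (div_le_one hq0).2 (le_max_right _ _)
  obtain ⟨C, hC, hT⟩ := exists_tailFn_rpow_le n hs hp1
  set θ := ENNReal.ofReal (2⁻¹ ^ α) with hθ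
  have hθ1 : θ < 1 := by
    rw [hθ, ENNReal.ofReal_lt_one]
    exact Real.rpow_lt_one (by norm_num) (by norm_num) hα
  have hθ0 : 1 - θ ≠ 0 := (tsub_pos_of_lt hθ1).ne'
  set K₁ := (1 + C) ^ (1 / m)
  set K₂ := (1 - θ) * (C / (1 - θ)) ^ (1 / m)
  set K : ℝ≥0∞ := 2 * 2 ^ n + K₁ + K₂
  have hm' : 0 ≤ 1 / m := by positivity
  have hK : K ≠ ⊤ := by
    have hdiv : C / (1 - θ) ≠ ⊤ := ENNReal.div_ne_top hC hθ0
    simp only [K, K₁, K₂]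
    finiteness
  obtain ⟨c, hc, H⟩ := le_of_dyadic_recursion hα hK
  refine ⟨c.toReal + 1, by positivity, fun f x₀ R r hf hfq _ hR hr hrR ↦ ?_⟩
  have hfi (r : ℝ) (hr : 0 < r) := integrable_ballMeasure hq hf hfq x₀ hr
  have key := H (fun t ↦ tailFn n s p (fun x ↦ f x - ballAvg n f x₀ t) x₀ t)
    (fun t ↦ locExcess n p f x₀ t)
    (fun r ρ hr h1 h2 ↦ by
      refine (locExcess_le_of_le_two_mul hf x₀ hr h1 h2 (hfi r hr)).trans ?_
      gcongr
      exact le_self_add.trans le_self_add)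
    (fun r ρ hr h1 h2 ↦ by
      have hρ := hr.trans_le h1
      have hle : ENNReal.ofReal ((r / ρ) ^ α) ≤ 1 := ENNReal.ofReal_le_one.2
        (Real.rpow_le_one (by positivity) ((div_le_one hρ).2 h1) hα.le)
      have h := (hT f x₀ r ρ hf (hfi r hr) hr h1 h2).trans
        (add_le_add (mul_le_of_le_one_left zero_le hle) le_rfl)
      refine (ENNReal.le_mul_add_of_rpow_le hm0 h).trans ?_
      gcongr
      exact le_add_self.trans le_self_add)
    (fun r hr ↦ by
      have h := hT f x₀ r (2 * r) hf (hfi r hr) hr (by linarith) le_rfl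
      rw [show r / (2 * r) = 2⁻¹ by field_simp] at h
      refine (ENNReal.le_convex_add_of_rpow_le hm0 hm1 hθ1 h).trans ?_
      gcongr
      exact le_add_self)
    r R hr hrR
  have hc1 : c ≤ ENNReal.ofReal (c.toReal + 1) := by
    rw [← ENNReal.ofReal_toReal hc]
    exact ENNReal.ofReal_le_ofReal (by simp)
  refine key.trans ?_
  rw [mul_add, ← mul_assoc, ENNReal.ofReal_mul (by positivity), excess]
  gcongr
end
end
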